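/- Let S be a 2-dimensional linear subspace of ℝ^{2n} ≅ ℂⁿ on which the standard symplectic form ω_std does not vanish identically, let S^{⊥ω} = {v : ω_std(v,s) = 0 for all s ∈ S} be its symplectic orthogonal complement (so ℂⁿ = S ⊕ S^{⊥ω}), and let π_S : ℂⁿ → S be the linear projection with kernel S^{⊥ω}. Then for every symplectic embedding ψ : B^{2n}(r) → ℂⁿ of the open ball of capacity r, the shadow π_S(ψ(B^{2n}(r))) has area at least r with respect to the area induced by ω_std on S. -/

import Mathlib

open MeasureTheory Real

/-- The standard symplectic form on `ℂⁿ ≅ ℝ^{2n}`. -/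
noncomputable def omegaStd (n : ℕ) (v w : EuclideanSpace ℂ (Fin n)) : ℝ :=
  ∑ k, ((v k).re * (w k).im - (v k).im * (w k).re)

/-- A symplectic embedding from `U` to `V`. -/
def IsSymplecticEmbedding (n : ℕ) (U V : Set (EuclideanSpace ℂ (Fin n)))
    (ψ : EuclideanSpace ℂ (Fin n) → EuclideanSpace ℂ (Fin n)) : Prop :=
  ContDiffOn ℝ (⊤ : ℕ∞) ψ U ∧ Set.InjOn ψ U ∧ Set.MapsTo ψ U V ∧
    ∀ x ∈ U, ∀ v w, omegaStd n (fderiv ℝ ψ x v) (fderiv ℝ ψ x w) = omegaStd n v w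



namespace NSq

section Brouwer

variable {F : Type*} [NormedAddCommGroup F] [InnerProductSpace ℝ F] [FiniteDimensional ℝ F]

/-- Polynomial dependence of `det (1 + t M)`. -/
lemma exists_poly_det (M : F →L[ℝ] F) :
    ∃ q : Polynomial ℝ, q.natDegree ≤ Module.finrank ℝ F ∧
      ∀ t : ℝ, q.eval t = (ContinuousLinearMap.id ℝ F + t • M).det := by
  classical
  let b := Module.finBasis ℝ F
  let A := LinearMap.toMatrix b b (M : F →ₗ[ℝ] F)
  refine ⟨((Polynomial.X : Polynomial ℝ) • A.map Polynomial.C + (1 : Matrix (Fin (Module.finrank ℝ F)) (Fin (Module.finrank ℝ F)) ℝ).map Polynomial.C).det, ?_, ?_⟩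
  · simpa using Polynomial.natDegree_det_X_add_C_le A 1
  · intro t
    have h1 : (ContinuousLinearMap.id ℝ F + t • M).det
        = LinearMap.det (LinearMap.id + t • (M : F →ₗ[ℝ] F)) := rfl
    rw [h1, ← LinearMap.det_toMatrix b, ← Polynomial.coe_evalRingHom, RingHom.map_det]
    congr 1
    ext i j
    simp [A, Matrix.one_apply, add_comm, apply_ite]
    ring

lemma exists_poly_integrand (M : F →L[ℝ] F) (a v : F) (C : ℝ) (k : ℕ) :
    ∃ q : Polynomial ℝ, q.natDegree ≤ 2 * k + Module.finrank ℝ F ∧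
      ∀ t : ℝ, q.eval t = (1 - ‖a + t • v‖ ^ 2 / C) ^ k *
        (ContinuousLinearMap.id ℝ F + t • M).det := by
  obtain ⟨q, hq, hq'⟩ := exists_poly_det M
  refine ⟨(Polynomial.C (-(‖v‖ ^ 2 / C)) * Polynomial.X ^ 2
      + Polynomial.C (-(2 * inner ℝ a v / C)) * Polynomial.X
      + Polynomial.C (1 - ‖a‖ ^ 2 / C)) ^ k * q, ?_, ?_⟩
  · refine Polynomial.natDegree_mul_le.trans (add_le_add ?_ hq)
    refine Polynomial.natDegree_pow_le.trans ?_
    rw [mul_comm 2 k]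
    exact Nat.mul_le_mul_left _ Polynomial.natDegree_quadratic_le
  · intro t
    rw [Polynomial.eval_mul, hq']
    congr 1
    rw [Polynomial.eval_pow]
    congr 1
    have : ‖a + t • v‖ ^ 2 = ‖a‖ ^ 2 + 2 * (t * inner ℝ a v) + t ^ 2 * ‖v‖ ^ 2 := by
      rw [norm_add_sq_real, inner_smul_right, norm_smul, mul_pow, norm_eq_abs, sq_abs]
    simp [this]
    ring

lemma lagrange_weights (D : ℕ) (t₀ : ℝ) (ht₀ : 0 < t₀) :
    ∃ (w : Fin (D + 1) → ℝ) (s : Fin (D + 1) → ℝ), (∀ i, 0 ≤ s i ∧ s i ≤ t₀) ∧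
      ∀ q : Polynomial ℝ, q.natDegree ≤ D → q.eval 1 = ∑ i, w i * q.eval (s i) := by
  classical
  let s : Fin (D + 1) → ℝ := fun i => t₀ * ((i : ℕ) : ℝ) / (D + 1)
  have hD : (0 : ℝ) < D + 1 := by positivity
  refine ⟨fun i => (Lagrange.basis Finset.univ s i).eval 1, s, ?_, ?_⟩
  · intro i
    have hi : ((i : ℕ) : ℝ) ≤ D + 1 := by exact_mod_cast i.2.le
    refine ⟨by positivity, ?_⟩
    simp only [s]
    rw [div_le_iff₀ hD]
    exact mul_le_mul_of_nonneg_left hi ht₀.le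
  · intro q hq
    have hinj : Set.InjOn s (Finset.univ : Finset (Fin (D + 1))) := by
      intro i _ j _ h
      simp only [s] at h
      have h2 : ((i : ℕ) : ℝ) = ((j : ℕ) : ℝ) := by
        field_simp at h
        exact h
      exact Fin.ext (by exact_mod_cast h2)
    have := Lagrange.eq_interpolate (f := q) hinj (by
      rw [Finset.card_univ, Fintype.card_fin]
      exact lt_of_le_of_lt Polynomial.degree_le_natDegree (by exact_mod_cast Nat.lt_succ_of_le hq))
    conv_lhs => rw [this]
    rw [Lagrange.interpolate_apply, Polynomial.eval_finsetSum]
    refine Finset.sum_congr rfl fun i _ => ?_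
    rw [Polynomial.eval_mul, Polynomial.eval_C, mul_comm]

lemma det_pos_of_small (M : F →L[ℝ] F) (t : ℝ) (ht : 0 ≤ t) (h : t * ‖M‖ < 1) :
    0 < (ContinuousLinearMap.id ℝ F + t • M).det := by
  obtain ⟨q, -, hq⟩ := exists_poly_det M
  rw [← hq]
  by_contra! hneg
  have h0 : q.eval 0 = 1 := by rw [hq]; simp [ContinuousLinearMap.det]
  have hcont : ContinuousOn (fun s => q.eval s) (Set.Icc 0 t) := q.continuous.continuousOn
  have := intermediate_value_Icc' ht hcont
  obtain ⟨s, hs, hs0⟩ := this ⟨hneg, by rw [h0]; norm_num⟩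
  have hs0' : (ContinuousLinearMap.id ℝ F + s • M).det = 0 := by rw [← hq]; exact hs0
  have : ∃ v : F, v ≠ 0 ∧ v + s • M v = 0 := by
    have h2 : LinearMap.det (LinearMap.id + s • (M : F →ₗ[ℝ] F)) = 0 := hs0'
    have := LinearMap.bot_lt_ker_of_det_eq_zero h2
    obtain ⟨v, hv, hv0⟩ := (Submodule.ne_bot_iff _).1 this.ne'
    exact ⟨v, hv0, by simpa using hv⟩
  obtain ⟨v, hv0, hv⟩ := this
  have h1 : ‖v‖ = ‖s • M v‖ := by
    have h := congrArg norm (eq_neg_of_add_eq_zero_left hv)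
    rwa [norm_neg] at h
  have h2 : ‖s • M v‖ ≤ t * ‖M‖ * ‖v‖ := by
    rw [norm_smul, norm_eq_abs, abs_of_nonneg hs.1, mul_assoc]
    exact mul_le_mul hs.2 (M.le_opNorm v) (norm_nonneg _) ht
  have h3 : 0 < ‖v‖ := norm_pos_iff.2 hv0
  nlinarith

end Brouwer

section Brouwer2

variable {F : Type*} [NormedAddCommGroup F] [InnerProductSpace ℝ F] [FiniteDimensional ℝ F]
  [MeasurableSpace F] [BorelSpace F]

lemma change_var_small {u : F → F} (hu : ContDiff ℝ 1 u) {K : NNReal} (hK : LipschitzWith K u)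
    {R : ℝ} (hR : ∀ x, x ∉ Metric.closedBall (0 : F) R → u x = 0)
    {t : ℝ} (ht : 0 ≤ t) (htK : t * K < 1) (p : F → ℝ) :
    ∫ x in Metric.closedBall (0 : F) R, p (x + t • u x) *
      (ContinuousLinearMap.id ℝ F + t • fderiv ℝ u x).det
      = ∫ x in Metric.closedBall (0 : F) R, p x := by
  have hinj : Function.Injective (fun x => x + t • u x) := by
    intro x y hxy
    have h1 : x - y = t • (u y - u x) := by
      rw [smul_sub]
      have : x + t • u x = y + t • u y := hxy
      rw [sub_eq_sub_iff_add_eq_add, this, add_comm]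
    have h2 : ‖x - y‖ ≤ t * K * ‖x - y‖ := by
      conv_lhs => rw [h1]
      rw [norm_smul, norm_eq_abs, abs_of_nonneg ht, mul_assoc]
      have := hK.dist_le_mul y x
      rw [dist_eq_norm, dist_eq_norm, norm_sub_rev y x] at this
      exact mul_le_mul_of_nonneg_left this ht
    have h3 : ‖x - y‖ = 0 := by
      by_contra h
      have : 0 < ‖x - y‖ := lt_of_le_of_ne (norm_nonneg _) (Ne.symm h)
      nlinarith
    exact sub_eq_zero.1 (norm_eq_zero.1 h3)
  have hsurj : Function.Surjective (fun x => x + t • u x) := by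
    intro y
    have hc : ContractingWith ⟨t * K, mul_nonneg ht K.2⟩ (fun x => y - t • u x) := by
      refine ⟨by exact_mod_cast htK, ?_⟩
      refine LipschitzWith.of_dist_le_mul fun a b => ?_
      rw [dist_sub_left, dist_smul₀, norm_eq_abs, abs_of_nonneg ht]
      change _ ≤ t * K * dist a b
      rw [mul_assoc]
      exact mul_le_mul_of_nonneg_left (hK.dist_le_mul a b) ht
    refine ⟨hc.fixedPoint _, ?_⟩
    have := hc.fixedPoint_isFixedPt
    have h2 : y - t • u (hc.fixedPoint) = hc.fixedPoint := this
    change hc.fixedPoint + t • u (hc.fixedPoint) = y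
    conv_lhs => lhs; rw [← h2]
    simp
  have himg : (fun x => x + t • u x) '' Metric.closedBall (0 : F) R
      = Metric.closedBall (0 : F) R := by
    ext y
    constructor
    · rintro ⟨x, hx, rfl⟩
      by_contra hy
      have h1 := hR _ hy
      have h2 : (fun x => x + t • u x) (x + t • u x) = (fun x => x + t • u x) x := by
        simp only [] at h1 ⊢
        rw [h1]; simp
      have h3 := hinj h2
      exact hy (by simp only [h3]; exact hx)
    · intro hy
      obtain ⟨x, hx⟩ := hsurj y
      refine ⟨x, ?_, hx⟩
      by_contra hx'
      have h1 := hR _ hx'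
      simp only [h1, smul_zero, add_zero] at hx
      exact hx' (hx ▸ hy)
  have hder : ∀ x, HasFDerivAt (fun x => x + t • u x)
      (ContinuousLinearMap.id ℝ F + t • fderiv ℝ u x) x := fun x =>
    (hasFDerivAt_id x).add (((hu.differentiable (by norm_num)) x).hasFDerivAt.const_smul t)
  have := integral_image_eq_integral_abs_det_fderiv_smul (volume : Measure F)
    (Metric.isClosed_closedBall (x := (0 : F)) (ε := R)).measurableSet
    (fun x _ => (hder x).hasFDerivWithinAt) (hinj.injOn) p
  rw [himg] at this
  rw [this]
  refine setIntegral_congr_fun Metric.isClosed_closedBall.measurableSet fun x _ => ?_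
  have hM : ‖fderiv ℝ u x‖ ≤ K := norm_fderiv_le_of_lipschitz ℝ hK
  have hpos := det_pos_of_small (fderiv ℝ u x) t ht
    (lt_of_le_of_lt (mul_le_mul_of_nonneg_left hM ht) htK)
  simp only [smul_eq_mul]
  rw [abs_of_pos hpos, mul_comm]

lemma brouwer_smooth {u : F → F} (hu : ContDiff ℝ 1 u) (hc : HasCompactSupport u) :
    Function.Surjective (fun x => x + u x) := by
  intro y₀
  by_contra! hmiss
  obtain ⟨K, hK⟩ := ContDiff.lipschitzWith_of_hasCompactSupport hc hu (by norm_num)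
  obtain ⟨R₁, hR₁⟩ := hc.isCompact.isBounded.subset_closedBall (0 : F)
  obtain ⟨Cu, hCu⟩ := hc.exists_bound_of_continuous hu.continuous
  have hCu0 : 0 ≤ Cu := (norm_nonneg _).trans (hCu 0)
  set R : ℝ := max R₁ (‖y₀‖ + 1) with hRdef
  have hR : ∀ x, x ∉ Metric.closedBall (0 : F) R → u x = 0 := by
    intro x hx
    by_contra h
    exact hx (Metric.closedBall_subset_closedBall (le_max_left _ _)
      (hR₁ (subset_tsupport u h)))
  have hRpos : 0 < R := lt_of_lt_of_le (by positivity) (le_max_right _ _)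
  have hcontG : Continuous (fun x => ‖x + u x - y₀‖) := by
    have := hu.continuous; fun_prop
  -- distance
  obtain ⟨x₁, hx₁, hmin⟩ := (isCompact_closedBall (0 : F) R).exists_isMinOn
    ⟨0, by simp [hRpos.le]⟩ hcontG.continuousOn
  set δ₀ := ‖x₁ + u x₁ - y₀‖ with hδ₀
  have hδ₀pos : 0 < δ₀ := norm_pos_iff.2 (sub_ne_zero.2 (hmiss x₁))
  set δ := min δ₀ 1 with hδ
  have hδpos : 0 < δ := lt_min hδ₀pos one_pos
  have hδle : ∀ x ∈ Metric.closedBall (0 : F) R, δ ≤ ‖x + u x - y₀‖ := fun x hx =>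
    (min_le_left _ _).trans (hmin hx)
  set C : ℝ := (R + Cu + ‖y₀‖ + 1) ^ 2 with hC
  have hCbase : 1 ≤ R + Cu + ‖y₀‖ + 1 := by have := norm_nonneg y₀; linarith
  have hCpos : 0 < C := by positivity
  have hδC : δ ^ 2 ≤ C := by
    rw [hC]
    have : δ ≤ 1 := min_le_right _ _
    exact pow_le_pow_left₀ hδpos.le (this.trans hCbase) 2
  -- the key identity
  have key : ∀ k : ℕ, ∫ x in Metric.closedBall (0 : F) R, (1 - ‖x + u x - y₀‖ ^ 2 / C) ^ k *
      (ContinuousLinearMap.id ℝ F + fderiv ℝ u x).det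
      = ∫ x in Metric.closedBall (0 : F) R, (1 - ‖x - y₀‖ ^ 2 / C) ^ k := by
    intro k
    have ht0 : (0 : ℝ) < 1 / (K + 1) := by positivity
    obtain ⟨w, s, hs, hw⟩ := lagrange_weights (2 * k + Module.finrank ℝ F) (1 / ((K : ℝ) + 1)) ht0
    have hsK : ∀ i, s i * K < 1 := by
      intro i
      have h1 : s i * (K + 1) ≤ 1 := by
        have := (hs i).2
        rwa [le_div_iff₀ (by positivity)] at this
      by_cases h0 : s i = 0
      · simp [h0]
      · have : 0 < s i := lt_of_le_of_ne (hs i).1 (Ne.symm h0)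
        nlinarith
    have hpt : ∀ x, (1 - ‖x + u x - y₀‖ ^ 2 / C) ^ k *
        (ContinuousLinearMap.id ℝ F + fderiv ℝ u x).det
        = ∑ i, w i * ((1 - ‖x + s i • u x - y₀‖ ^ 2 / C) ^ k *
        (ContinuousLinearMap.id ℝ F + s i • fderiv ℝ u x).det) := by
      intro x
      obtain ⟨q, hqd, hq⟩ := exists_poly_integrand (fderiv ℝ u x) (x - y₀) (u x) C k
      have := hw q hqd
      simp only [hq, one_smul] at this
      simpa only [sub_add_eq_add_sub] using this
    have hdetc : ∀ t : ℝ, Continuous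
        (fun x => (ContinuousLinearMap.id ℝ F + t • fderiv ℝ u x).det) := by
      intro t
      have h1 : Continuous (fun x => fderiv ℝ u x) := hu.continuous_fderiv (by norm_num)
      exact ContinuousLinearMap.continuous_det.comp (by fun_prop)
    have hintg : ∀ i, Integrable (fun x => w i * ((1 - ‖x + s i • u x - y₀‖ ^ 2 / C) ^ k *
        (ContinuousLinearMap.id ℝ F + s i • fderiv ℝ u x).det))
        (volume.restrict (Metric.closedBall (0 : F) R)) := by
      intro i
      apply ContinuousOn.integrableOn_compact (isCompact_closedBall _ _)
      have h1 := hdetc (s i)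
      have h2 := hu.continuous
      exact Continuous.continuousOn (by fun_prop)
    have hone : ∀ c : ℝ, c = ∑ i, w i * c := by
      intro c
      have := hw (Polynomial.C c) (by simp)
      simpa using this
    calc _ = ∫ x in Metric.closedBall (0 : F) R, ∑ i, w i * ((1 - ‖x + s i • u x - y₀‖ ^ 2 / C) ^ k *
        (ContinuousLinearMap.id ℝ F + s i • fderiv ℝ u x).det) := by simp only [hpt]
      _ = ∑ i, ∫ x in Metric.closedBall (0 : F) R, w i * ((1 - ‖x + s i • u x - y₀‖ ^ 2 / C) ^ k *
        (ContinuousLinearMap.id ℝ F + s i • fderiv ℝ u x).det) :=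
          integral_finsetSum _ fun i _ => hintg i
      _ = ∑ i, w i * ∫ x in Metric.closedBall (0 : F) R, (1 - ‖x - y₀‖ ^ 2 / C) ^ k := by
          refine Finset.sum_congr rfl fun i _ => ?_
          rw [integral_const_mul]
          congr 1
          exact change_var_small hu hK hR (hs i).1 (hsK i) (fun y => (1 - ‖y - y₀‖ ^ 2 / C) ^ k)
      _ = _ := (hone _).symm
  -- bounds
  have hdetc : Continuous (fun x => (ContinuousLinearMap.id ℝ F + fderiv ℝ u x).det) := by
    have h1 : Continuous (fun x => fderiv ℝ u x) := hu.continuous_fderiv (by norm_num)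
    exact ContinuousLinearMap.continuous_det.comp (by fun_prop)
  set I := ∫ x in Metric.closedBall (0 : F) R,
    |(ContinuousLinearMap.id ℝ F + fderiv ℝ u x).det| with hI
  set v := (volume (Metric.closedBall y₀ (δ / 2))).toReal with hv
  have hvpos : 0 < v := ENNReal.toReal_pos
    (Metric.measure_closedBall_pos volume y₀ (by positivity)).ne'
    (isCompact_closedBall y₀ (δ / 2)).measure_lt_top.ne
  set a := 1 - δ ^ 2 / C with ha
  set b := 1 - (δ / 2) ^ 2 / C with hb
  have ha0 : 0 ≤ a := by
    rw [ha, sub_nonneg, div_le_one hCpos]; exact hδC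
  have hab : a < b := by
    rw [ha, hb]
    have : (δ / 2) ^ 2 / C < δ ^ 2 / C := by
      apply div_lt_div_of_pos_right _ hCpos
      nlinarith
    linarith
  have hb0 : 0 < b := lt_of_le_of_lt ha0 hab
  have hGle : ∀ x ∈ Metric.closedBall (0 : F) R, ‖x + u x - y₀‖ ^ 2 ≤ C := by
    intro x hx
    rw [hC]
    apply pow_le_pow_left₀ (norm_nonneg _)
    have h1 : ‖x‖ ≤ R := by simpa using hx
    have h2 := norm_sub_le (x + u x) y₀
    have h3 := norm_add_le x (u x)
    have h4 := hCu x
    linarith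
  have hle : ∀ x ∈ Metric.closedBall (0 : F) R, ‖x - y₀‖ ^ 2 ≤ C := by
    intro x hx
    rw [hC]
    apply pow_le_pow_left₀ (norm_nonneg _)
    have h1 : ‖x‖ ≤ R := by simpa using hx
    have h2 := norm_sub_le x y₀
    linarith
  have hupper : ∀ k : ℕ, ∫ x in Metric.closedBall (0 : F) R, (1 - ‖x + u x - y₀‖ ^ 2 / C) ^ k *
      (ContinuousLinearMap.id ℝ F + fderiv ℝ u x).det ≤ a ^ k * I := by
    intro k
    rw [hI, ← integral_const_mul]
    apply setIntegral_mono_on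
    · apply ContinuousOn.integrableOn_compact (isCompact_closedBall _ _)
      have h2 := hu.continuous
      exact Continuous.continuousOn (by fun_prop)
    · apply ContinuousOn.integrableOn_compact (isCompact_closedBall _ _)
      exact Continuous.continuousOn (by fun_prop)
    · exact Metric.isClosed_closedBall.measurableSet
    · intro x hx
      have h0 : 0 ≤ 1 - ‖x + u x - y₀‖ ^ 2 / C := by
        rw [sub_nonneg, div_le_one hCpos]; exact hGle x hx
      have h1 : 1 - ‖x + u x - y₀‖ ^ 2 / C ≤ a := by
        rw [ha]
        have : δ ^ 2 / C ≤ ‖x + u x - y₀‖ ^ 2 / C :=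
          div_le_div_of_nonneg_right (pow_le_pow_left₀ hδpos.le (hδle x hx) 2) hCpos.le
        linarith
      calc _ ≤ (1 - ‖x + u x - y₀‖ ^ 2 / C) ^ k *
            |(ContinuousLinearMap.id ℝ F + fderiv ℝ u x).det| :=
            mul_le_mul_of_nonneg_left (le_abs_self _) (pow_nonneg h0 k)
        _ ≤ _ := mul_le_mul_of_nonneg_right (pow_le_pow_left₀ h0 h1 k) (abs_nonneg _)
  have hsub : Metric.closedBall y₀ (δ / 2) ⊆ Metric.closedBall (0 : F) R := by
    intro x hx
    have h1 : ‖x - y₀‖ ≤ δ / 2 := by simpa [dist_eq_norm] using hx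
    have h2 : ‖y₀‖ + 1 ≤ R := le_max_right _ _
    have h3 : δ ≤ 1 := min_le_right _ _
    have h4 : ‖x‖ ≤ ‖x - y₀‖ + ‖y₀‖ := by simpa using norm_add_le (x - y₀) y₀
    simp only [Metric.mem_closedBall, dist_zero_right]
    linarith
  have hlower : ∀ k : ℕ, b ^ k * v ≤ ∫ x in Metric.closedBall (0 : F) R, (1 - ‖x - y₀‖ ^ 2 / C) ^ k := by
    intro k
    have hintk : IntegrableOn (fun x : F => (1 - ‖x - y₀‖ ^ 2 / C) ^ k)
        (Metric.closedBall (0 : F) R) := by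
      apply ContinuousOn.integrableOn_compact (isCompact_closedBall _ _)
      exact Continuous.continuousOn (by fun_prop)
    calc b ^ k * v = ∫ x in Metric.closedBall y₀ (δ / 2), b ^ k := by
          rw [setIntegral_const, smul_eq_mul, mul_comm]; rfl
      _ ≤ ∫ x in Metric.closedBall y₀ (δ / 2), (1 - ‖x - y₀‖ ^ 2 / C) ^ k := by
          apply setIntegral_mono_on
          · exact integrableOn_const (isCompact_closedBall _ _).measure_lt_top.ne
          · exact hintk.mono_set hsub
          · exact Metric.isClosed_closedBall.measurableSet
          · intro x hx
            have h1 : ‖x - y₀‖ ≤ δ / 2 := by simpa [dist_eq_norm] using hx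
            apply pow_le_pow_left₀ hb0.le
            rw [hb]
            have : ‖x - y₀‖ ^ 2 / C ≤ (δ / 2) ^ 2 / C :=
              div_le_div_of_nonneg_right (pow_le_pow_left₀ (norm_nonneg _) h1 2) hCpos.le
            linarith
      _ ≤ _ := by
          apply setIntegral_mono_set hintk
          · filter_upwards [ae_restrict_mem Metric.isClosed_closedBall.measurableSet] with x hx
            apply pow_nonneg
            rw [sub_nonneg, div_le_one hCpos]; exact hle x hx
          · exact hsub.eventuallyLE
  have hall : ∀ k : ℕ, v ≤ (a / b) ^ k * I := by
    intro k
    have h1 := (hlower k).trans ((key k).symm.le.trans (hupper k))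
    rw [div_pow, div_mul_eq_mul_div, le_div_iff₀ (pow_pos hb0 k), mul_comm v]
    exact h1
  have hlim : Filter.Tendsto (fun k : ℕ => (a / b) ^ k * I) Filter.atTop (nhds (0 * I)) :=
    (tendsto_pow_atTop_nhds_zero_of_lt_one (div_nonneg ha0 hb0.le)
      ((div_lt_one hb0).2 hab)).mul_const I
  rw [zero_mul] at hlim
  exact absurd (ge_of_tendsto' hlim hall) (not_le.2 hvpos)

end Brouwer2

section Brouwer3

variable {F : Type*} [NormedAddCommGroup F] [InnerProductSpace ℝ F] [FiniteDimensional ℝ F]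

/-- Brouwer-type theorem: a bounded continuous perturbation of the identity is surjective. -/
theorem brouwer_bounded {u : F → F} (hu : Continuous u) {C : ℝ} (hC : ∀ x, ‖u x‖ ≤ C) :
    Function.Surjective (fun x => x + u x) := by
  borelize F
  intro y₀
  by_contra! hmiss
  have hC0 : 0 ≤ C := (norm_nonneg _).trans (hC 0)
  set R := C + ‖y₀‖ + 1 with hR
  -- cutoff
  let χ : F → ℝ := fun x => max 0 (min 1 (R + 1 - ‖x‖))
  have hχc : Continuous χ := by fun_prop
  have hχ01 : ∀ x, 0 ≤ χ x ∧ χ x ≤ 1 := fun x =>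
    ⟨le_max_left _ _, max_le zero_le_one (min_le_left _ _)⟩
  have hχ1 : ∀ x, ‖x‖ ≤ R → χ x = 1 := by
    intro x hx
    simp only [χ]
    rw [min_eq_left (by linarith), max_eq_right zero_le_one]
  have hχ0 : ∀ x, R + 1 ≤ ‖x‖ → χ x = 0 := by
    intro x hx
    simp only [χ]
    rw [max_eq_left]
    exact (min_le_right _ _).trans (by linarith)
  let u' : F → F := fun x => χ x • u x
  have hu'c : Continuous u' := hχc.smul hu
  have hu'n : ∀ x, ‖u' x‖ ≤ C := by
    intro x
    simp only [u', norm_smul, norm_eq_abs, abs_of_nonneg (hχ01 x).1]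
    calc χ x * ‖u x‖ ≤ 1 * ‖u x‖ := mul_le_mul_of_nonneg_right (hχ01 x).2 (norm_nonneg _)
      _ ≤ C := by rw [one_mul]; exact hC x
  have hbig : ∀ x, R ≤ ‖x‖ → 1 ≤ ‖x + u' x - y₀‖ := by
    intro x hx
    have h1 := hu'n x
    have h2 : ‖x‖ ≤ ‖x + u' x - y₀‖ + ‖u' x‖ + ‖y₀‖ := by
      calc ‖x‖ = ‖(x + u' x - y₀) - u' x + y₀‖ := by congr 1; abel
        _ ≤ ‖(x + u' x - y₀) - u' x‖ + ‖y₀‖ := norm_add_le _ _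
        _ ≤ _ := by gcongr; exact norm_sub_le _ _
    linarith
  have hmiss' : ∀ x, x + u' x ≠ y₀ := by
    intro x hx
    by_cases h : ‖x‖ ≤ R
    · apply hmiss x
      simpa [u', hχ1 x h] using hx
    · have := hbig x (le_of_not_ge h)
      rw [hx] at this
      simp at this
      linarith
  have hcontG : Continuous (fun x => ‖x + u' x - y₀‖) := by fun_prop
  obtain ⟨x₁, hx₁, hmin⟩ := (isCompact_closedBall (0 : F) R).exists_isMinOn
    ⟨0, by simp; positivity⟩ hcontG.continuousOn
  set δ := min ‖x₁ + u' x₁ - y₀‖ 1 with hδ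
  have hδpos : 0 < δ := lt_min (norm_pos_iff.2 (sub_ne_zero.2 (hmiss' x₁))) one_pos
  have hδle : ∀ x, δ ≤ ‖x + u' x - y₀‖ := by
    intro x
    by_cases h : ‖x‖ ≤ R
    · exact (min_le_left _ _).trans (hmin (by simpa using h))
    · exact (min_le_right _ _).trans (hbig x (le_of_not_ge h))
  obtain ⟨g, hg, hgd, hgs⟩ := hu'c.exists_contDiff_approx 1 (ε := fun _ => δ) continuous_const
    (fun _ => hδpos)
  have hgc : HasCompactSupport g := by
    apply HasCompactSupport.intro (isCompact_closedBall (0 : F) (R + 1))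
    intro x hx
    by_contra h
    have : u' x ≠ 0 := hgs h
    apply this
    have h2 : R + 1 ≤ ‖x‖ := by
      simp at hx; exact hx.le
    simp [u', hχ0 x h2]
  obtain ⟨x, hx⟩ := brouwer_smooth hg hgc y₀
  have h1 := hδle x
  have h2 := hgd x
  simp only at hx
  rw [dist_eq_norm] at h2
  have : x + u' x - y₀ = -(g x - u' x) := by rw [← hx]; abel
  rw [this, norm_neg] at h1
  linarith

end Brouwer3

end NSq


namespace NSq

/-- The model space. -/
abbrev V (n : ℕ) := EuclideanSpace ℂ (Fin n)

/-- Frequencies. -/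
abbrev Fr (N : ℕ) := {k : ℤ // k ∈ Finset.Icc (-(N : ℤ)) (N : ℤ)}

/-- Trigonometric polynomials of degree at most `N`. -/
abbrev TP (n N : ℕ) := PiLp 2 (fun _ : Fr N => V n)

/-- The exponential `e^{2π i k t}`. -/
noncomputable def ex (k : ℤ) (t : ℝ) : ℂ := Complex.exp ((2 * π * k * t : ℝ) * Complex.I)

lemma norm_ex (k : ℤ) (t : ℝ) : ‖ex k t‖ = 1 := Complex.norm_exp_ofReal_mul_I _

lemma continuous_ex (k : ℤ) : Continuous (ex k) := by
  unfold ex; fun_prop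

lemma star_ex (k : ℤ) (t : ℝ) : (starRingEnd ℂ) (ex k t) = ex (-k) t := by
  unfold ex
  rw [← Complex.exp_conj]
  congr 1
  rw [map_mul, Complex.conj_ofReal, Complex.conj_I]
  push_cast
  ring

lemma ex_mul (k l : ℤ) (t : ℝ) : ex k t * ex l t = ex (k + l) t := by
  unfold ex
  rw [← Complex.exp_add]
  congr 1
  push_cast
  ring

lemma ex_zero (t : ℝ) : ex 0 t = 1 := by simp [ex]

lemma ex_at_zero (k : ℤ) : ex k 0 = 1 := by simp [ex]

lemma ex_at_one (k : ℤ) : ex k 1 = 1 := by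
  unfold ex
  rw [Complex.exp_eq_one_iff]
  exact ⟨k, by push_cast; ring⟩

lemma hasDerivAt_ex (k : ℤ) (t : ℝ) :
    HasDerivAt (ex k) ((2 * π * k : ℝ) * Complex.I * ex k t) t := by
  unfold ex
  have h1 : HasDerivAt (fun t : ℝ => ((2 * π * k * t : ℝ) : ℂ) * Complex.I)
      ((2 * π * k : ℝ) * Complex.I) t := by
    have h0 : HasDerivAt (fun t : ℝ => (2 * π * k * t : ℝ)) (2 * π * k) t := by
      simpa using (hasDerivAt_id t).const_mul (2 * π * k)
    exact (h0.ofReal_comp).mul_const Complex.I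
  have := h1.cexp
  convert this using 1
  rw [mul_comm]

lemma integral_ex (k : ℤ) : ∫ t in (0:ℝ)..1, ex k t = if k = 0 then 1 else 0 := by
  split_ifs with h
  · subst h; simp [ex_zero]
  · have hc : ((2 * π * k : ℝ) : ℂ) * Complex.I ≠ 0 := by
      simp [h, Real.pi_ne_zero]
    have h1 : ∀ t ∈ Set.uIcc (0:ℝ) 1,
        HasDerivAt (fun t => ex k t / (((2 * π * k : ℝ) : ℂ) * Complex.I)) (ex k t) t := by
      intro t _
      have := (hasDerivAt_ex k t).div_const (((2 * π * k : ℝ) : ℂ) * Complex.I)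
      rwa [mul_div_cancel_left₀ _ hc] at this
    rw [intervalIntegral.integral_eq_sub_of_hasDerivAt h1
      ((continuous_ex k).intervalIntegrable _ _), ex_at_one, ex_at_zero, sub_self]

variable {n N : ℕ}

/-- Evaluation of a trigonometric polynomial. -/
noncomputable def ev (x : TP n N) (t : ℝ) : V n := ∑ k : Fr N, ex k t • x k

lemma continuous_ev (x : TP n N) : Continuous (ev x) := by
  unfold ev
  refine continuous_finsetSum _ fun k _ => ?_
  exact (continuous_ex k).smul continuous_const

lemma continuous_ev2 : Continuous (fun q : TP n N × ℝ => ev q.1 q.2) := by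
  unfold ev
  refine continuous_finsetSum _ fun k _ => ?_
  exact ((continuous_ex k).comp continuous_snd).smul (by fun_prop)

lemma ev_add (x y : TP n N) (t : ℝ) : ev (x + y) t = ev x t + ev y t := by
  simp [ev, Finset.sum_add_distrib]

lemma ev_sub (x y : TP n N) (t : ℝ) : ev (x - y) t = ev x t - ev y t := by
  simp [ev, smul_sub, Finset.sum_sub_distrib]

/-- real inner product versus the exponential. -/
lemma inner_ex_smul (k : ℤ) (t : ℝ) (v w : V n) :
    inner ℝ (ex (-k) t • v) w = inner ℝ v (ex k t • w) := by
  simp only [PiLp.inner_apply, PiLp.smul_apply, smul_eq_mul]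
  refine Finset.sum_congr rfl fun j _ => ?_
  rw [Complex.inner, Complex.inner, map_mul, star_ex, neg_neg]
  congr 1; ring

lemma integral_inner_ex (k : ℤ) (v w : V n) :
    ∫ t in (0:ℝ)..1, inner ℝ v (ex k t • w) = if k = 0 then inner ℝ v w else 0 := by
  have h1 : ∫ t in (0:ℝ)..1, inner ℝ v (ex k t • w) =
      inner ℝ v (∫ t in (0:ℝ)..1, ex k t • w) := by
    have := (innerSL ℝ v).intervalIntegral_comp_comm (μ := volume) (a := 0) (b := 1)
      (f := fun t => ex k t • w)
      (((continuous_ex k).smul continuous_const).intervalIntegrable _ _)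
    simpa using this
  rw [h1, intervalIntegral.integral_smul_const, integral_ex]
  split_ifs <;> simp

/-- Parseval. -/
lemma parseval (x y : TP n N) :
    ∫ t in (0:ℝ)..1, inner ℝ (ev x t) (ev y t) = inner ℝ x y := by
  have h1 : ∀ t, inner ℝ (ev x t) (ev y t)
      = ∑ k : Fr N, ∑ l : Fr N, inner ℝ (x k) (ex (l - k) t • y l) := by
    intro t
    unfold ev
    rw [sum_inner]
    refine Finset.sum_congr rfl fun k _ => ?_
    rw [inner_sum]
    refine Finset.sum_congr rfl fun l _ => ?_
    have := inner_ex_smul (-(k:ℤ)) t (x k) (ex l t • y l)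
    rw [neg_neg] at this
    rw [this, smul_smul, ex_mul]
    congr 3
    ring
  have hc : ∀ (k l : Fr N), Continuous (fun t => inner ℝ (x k) (ex (l - k) t • y l)) := by
    intro k l
    exact continuous_const.inner ((continuous_ex _).smul continuous_const)
  simp only [h1]
  rw [intervalIntegral.integral_finsetSum]
  swap
  · intro k _
    exact (continuous_finsetSum _ fun l _ => hc k l).intervalIntegrable _ _
  rw [PiLp.inner_apply]
  refine Finset.sum_congr rfl fun k _ => ?_
  rw [intervalIntegral.integral_finsetSum fun l _ => (hc k l).intervalIntegrable _ _]
  simp only [integral_inner_ex]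
  rw [Finset.sum_eq_single k]
  · simp
  · intro l _ hl
    rw [if_neg]
    intro h
    exact hl (Subtype.ext (by linarith))
  · simp

lemma parseval_norm (x : TP n N) : ∫ t in (0:ℝ)..1, ‖ev x t‖ ^ 2 = ‖x‖ ^ 2 := by
  rw [← real_inner_self_eq_norm_sq, ← parseval]
  simp only [real_inner_self_eq_norm_sq]

/-- Fourier coefficients up to order `N`. -/
noncomputable def cf (N : ℕ) (g : ℝ → V n) : TP n N :=
  WithLp.toLp 2 fun k : Fr N => ∫ t in (0:ℝ)..1, ex (-(k:ℤ)) t • g t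

lemma inner_cf (g : ℝ → V n) (hg : Continuous g) (v : TP n N) :
    inner ℝ (cf N g) v = ∫ t in (0:ℝ)..1, inner ℝ (g t) (ev v t) := by
  have hc : ∀ k : Fr N, Continuous (fun t => inner ℝ (g t) (ex k t • v k)) := fun k =>
    hg.inner ((continuous_ex _).smul continuous_const)
  unfold ev
  simp only [inner_sum]
  rw [intervalIntegral.integral_finsetSum fun k _ => (hc k).intervalIntegrable _ _]
  rw [PiLp.inner_apply]
  refine Finset.sum_congr rfl fun k _ => ?_
  have := (innerSL ℝ (v k)).intervalIntegral_comp_comm (μ := volume) (a := 0) (b := 1)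
      (f := fun t => ex (-(k:ℤ)) t • g t)
      (((continuous_ex _).smul hg).intervalIntegrable _ _)
  simp only [innerSL_apply_apply] at this
  change inner ℝ (∫ t in (0:ℝ)..1, ex (-(k:ℤ)) t • g t) (v k) = _
  rw [real_inner_comm, ← this]
  refine intervalIntegral.integral_congr fun t _ => ?_
  simp only
  rw [real_inner_comm, inner_ex_smul]

/-- Bessel. -/
lemma norm_cf_le (g : ℝ → V n) (hg : Continuous g) {K : ℝ} (hK : ∀ t, ‖g t‖ ≤ K) :
    ‖cf N g‖ ≤ K := by
  have hK0 : 0 ≤ K := (norm_nonneg _).trans (hK 0)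
  set v := cf N g with hv
  have h1 : ‖v‖ ^ 2 = ∫ t in (0:ℝ)..1, inner ℝ (g t) (ev v t) := by
    rw [← inner_cf g hg, ← real_inner_self_eq_norm_sq]
  have h2 : ∫ t in (0:ℝ)..1, inner ℝ (g t) (ev v t)
      ≤ ∫ t in (0:ℝ)..1, (K ^ 2 / 2 + ‖ev v t‖ ^ 2 / 2) := by
    have hcv := continuous_ev v
    apply intervalIntegral.integral_mono_on zero_le_one
    · exact (hg.inner hcv).intervalIntegrable _ _
    · exact Continuous.intervalIntegrable (by fun_prop) _ _
    · intro t _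
      have h3 := real_inner_le_norm (g t) (ev v t)
      have h4 : ‖g t‖ * ‖ev v t‖ ≤ K * ‖ev v t‖ :=
        mul_le_mul_of_nonneg_right (hK t) (norm_nonneg _)
      nlinarith [sq_nonneg (K - ‖ev v t‖)]
  have h3 : ∫ t in (0:ℝ)..1, (K ^ 2 / 2 + ‖ev v t‖ ^ 2 / 2) = K ^ 2 / 2 + ‖v‖ ^ 2 / 2 := by
    have hcv := continuous_ev v
    rw [intervalIntegral.integral_add (by simp) (Continuous.intervalIntegrable (by fun_prop) _ _),
      intervalIntegral.integral_div, intervalIntegral.integral_div, parseval_norm]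
    simp
  rw [h3, ← h1] at h2
  have : ‖v‖ ^ 2 ≤ K ^ 2 := by linarith
  exact abs_le_of_sq_le_sq' this hK0 |>.2

/-- Diagonal real operator on `V n`. -/
noncomputable def dg (c : Fin n → ℝ) (z : V n) : V n := WithLp.toLp 2 fun j => (c j : ℂ) * z j

lemma dg_apply (c : Fin n → ℝ) (z : V n) (j : Fin n) : dg c z j = (c j : ℂ) * z j := rfl

lemma continuous_dg (c : Fin n → ℝ) : Continuous (dg c) := by
  unfold dg
  fun_prop

lemma norm_dg_sq (c : Fin n → ℝ) (z : V n) : ‖dg c z‖ ^ 2 = ∑ j, (c j) ^ 2 * ‖z j‖ ^ 2 := by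
  rw [EuclideanSpace.norm_sq_eq]
  refine Finset.sum_congr rfl fun j _ => ?_
  rw [dg_apply, norm_mul, mul_pow, Complex.norm_real, norm_eq_abs, sq_abs]

/-- The diagonal operator on trigonometric polynomials. -/
noncomputable def dgT (c : Fin n → ℝ) (x : TP n N) : TP n N := WithLp.toLp 2 fun k => dg c (x k)

lemma ev_dgT (c : Fin n → ℝ) (x : TP n N) (t : ℝ) : ev (dgT c x) t = dg c (ev x t) := by
  ext j
  simp only [ev, dgT, dg_apply, WithLp.ofLp_sum, Finset.sum_apply, PiLp.smul_apply, smul_eq_mul,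
    Finset.mul_sum]
  refine Finset.sum_congr rfl fun k _ => ?_
  ring

lemma cf_ev (x : TP n N) : cf N (ev x) = x := by
  apply ext_inner_right ℝ
  intro v
  rw [inner_cf _ (continuous_ev x), parseval]

lemma cf_add (g h : ℝ → V n) (hg : Continuous g) (hh : Continuous h) :
    cf N (fun t => g t + h t) = cf N g + cf N h := by
  apply ext_inner_right ℝ
  intro v
  have hv := continuous_ev v
  rw [inner_add_left, inner_cf _ hg, inner_cf _ hh, inner_cf (fun t => g t + h t) (hg.add hh)]
  simp only [inner_add_left]
  rw [intervalIntegral.integral_add ((hg.inner hv).intervalIntegrable _ _)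
    ((hh.inner hv).intervalIntegrable _ _)]

end NSq


namespace NSq

/-- The Hamiltonians we consider: quadratic at infinity, vanishing near `p`. -/
structure Ham (n : ℕ) (i₀ : Fin n) (H : V n → ℝ) (X : V n → V n) (c : Fin n → ℝ)
    (m Lp K ρ : ℝ) (p : V n) : Prop where
  Hc : Continuous H
  Lp0 : 0 ≤ Lp
  XL : ∀ a b, ‖X a - X b‖ ≤ Lp * ‖a - b‖
  HT : ∀ a b, |H (a + b) - H a - inner ℝ (X a) b| ≤ Lp * ‖b‖ ^ 2
  H0 : ∀ z, 0 ≤ H z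
  Hinf : ∀ z, π * ∑ j, c j * ‖z j‖ ^ 2 - m ≤ H z
  Xinf : ∀ z, ‖X z - dg (fun j => 2 * π * c j) z‖ ≤ K
  c1 : 1 < c i₀
  c2 : c i₀ < 2
  cpos : ∀ j, 0 < c j
  clt : ∀ j, j ≠ i₀ → c j < 1
  ρ0 : 0 < ρ
  flat : ∀ a, ‖a‖ ≤ ρ → H (p + a) = 0 ∧ X (p + a) = 0

variable {n N : ℕ} {i₀ : Fin n} {H : V n → ℝ} {X : V n → V n} {c : Fin n → ℝ}
  {m Lp K ρ : ℝ} {p : V n}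

lemma Ham.Xc (h : Ham n i₀ H X c m Lp K ρ p) : Continuous X := by
  have : LipschitzWith ⟨Lp, h.Lp0⟩ X := by
    refine LipschitzWith.of_dist_le_mul fun a b => ?_
    rw [dist_eq_norm, dist_eq_norm]
    exact h.XL a b
  exact this.continuous

/-- Quadratic part of the action. -/
noncomputable def qd (x : TP n N) : ℝ := π * ∑ k : Fr N, ((k : ℤ) : ℝ) * ‖x k‖ ^ 2

/-- The action functional. -/
noncomputable def Act (H : V n → ℝ) (x : TP n N) : ℝ := qd x - ∫ t in (0:ℝ)..1, H (ev x t)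

/-- Linear part of the gradient. -/
noncomputable def Dop (x : TP n N) : TP n N :=
  WithLp.toLp 2 fun k : Fr N => (2 * π * ((k : ℤ) : ℝ)) • x k

/-- The gradient of the action functional. -/
noncomputable def Gr (X : V n → V n) (x : TP n N) : TP n N := Dop x - cf N (fun t => X (ev x t))

lemma continuous_Act (hH : Continuous H) : Continuous (Act H : TP n N → ℝ) := by
  unfold Act qd
  refine Continuous.sub (by fun_prop) ?_
  apply intervalIntegral.continuous_parametric_intervalIntegral_of_continuous'
  exact hH.comp continuous_ev2

lemma continuous_Gr (hX : Continuous X) : Continuous (Gr X : TP n N → TP n N) := by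
  unfold Gr Dop cf
  refine Continuous.sub (by fun_prop) ?_
  refine (PiLp.continuous_toLp 2 _).comp (continuous_pi fun k => ?_)
  apply intervalIntegral.continuous_parametric_intervalIntegral_of_continuous'
  exact ((continuous_ex _).comp continuous_snd).smul (hX.comp continuous_ev2)

lemma qd_add (x v : TP n N) : qd (x + v) = qd x + inner ℝ (Dop x) v + qd v := by
  unfold qd Dop
  rw [PiLp.inner_apply, Finset.mul_sum, Finset.mul_sum, Finset.mul_sum, ← Finset.sum_add_distrib,
    ← Finset.sum_add_distrib]
  refine Finset.sum_congr rfl fun k _ => ?_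
  simp only [PiLp.add_apply]
  rw [norm_add_sq_real, real_inner_smul_left]
  ring

lemma norm_sq_TP (x : TP n N) : ‖x‖ ^ 2 = ∑ k, ‖x k‖ ^ 2 := PiLp.norm_sq_eq_of_L2 _ x

lemma qd_le (v : TP n N) : qd v ≤ π * N * ‖v‖ ^ 2 := by
  rw [norm_sq_TP, mul_assoc, Finset.mul_sum]
  unfold qd
  apply mul_le_mul_of_nonneg_left _ pi_pos.le
  apply Finset.sum_le_sum
  intro k _
  apply mul_le_mul_of_nonneg_right _ (by positivity)
  exact_mod_cast (Finset.mem_Icc.1 k.2).2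

lemma Ham.descent (h : Ham n i₀ H X c m Lp K ρ p) (x v : TP n N) :
    Act H (x + v) ≤ Act H x + inner ℝ (Gr X x) v + (π * N + Lp) * ‖v‖ ^ 2 := by
  have hc1 := continuous_ev x
  have hc2 := continuous_ev v
  have hH := h.Hc
  have hX := h.Xc
  have h1 : ∫ t in (0:ℝ)..1, (H (ev x t) + inner ℝ (X (ev x t)) (ev v t) - Lp * ‖ev v t‖ ^ 2)
      ≤ ∫ t in (0:ℝ)..1, H (ev (x + v) t) := by
    apply intervalIntegral.integral_mono_on zero_le_one
    · exact Continuous.intervalIntegrable (by fun_prop) _ _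
    · exact (hH.comp (continuous_ev _)).intervalIntegrable _ _
    · intro t _
      rw [ev_add]
      have := (abs_le.1 (h.HT (ev x t) (ev v t))).1
      linarith
  rw [intervalIntegral.integral_sub, intervalIntegral.integral_add,
    intervalIntegral.integral_const_mul, parseval_norm,
    ← inner_cf (fun t => X (ev x t)) (hX.comp hc1)] at h1
  · unfold Act Gr
    rw [qd_add, inner_sub_left]
    have := qd_le v
    linarith
  · exact Continuous.intervalIntegrable (by fun_prop) _ _
  · exact Continuous.intervalIntegrable (by fun_prop) _ _
  · exact Continuous.intervalIntegrable (by fun_prop) _ _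
  · exact Continuous.intervalIntegrable (by fun_prop) _ _

lemma Ham.exists_gap (h : Ham n i₀ H X c m Lp K ρ p) :
    ∃ d : ℝ, 0 < d ∧ ∀ (j : Fin n) (k : ℤ), d ^ 2 ≤ (2 * π * (k - c j)) ^ 2 := by
  have h1 : ∀ j : Fin n, ∃ d : ℝ, 0 < d ∧ ∀ k : ℤ, d ≤ |(k:ℝ) - c j| := by
    intro j
    by_cases hj : j = i₀
    · subst hj
      refine ⟨min (c j - 1) (2 - c j), lt_min (by linarith [h.c1]) (by linarith [h.c2]), ?_⟩
      intro k
      rcases le_or_gt k 1 with hk | hk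
      · have : (k:ℝ) ≤ 1 := by exact_mod_cast hk
        rw [abs_sub_comm]
        exact (min_le_left _ _).trans ((by linarith : c j - 1 ≤ c j - k).trans (le_abs_self _))
      · have : (2:ℝ) ≤ k := by exact_mod_cast hk
        exact (min_le_right _ _).trans ((by linarith : 2 - c j ≤ k - c j).trans (le_abs_self _))
    · refine ⟨min (c j) (1 - c j), lt_min (h.cpos j) (by linarith [h.clt j hj]), ?_⟩
      intro k
      rcases le_or_gt k 0 with hk | hk
      · have : (k:ℝ) ≤ 0 := by exact_mod_cast hk
        rw [abs_sub_comm]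
        exact (min_le_left _ _).trans ((by linarith : c j ≤ c j - k).trans (le_abs_self _))
      · have : (1:ℝ) ≤ k := by exact_mod_cast hk
        exact (min_le_right _ _).trans ((by linarith : 1 - c j ≤ k - c j).trans (le_abs_self _))
  choose d hd hd' using h1
  haveI : Nonempty (Fin n) := ⟨i₀⟩
  obtain ⟨j₀, hj₀⟩ := Finite.exists_min d
  refine ⟨d j₀, hd j₀, fun j k => ?_⟩
  rw [← sq_abs (2 * π * (k - c j)), abs_mul, abs_of_pos (by positivity : 0 < 2 * π)]
  apply pow_le_pow_left₀ (hd j₀).le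
  have h3 := (hj₀ j).trans (hd' j k)
  have h4 := pi_gt_three
  nlinarith [abs_nonneg ((k:ℝ) - c j)]

lemma Ham.coercive (h : Ham n i₀ H X c m Lp K ρ p) {d : ℝ} (hd : 0 < d)
    (hgap : ∀ (j : Fin n) (k : ℤ), d ^ 2 ≤ (2 * π * (k - c j)) ^ 2) (x : TP n N) :
    d * ‖x‖ - K ≤ ‖Gr X x‖ := by
  have hX := h.Xc
  have hcx := continuous_ev x
  let b : ℝ → V n := fun t => X (ev x t) - dg (fun j => 2 * π * c j) (ev x t)
  have hb : Continuous b := (hX.comp hcx).sub ((continuous_dg _).comp hcx)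
  let M : TP n N := WithLp.toLp 2 fun k : Fr N => dg (fun j => 2 * π * (((k:ℤ):ℝ) - c j)) (x k)
  have hG : Gr X x = M - cf N b := by
    have h1 : cf N (fun t => X (ev x t)) = cf N b + dgT (fun j => 2 * π * c j) x := by
      have h2 : (fun t => X (ev x t)) = fun t => b t + ev (dgT (fun j => 2 * π * c j) x) t := by
        funext t
        simp [b, ev_dgT]
      rw [h2, cf_add _ _ hb (continuous_ev _), cf_ev]
    unfold Gr
    rw [h1, sub_add_eq_sub_sub_swap]
    congr 1
    ext k j
    simp only [Dop, dgT, M, PiLp.sub_apply, dg_apply, PiLp.smul_apply, Complex.real_smul]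
    push_cast
    ring
  have hM : d * ‖x‖ ≤ ‖M‖ := by
    apply le_of_sq_le_sq _ (norm_nonneg _)
    rw [mul_pow, norm_sq_TP, norm_sq_TP, Finset.mul_sum]
    apply Finset.sum_le_sum
    intro k _
    simp only [M]
    rw [norm_dg_sq, EuclideanSpace.norm_sq_eq, Finset.mul_sum]
    apply Finset.sum_le_sum
    intro j _
    exact mul_le_mul_of_nonneg_right (hgap j k) (by positivity)
  have hcf : ‖cf N b‖ ≤ K := norm_cf_le b hb fun t => h.Xinf _
  rw [hG]
  have := norm_sub_norm_le M (cf N b)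
  linarith

/-- Positive part of the `H^{1/2}` norm, squared. -/
noncomputable def hp (x : TP n N) : ℝ := ∑ k : Fr N, max ((k : ℤ) : ℝ) 0 * ‖x k‖ ^ 2

lemma hp_nonneg (x : TP n N) : 0 ≤ hp x := Finset.sum_nonneg fun _ _ => by positivity

/-- Restriction of the frequencies. -/
noncomputable def cut (P : ℤ → Prop) [DecidablePred P] (x : TP n N) : TP n N :=
  WithLp.toLp 2 fun k : Fr N => if P k then x k else 0

lemma cut_apply (P : ℤ → Prop) [DecidablePred P] (x : TP n N) (k : Fr N) :
    cut P x k = if P k then x k else 0 := rfl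

lemma Ham.gamma (h : Ham n i₀ H X c m Lp K ρ p) :
    ∃ α : ℝ, 0 < α ∧ ∀ (N : ℕ) (y : TP n N), (∀ k : Fr N, (k:ℤ) < 0 → y k = 0) →
      (∀ k : Fr N, (k:ℤ) = 0 → y k = p) → hp y = α ^ 2 → π / 2 * α ^ 2 ≤ Act H y := by
  obtain ⟨K₁, hK₁⟩ := exists_nat_ge (2 * Lp / π)
  set K₀ : ℕ := K₁ + 1 with hK₀
  have hK₀r : (1:ℝ) ≤ K₀ := by rw [hK₀]; push_cast; linarith [Nat.cast_nonneg (α := ℝ) K₁]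
  have hK₀' : Lp / K₀ ≤ π / 2 := by
    rw [div_le_iff₀ (by linarith)]
    rw [div_le_iff₀ pi_pos] at hK₁
    have : (K₁:ℝ) ≤ K₀ := by rw [hK₀]; push_cast; linarith
    nlinarith [pi_pos]
  refine ⟨ρ / K₀, div_pos h.ρ0 (by linarith), ?_⟩
  intro N y hneg hzero hα
  set α := ρ / K₀ with hαdef
  have hα0 : 0 < α := div_pos h.ρ0 (by linarith)
  have hqd : qd y = π * α ^ 2 := by
    unfold qd
    rw [← hα, hp]
    congr 1
    refine Finset.sum_congr rfl fun k _ => ?_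
    rcases lt_or_ge (k:ℤ) 0 with hk | hk
    · simp [hneg k hk]
    · rw [max_eq_left (by exact_mod_cast hk)]
  -- decomposition
  let yz := cut (fun k => k = 0) y
  let yl := cut (fun k => 1 ≤ k ∧ k ≤ K₀) y
  let yh := cut (fun k => (K₀ : ℤ) < k) y
  have hdec : y = yz + yl + yh := by
    ext1 k
    simp only [PiLp.add_apply, yz, yl, yh, cut_apply]
    have hK1 : (1:ℤ) ≤ K₀ := by exact_mod_cast hK₀r
    rcases lt_trichotomy (k:ℤ) 0 with hk | hk | hk
    · rw [hneg k hk]; simp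
    · rw [if_pos hk, if_neg (by omega), if_neg (by omega)]; simp
    · by_cases hk2 : (k:ℤ) ≤ K₀
      · rw [if_neg (by omega), if_pos (by omega), if_neg (by omega)]; simp
      · rw [if_neg (by omega), if_neg (by omega), if_pos (by omega)]; simp
  have hevz : ∀ t, ev yz t = p := by
    intro t
    unfold ev
    have h0 : (0:ℤ) ∈ Finset.Icc (-(N:ℤ)) N := by simp
    rw [Finset.sum_eq_single (⟨0, h0⟩ : Fr N)]
    · simp [yz, cut_apply, hzero ⟨0, h0⟩ rfl, ex_zero]
    · intro k _ hk
      have : ¬ ((k:ℤ) = 0) := fun h => hk (Subtype.ext h)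
      simp [yz, cut_apply, this]
    · simp
  have hyk : ∀ k : Fr N, 1 ≤ (k:ℤ) → ‖y k‖ ≤ α := by
    intro k hk
    apply le_of_sq_le_sq _ hα0.le
    rw [← hα]
    have hk1 : (1:ℝ) ≤ ((k:ℤ):ℝ) := by exact_mod_cast hk
    calc ‖y k‖ ^ 2 ≤ max ((k:ℤ):ℝ) 0 * ‖y k‖ ^ 2 := by
          have : 1 ≤ max ((k:ℤ):ℝ) 0 := hk1.trans (le_max_left _ _)
          nlinarith [sq_nonneg ‖y k‖]
      _ ≤ hp y := Finset.single_le_sum (f := fun k : Fr N => max ((k:ℤ):ℝ) 0 * ‖y k‖ ^ 2)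
          (fun _ _ => by positivity) (Finset.mem_univ k)
  have hevl : ∀ t, ‖ev yl t‖ ≤ ρ := by
    intro t
    have h1 : ‖ev yl t‖ ≤ ∑ k ∈ (Finset.univ.filter
        (fun k : Fr N => 1 ≤ (k:ℤ) ∧ (k:ℤ) ≤ K₀)), α := by
      unfold ev
      refine (norm_sum_le _ _).trans ?_
      rw [Finset.sum_filter]
      apply Finset.sum_le_sum
      intro k _
      rw [norm_smul, norm_ex, one_mul]
      simp only [yl, cut_apply]
      split_ifs with hk
      · exact hyk k hk.1
      · simp
    have h2 : (Finset.univ.filter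
        (fun k : Fr N => 1 ≤ (k:ℤ) ∧ (k:ℤ) ≤ K₀)).card ≤ K₀ := by
      have : (Finset.Icc (1:ℤ) K₀).card = K₀ := by simp
      rw [← this]
      apply Finset.card_le_card_of_injOn (fun k : Fr N => (k:ℤ))
      · intro k hk
        simp only [Finset.coe_filter, Finset.mem_univ, true_and, Set.mem_ofPred_eq] at hk
        simpa using hk
      · exact Subtype.val_injective.injOn
    rw [Finset.sum_const, nsmul_eq_mul] at h1
    have h3 : ((Finset.univ.filter
        (fun k : Fr N => 1 ≤ (k:ℤ) ∧ (k:ℤ) ≤ K₀)).card : ℝ) * α ≤ K₀ * α :=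
      mul_le_mul_of_nonneg_right (by exact_mod_cast h2) hα0.le
    have h4 : (K₀:ℝ) * α = ρ := by rw [hαdef]; field_simp
    linarith
  have hyh : ‖yh‖ ^ 2 ≤ α ^ 2 / K₀ := by
    rw [norm_sq_TP, ← hα, hp, le_div_iff₀ (by linarith), Finset.sum_mul]
    apply Finset.sum_le_sum
    intro k _
    simp only [yh, cut_apply]
    split_ifs with hk
    · rw [mul_comm]
      apply mul_le_mul_of_nonneg_right _ (by positivity)
      refine le_trans ?_ (le_max_left _ _)
      exact_mod_cast hk.le
    · simp; positivity
  have hintg : ∫ t in (0:ℝ)..1, H (ev y t) ≤ ∫ t in (0:ℝ)..1, Lp * ‖ev yh t‖ ^ 2 := by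
    have := continuous_ev yh
    apply intervalIntegral.integral_mono_on zero_le_one
    · exact (h.Hc.comp (continuous_ev _)).intervalIntegrable _ _
    · exact Continuous.intervalIntegrable (by fun_prop) _ _
    · intro t _
      have h1 : ev y t = p + ev yl t + ev yh t := by
        conv_lhs => rw [hdec]
        rw [ev_add, ev_add, hevz]
      obtain ⟨h2, h3⟩ := h.flat (ev yl t) (hevl t)
      have h4 := (abs_le.1 (h.HT (p + ev yl t) (ev yh t))).2
      rw [h2, h3, inner_zero_left] at h4
      rw [h1]
      linarith
  rw [intervalIntegral.integral_const_mul, parseval_norm] at hintg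
  have h5 : Lp * ‖yh‖ ^ 2 ≤ π / 2 * α ^ 2 := by
    calc Lp * ‖yh‖ ^ 2 ≤ Lp * (α ^ 2 / K₀) := mul_le_mul_of_nonneg_left hyh h.Lp0
      _ = Lp / K₀ * α ^ 2 := by ring
      _ ≤ _ := mul_le_mul_of_nonneg_right hK₀' (by positivity)
  unfold Act
  rw [hqd]
  linarith

lemma Ham.sigma (h : Ham n i₀ H X c m Lp K ρ p) :
    ∃ c₀ : ℝ, 0 < c₀ ∧ ∀ (N : ℕ) (z : TP n N) (s : ℝ), 0 ≤ s → (∀ k : Fr N, 1 < (k:ℤ) → z k = 0) →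
      (∀ k : Fr N, (k:ℤ) = 1 → z k = s • EuclideanSpace.single i₀ (1:ℂ)) →
      Act H z ≤ m - π * c₀ * ‖z‖ ^ 2 ∧ (s = 0 → Act H z ≤ 0) := by
  haveI : Nonempty (Fin n) := ⟨i₀⟩
  obtain ⟨j₀, hj₀⟩ := Finite.exists_min c
  refine ⟨min 1 (min (c j₀) (c i₀ - 1)), lt_min one_pos (lt_min (h.cpos _) (by linarith [h.c1])), ?_⟩
  set c₀ := min 1 (min (c j₀) (c i₀ - 1)) with hc₀
  intro N z s hs hz2 hz1
  have hHc := (h.Hc.comp (continuous_ev z))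
  constructor
  · have h1 : ∫ t in (0:ℝ)..1, (π * ‖ev (dgT (fun j => √(c j)) z) t‖ ^ 2 - m)
        ≤ ∫ t in (0:ℝ)..1, H (ev z t) := by
      have := continuous_ev (dgT (fun j => √(c j)) z)
      apply intervalIntegral.integral_mono_on zero_le_one
      · exact Continuous.intervalIntegrable (by fun_prop) _ _
      · exact hHc.intervalIntegrable _ _
      · intro t _
        have h2 := h.Hinf (ev z t)
        rw [ev_dgT, norm_dg_sq]
        simp only [Real.sq_sqrt (h.cpos _).le]
        exact h2
    rw [intervalIntegral.integral_sub, intervalIntegral.integral_const_mul, parseval_norm,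
      norm_sq_TP] at h1
    · simp only [intervalIntegral.integral_const, sub_zero, one_smul] at h1
      have h2 : ∑ k : Fr N, ((k:ℤ):ℝ) * ‖z k‖ ^ 2 - ∑ k : Fr N, ‖dgT (fun j => √(c j)) z k‖ ^ 2
          ≤ - c₀ * ∑ k : Fr N, ‖z k‖ ^ 2 := by
        rw [← Finset.sum_sub_distrib, Finset.mul_sum]
        apply Finset.sum_le_sum
        intro k _
        have h3 : ‖dgT (fun j => √(c j)) z k‖ ^ 2 = ∑ j, c j * ‖z k j‖ ^ 2 := by
          change ‖dg (fun j => √(c j)) (z k)‖ ^ 2 = _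
          rw [norm_dg_sq]
          simp only [Real.sq_sqrt (h.cpos _).le]
        have h4 : 0 ≤ ∑ j, c j * ‖z k j‖ ^ 2 := Finset.sum_nonneg fun j _ =>
          mul_nonneg (h.cpos j).le (by positivity)
        rw [h3]
        have hn : 0 ≤ ‖z k‖ ^ 2 := by positivity
        rcases lt_trichotomy (k:ℤ) 0 with hk | hk | hk
        · have : ((k:ℤ):ℝ) ≤ -1 := by exact_mod_cast (by omega : (k:ℤ) ≤ -1)
          have h5 : c₀ ≤ 1 := min_le_left _ _
          nlinarith
        · have h5 : c₀ ≤ c j₀ := (min_le_right _ _).trans (min_le_left _ _)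
          have h6 : c₀ * ‖z k‖ ^ 2 ≤ ∑ j, c j * ‖z k j‖ ^ 2 := by
            rw [EuclideanSpace.norm_sq_eq, Finset.mul_sum]
            apply Finset.sum_le_sum
            intro j _
            exact mul_le_mul_of_nonneg_right (h5.trans (hj₀ j)) (by positivity)
          rw [hk]
          simp only [Int.cast_zero, zero_mul]
          linarith
        · rcases eq_or_lt_of_le (by omega : 1 ≤ (k:ℤ)) with hk1 | hk1
          · have h5 : c₀ ≤ c i₀ - 1 := (min_le_right _ _).trans (min_le_right _ _)
            have h6 : ∑ j, c j * ‖z k j‖ ^ 2 = c i₀ * s ^ 2 := by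
              rw [hz1 k hk1.symm, Finset.sum_eq_single i₀]
              · simp
              · intro j _ hj
                simp [hj]
              · simp
            have h7 : ‖z k‖ ^ 2 = s ^ 2 := by
              rw [hz1 k hk1.symm, norm_smul]
              simp
            rw [h6, h7, ← hk1]
            push_cast
            nlinarith [sq_nonneg s]
          · rw [hz2 k hk1]; simp
      unfold Act qd
      rw [norm_sq_TP]
      have h8 := mul_le_mul_of_nonneg_left h2 pi_pos.le
      linarith
    · have := continuous_ev (dgT (fun j => √(c j)) z)
      exact Continuous.intervalIntegrable (by fun_prop) _ _
    · simp
  · intro hs0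
    have h1 : 0 ≤ ∫ t in (0:ℝ)..1, H (ev z t) :=
      intervalIntegral.integral_nonneg zero_le_one fun t _ => h.H0 _
    have h2 : qd z ≤ 0 := by
      unfold qd
      apply mul_nonpos_of_nonneg_of_nonpos pi_pos.le
      apply Finset.sum_nonpos
      intro k _
      rcases le_or_gt (k:ℤ) 0 with hk | hk
      · exact mul_nonpos_of_nonpos_of_nonneg (by exact_mod_cast hk) (by positivity)
      · rcases eq_or_lt_of_le (by omega : 1 ≤ (k:ℤ)) with hk1 | hk1
        · rw [hz1 k hk1.symm, hs0]; simp
        · rw [hz2 k hk1]; simp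
    unfold Act
    linarith

end NSq


namespace NSq

variable {n N : ℕ} {i₀ : Fin n} {H : V n → ℝ} {X : V n → V n} {c : Fin n → ℝ}
  {m Lp K ρ : ℝ} {p : V n}

/-- Lower bound on the gradient away from critical points. -/
lemma Ham.grad_lower (h : Ham n i₀ H X c m Lp K ρ p) {β : ℝ}
    (hno : ∀ x : TP n N, β ≤ Act H x → Gr X x ≠ 0) :
    ∃ δ : ℝ, 0 < δ ∧ ∀ x : TP n N, β ≤ Act H x → δ ≤ ‖Gr X x‖ := by
  obtain ⟨d, hd, hgap⟩ := h.exists_gap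
  have hA := continuous_Act (n := n) (N := N) h.Hc
  have hG := (continuous_Gr (n := n) (N := N) h.Xc).norm
  set A : Set (TP n N) := Metric.closedBall 0 ((K + 1) / d) ∩ {x | β ≤ Act H x} with hAdef
  have hAc : IsCompact A :=
    (isCompact_closedBall _ _).inter_right (isClosed_le continuous_const hA)
  have hout : ∀ x : TP n N, x ∉ Metric.closedBall (0 : TP n N) ((K + 1) / d) → 1 ≤ ‖Gr X x‖ := by
    intro x hx
    have h1 := h.coercive hd hgap x
    rw [mem_closedBall_zero_iff, not_le, div_lt_iff₀ hd] at hx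
    linarith
  rcases A.eq_empty_or_nonempty with hE | hE
  · refine ⟨1, one_pos, fun x hx => hout x fun hx2 => ?_⟩
    have : x ∈ A := ⟨hx2, hx⟩
    rw [hE] at this
    exact this
  · obtain ⟨x₀, hx₀, hmin⟩ := hAc.exists_isMinOn hE hG.continuousOn
    refine ⟨min 1 ‖Gr X x₀‖, lt_min one_pos (norm_pos_iff.2 (hno x₀ hx₀.2)), fun x hx => ?_⟩
    by_cases hx2 : x ∈ Metric.closedBall (0 : TP n N) ((K + 1) / d)
    · exact (min_le_right _ _).trans (hmin ⟨hx2, hx⟩)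
    · exact (min_le_left _ _).trans (hout x hx2)

/-- The deformation pushing the functional below `β`. -/
lemma Ham.deform (h : Ham n i₀ H X c m Lp K ρ p) {β : ℝ} (hβ : 0 < β)
    (hno : ∀ x : TP n N, β ≤ Act H x → Gr X x ≠ 0) :
    ∃ G : TP n N → TP n N, Continuous G ∧ (∀ x, Act H x ≤ 0 → G x = x) ∧
      ∀ x, Act H x ≤ m → Act H (G x) < β := by
  obtain ⟨δ, hδ, hlow⟩ := h.grad_lower hno
  have hA := continuous_Act (n := n) (N := N) h.Hc
  have hG := (continuous_Gr (n := n) (N := N) h.Xc)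
  set C : ℝ := π * N + Lp + 1 with hC
  have hC0 : 0 < C := by have := h.Lp0; positivity
  set η : ℝ := 1 / (2 * C) with hη
  have hη0 : 0 < η := by positivity
  have hCη : C * η = 1 / 2 := by rw [hη]; field_simp
  let χ : ℝ → ℝ := fun a => max 0 (min 1 (a / β))
  have hχc : Continuous χ := by fun_prop
  have hχ0 : ∀ a, 0 ≤ χ a := fun a => le_max_left _ _
  have hχ1 : ∀ a, χ a ≤ 1 := fun a => max_le zero_le_one (min_le_left _ _)
  have hχz : ∀ a, a ≤ 0 → χ a = 0 := by
    intro a ha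
    apply max_eq_left
    exact (min_le_right _ _).trans (div_nonpos_of_nonpos_of_nonneg ha hβ.le)
  have hχb : ∀ a, β ≤ a → χ a = 1 := by
    intro a ha
    have : 1 ≤ a / β := by rwa [le_div_iff₀ hβ, one_mul]
    simp only [χ]
    rw [min_eq_left this, max_eq_right zero_le_one]
  let g : TP n N → TP n N := fun x => x + (-(η * χ (Act H x))) • Gr X x
  have hgc : Continuous g := by
    have := hχc.comp hA
    exact continuous_id.add ((continuous_const.mul this).neg.smul hG)
  have hdec : ∀ x, Act H (g x) ≤ Act H x - η * χ (Act H x) / 2 * ‖Gr X x‖ ^ 2 := by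
    intro x
    have h1 := h.descent x ((-(η * χ (Act H x))) • Gr X x)
    rw [real_inner_smul_right, real_inner_self_eq_norm_sq, norm_smul, mul_pow, norm_neg,
      Real.norm_eq_abs, sq_abs] at h1
    set q := χ (Act H x)
    have hq0 : 0 ≤ q := hχ0 _
    have hq1 : q ≤ 1 := hχ1 _
    have h2 : (π * N + Lp) * ((η * q) ^ 2 * ‖Gr X x‖ ^ 2) ≤ η * q / 2 * ‖Gr X x‖ ^ 2 := by
      have : (π * N + Lp) ≤ C := by rw [hC]; linarith
      calc (π * N + Lp) * ((η * q) ^ 2 * ‖Gr X x‖ ^ 2) ≤ C * ((η * q) ^ 2 * ‖Gr X x‖ ^ 2) := by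
            apply mul_le_mul_of_nonneg_right this; positivity
        _ = (C * η) * (η * q * ‖Gr X x‖ ^ 2) * q := by ring
        _ ≤ (C * η) * (η * q * ‖Gr X x‖ ^ 2) * 1 := by
            apply mul_le_mul_of_nonneg_left hq1; positivity
        _ = _ := by rw [hCη]; ring
    change Act H (x + _) ≤ _
    linarith
  have hmono : ∀ x, Act H (g x) ≤ Act H x := by
    intro x
    have := hdec x
    have h2 : 0 ≤ η * χ (Act H x) / 2 * ‖Gr X x‖ ^ 2 := by
      have := hχ0 (Act H x); positivity
    linarith
  have hfix : ∀ x, Act H x ≤ 0 → g x = x := by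
    intro x hx
    simp [g, hχz _ hx]
  set ε : ℝ := η / 2 * δ ^ 2 with hε
  have hε0 : 0 < ε := by positivity
  have hstep : ∀ x, β ≤ Act H x → Act H (g x) ≤ Act H x - ε := by
    intro x hx
    have h1 := hdec x
    rw [hχb _ hx, mul_one] at h1
    have h2 : δ ^ 2 ≤ ‖Gr X x‖ ^ 2 := pow_le_pow_left₀ hδ.le (hlow x hx) 2
    have : ε ≤ η / 2 * ‖Gr X x‖ ^ 2 := by
      rw [hε]; exact mul_le_mul_of_nonneg_left h2 (by positivity)
    linarith
  have hiter : ∀ (j : ℕ) x, Act H (g^[j] x) < β ∨ Act H (g^[j] x) ≤ Act H x - j * ε := by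
    intro j x
    induction j with
    | zero => right; simp
    | succ j ih =>
      rw [Function.iterate_succ_apply']
      rcases lt_or_ge (Act H (g^[j] x)) β with hlt | hge
      · left; exact (hmono _).trans_lt hlt
      · right
        rcases ih with ih | ih
        · linarith
        · have := hstep _ hge
          push_cast
          linarith
  obtain ⟨j, hj⟩ := exists_nat_gt ((m - β) / ε)
  rw [div_lt_iff₀ hε0] at hj
  refine ⟨g^[j], hgc.iterate j, ?_, ?_⟩
  · intro x hx
    exact Function.iterate_fixed (hfix x hx) j
  · intro x hx
    rcases hiter j x with h1 | h1
    · exact h1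
    · linarith

/-- Critical points at each Galerkin level. -/
lemma Ham.galerkin (h : Ham n i₀ H X c m Lp K ρ p) :
    ∃ β : ℝ, 0 < β ∧ ∀ N : ℕ, 1 ≤ N → ∃ x : TP n N, Gr X x = 0 ∧ β ≤ Act H x := by
  obtain ⟨α, hα, hgam⟩ := h.gamma
  obtain ⟨c₀, hc₀, hsig⟩ := h.sigma
  refine ⟨π / 4 * α ^ 2, by positivity, fun N hN => ?_⟩
  by_contra hcon
  push Not at hcon
  have hno : ∀ x : TP n N, π / 4 * α ^ 2 ≤ Act H x → Gr X x ≠ 0 := by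
    intro x hx h0
    exact absurd hx (not_le.2 (hcon x h0))
  obtain ⟨G, hGc, hGfix, hGlow⟩ := h.deform (by positivity : 0 < π / 4 * α ^ 2) hno
  have hA := continuous_Act (n := n) (N := N) h.Hc
  have m1 : (1:ℤ) ∈ Finset.Icc (-(N:ℤ)) N := by simp; omega
  have m0 : (0:ℤ) ∈ Finset.Icc (-(N:ℤ)) N := by simp
  let k1 : Fr N := ⟨1, m1⟩
  let k0 : Fr N := ⟨0, m0⟩
  let ep : TP n N := WithLp.toLp 2 fun k : Fr N => if k = k1 then EuclideanSpace.single i₀ (1:ℂ) else 0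
  have hep1 : ep k1 = EuclideanSpace.single i₀ (1:ℂ) := by simp [ep]
  have hep : ∀ k : Fr N, (k:ℤ) ≠ 1 → ep k = 0 := by
    intro k hk
    have : k ≠ k1 := fun h => hk (by rw [h])
    simp [ep, this]
  let s : TP n N → ℝ := fun x => ((x k1) i₀).re
  have hs : Continuous s := by
    have : Continuous fun x : TP n N => (x k1) i₀ := by fun_prop
    exact Complex.continuous_re.comp this
  have hcutc : Continuous (fun x : TP n N => cut (fun k => k ≤ 0) x) := by
    unfold cut
    refine (PiLp.continuous_toLp 2 _).comp (continuous_pi fun k => ?_)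
    split_ifs <;> fun_prop
  have hhpc : Continuous (hp : TP n N → ℝ) := by unfold hp; fun_prop
  let w : TP n N → TP n N := fun x => cut (fun k => k ≤ 0) x + (max (s x) 0) • ep
  have hw : Continuous w := hcutc.add ((hs.max continuous_const).smul continuous_const)
  have hwle : ∀ x (k : Fr N), (k:ℤ) ≤ 0 → w x k = x k := by
    intro x k hk
    simp [w, cut_apply, hk, hep k (by omega)]
  have hw1 : ∀ x (k : Fr N), (k:ℤ) = 1 → w x k = (max (s x) 0) • EuclideanSpace.single i₀ (1:ℂ) := by
    intro x k hk
    have : k = k1 := Subtype.ext hk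
    subst this
    have h1 : ¬ ((k1:ℤ) ≤ 0) := by simp [k1]
    simp [w, cut_apply, h1, hep1]
  have hwgt : ∀ x (k : Fr N), 1 < (k:ℤ) → w x k = 0 := by
    intro x k hk
    have h1 : ¬ ((k:ℤ) ≤ 0) := by omega
    simp [w, cut_apply, h1, hep k (by omega)]
  have hws : ∀ x, s (w x) = max (s x) 0 := by
    intro x
    simp only [s]
    rw [hw1 x k1 rfl]
    simp [s]
  have hhpw : ∀ x, hp (w x) = (max (s x) 0) ^ 2 := by
    intro x
    unfold hp
    rw [Finset.sum_eq_single k1]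
    · rw [hw1 x k1 rfl, norm_smul]
      simp [k1]
    · intro k _ hk
      have hk1 : (k:ℤ) ≠ 1 := fun h => hk (Subtype.ext h)
      rcases le_or_gt (k:ℤ) 0 with h0 | h0
      · have : ((k:ℤ):ℝ) ≤ 0 := by exact_mod_cast h0
        rw [max_eq_right this, zero_mul]
      · rw [hwgt x k (by omega)]; simp
    · simp
  have hsigw := fun x => hsig N (w x) (max (s x) 0) (le_max_right _ _) (hwgt x) (hw1 x)
  let U : TP n N → TP n N := fun y => cut (fun k => k ≤ 0) (G y - y) + (√(hp (G y)) - s y) • ep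
  have hU : Continuous U :=
    (hcutc.comp (hGc.sub continuous_id)).add
      (((hhpc.comp hGc).sqrt.sub hs).smul continuous_const)
  have hUz : ∀ x, Act H (w x) ≤ 0 → U (w x) = 0 := by
    intro x hx
    simp only [U]
    rw [hGfix _ hx, hhpw, hws, Real.sqrt_sq (le_max_right _ _), sub_self, sub_self, zero_smul,
      add_zero]
    ext k; simp [cut_apply]
  obtain ⟨B, hB⟩ : ∃ B, ∀ y ∈ Metric.closedBall (0 : TP n N) (√(|m| / (π * c₀))), ‖U y‖ ≤ B :=
    (isCompact_closedBall _ _).exists_bound_of_continuousOn hU.continuousOn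
  have hbd : ∀ x, ‖U (w x)‖ ≤ max B 0 := by
    intro x
    rcases le_or_gt (Act H (w x)) 0 with h0 | h0
    · rw [hUz x h0, norm_zero]; exact le_max_right _ _
    · refine le_trans (hB _ ?_) (le_max_left _ _)
      rw [mem_closedBall_zero_iff]
      apply Real.le_sqrt_of_sq_le
      rw [le_div_iff₀ (by positivity)]
      have := (hsigw x).1
      have := le_abs_self m
      linarith
  obtain ⟨x, hx⟩ := brouwer_bounded (u := fun x => U (w x)) (hU.comp hw) hbd
    (WithLp.toLp 2 fun k : Fr N => if k = k0 then p else if k = k1 then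
      α • EuclideanSpace.single i₀ (1:ℂ) else 0)
  have hxk := fun k : Fr N => congrArg (fun z : TP n N => z k) hx
  simp only [U, PiLp.add_apply, PiLp.smul_apply, cut_apply, PiLp.sub_apply] at hxk
  set y := G (w x) with hy
  have hylt : ∀ k : Fr N, (k:ℤ) ≤ 0 → y k = if k = k0 then p else 0 := by
    intro k hk
    have h1 := hxk k
    have h2 : k ≠ k1 := fun h => by rw [h] at hk; simp [k1] at hk
    rw [if_pos hk, hep k (by omega), hwle x k hk, if_neg h2, smul_zero, add_zero,
      add_sub_cancel] at h1
    exact h1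
  have hseq : s x + (√(hp y) - max (s x) 0) = α := by
    have h1 := hxk k1
    have h2 : ¬ ((k1:ℤ) ≤ 0) := by simp [k1]
    have h3 : k1 ≠ k0 := by simp [k1, k0]
    rw [if_neg h2, zero_add, hep1, if_neg h3, if_pos rfl, hws] at h1
    have h4 := congrArg (fun v : V n => (v i₀).re) h1
    simpa [s] using h4
  rcases le_or_gt (s x) 0 with h0 | h0
  · rw [max_eq_right h0] at hseq
    have h1 := (hsigw x).2 (max_eq_right h0)
    rw [hy, hGfix _ h1, hhpw, max_eq_right h0] at hseq
    simp at hseq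
    linarith
  · rw [max_eq_left h0.le] at hseq
    have h1 : √(hp y) = α := by linarith
    have h2 : hp y = α ^ 2 := by rw [← h1, Real.sq_sqrt (hp_nonneg y)]
    have h3 := hgam N y ?_ ?_ h2
    · have h4 := hGlow (w x) ?_
      · rw [← hy] at h4
        have : 0 < π * α ^ 2 := by positivity
        linarith
      · have := (hsigw x).1
        have : 0 ≤ π * c₀ * ‖w x‖ ^ 2 := by positivity
        linarith
    · intro k hk
      rw [hylt k hk.le, if_neg]
      intro h; rw [h] at hk; simp [k0] at hk
    · intro k hk
      have : k = k0 := Subtype.ext hk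
      rw [hylt k hk.le, if_pos this]

end NSq


namespace NSq

lemma fourier_zero_unique (v : ℝ → ℂ) (hv : Continuous v) (hper : v 0 = v 1)
    (hz : ∀ k : ℤ, ∫ t in (0:ℝ)..1, ex (-k) t * v t = 0) : ∀ t ∈ Set.Icc (0:ℝ) 1, v t = 0 := by
  have : Fact ((0:ℝ) < 1) := ⟨one_pos⟩
  let f : C(AddCircle (1:ℝ), ℂ) := ⟨AddCircle.liftIco 1 0 v,
    AddCircle.liftIco_zero_continuous hper hv.continuousOn⟩
  have hcoef : ∀ k, fourierCoeff f k = 0 := by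
    intro k
    rw [fourierCoeff_eq_intervalIntegral _ _ 0]
    simp only [zero_add]
    rw [show (1 / (1:ℝ)) = 1 by norm_num, one_smul, ← hz k]
    refine intervalIntegral.integral_congr_Ioo_of_le zero_le_one fun t ht => ?_
    simp only [f, ContinuousMap.coe_mk, smul_eq_mul]
    rw [AddCircle.liftIco_zero_coe_apply (Set.Ioo_subset_Ico_self ht), fourier_coe_apply]
    congr 1
    unfold ex
    congr 1
    push_cast
    ring
  have hs : Summable (fourierCoeff f) := by
    have : fourierCoeff (f : AddCircle (1:ℝ) → ℂ) = fun _ => 0 := funext hcoef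
    rw [this]; exact summable_zero
  have h0 : ∀ t ∈ Set.Ico (0:ℝ) 1, v t = 0 := by
    intro t ht
    have h1 := has_pointwise_sum_fourier_series_of_summable hs (t : AddCircle (1:ℝ))
    simp only [hcoef, zero_smul] at h1
    have h2 := h1.unique hasSum_zero
    rw [← h2]
    exact (AddCircle.liftIco_zero_coe_apply ht).symm
  intro t ht
  rcases eq_or_lt_of_le ht.2 with h | h
  · rw [h, ← hper]; exact h0 0 (by simp)
  · exact h0 t ⟨ht.1, h⟩

lemma fourier_ode (g f : ℝ → ℂ) (hg : Continuous g) (hf : Continuous f) (hper : g 0 = g 1)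
    (hk : ∀ k : ℤ, (2 * π * k : ℝ) * ∫ t in (0:ℝ)..1, ex (-k) t * g t
      = ∫ t in (0:ℝ)..1, ex (-k) t * f t) :
    ∀ t ∈ Set.Icc (0:ℝ) 1, g t = g 0 + Complex.I * ∫ s in (0:ℝ)..t, f s := by
  let F : ℝ → ℂ := fun t => ∫ s in (0:ℝ)..t, f s
  have hF : ∀ t, HasDerivAt F (f t) t := fun t =>
    intervalIntegral.integral_hasDerivAt_right (hf.intervalIntegrable _ _)
      (hf.stronglyMeasurableAtFilter _ _) hf.continuousAt
  have hFc : Continuous F := continuous_iff_continuousAt.2 fun t => (hF t).continuousAt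
  have hF0 : F 0 = 0 := by simp [F]
  have hF1 : F 1 = 0 := by
    have := hk 0
    simp only [Int.cast_zero, mul_zero, Complex.ofReal_zero, zero_mul, neg_zero, ex_zero,
      one_mul] at this
    exact this.symm
  have hibp : ∀ k : ℤ, (2 * π * k : ℝ) * Complex.I * ∫ t in (0:ℝ)..1, ex (-k) t * F t
      = ∫ t in (0:ℝ)..1, ex (-k) t * f t := by
    intro k
    have hd : ∀ t ∈ Set.uIcc (0:ℝ) 1, HasDerivAt (fun t => ex (-k) t * F t)
        (-((2 * π * k : ℝ) * Complex.I * (ex (-k) t * F t)) + ex (-k) t * f t) t := by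
      intro t _
      refine HasDerivAt.congr_deriv ((hasDerivAt_ex (-k) t).mul (hF t)) ?_
      push_cast; ring
    have hc1 : Continuous fun t => ex (-k) t * F t := (continuous_ex _).mul hFc
    have hc2 : Continuous fun t => ex (-k) t * f t := (continuous_ex _).mul hf
    have h1 := intervalIntegral.integral_eq_sub_of_hasDerivAt hd
      (Continuous.intervalIntegrable (by fun_prop) _ _)
    rw [intervalIntegral.integral_add (Continuous.intervalIntegrable (by fun_prop) _ _)
      (hc2.intervalIntegrable _ _), intervalIntegral.integral_neg,
      intervalIntegral.integral_const_mul, hF0, hF1] at h1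
    linear_combination -h1
  let c : ℂ := ∫ t in (0:ℝ)..1, (g t - Complex.I * F t)
  let v : ℝ → ℂ := fun t => g t - Complex.I * F t - c
  have hv : Continuous v := by fun_prop
  have hz := fourier_zero_unique v hv (by simp only [v, hF0, hF1, hper]) ?_
  · intro t ht
    have h1 := hz t ht
    have h2 := hz 0 (by simp)
    simp only [v, hF0] at h1 h2
    change g t = g 0 + Complex.I * F t
    linear_combination h1 - h2
  · intro k
    by_cases hk0 : k = 0
    · subst hk0
      simp only [neg_zero, ex_zero, one_mul, v]
      rw [intervalIntegral.integral_sub (Continuous.intervalIntegrable (by fun_prop) _ _) (by simp)]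
      simp [c]
    · have hc1 : Continuous fun t => ex (-k) t * F t := (continuous_ex _).mul hFc
      have hc2 : Continuous fun t => ex (-k) t * g t := (continuous_ex _).mul hg
      have hc3 := continuous_ex (-k)
      have h1 : ∀ t, ex (-k) t * v t = ex (-k) t * g t - Complex.I * (ex (-k) t * F t)
          - ex (-k) t * c := by intro t; simp only [v]; ring
      simp only [h1]
      rw [intervalIntegral.integral_sub (Continuous.intervalIntegrable (by fun_prop) _ _)
        (Continuous.intervalIntegrable (by fun_prop) _ _),
        intervalIntegral.integral_sub (Continuous.intervalIntegrable (by fun_prop) _ _)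
        (Continuous.intervalIntegrable (by fun_prop) _ _), intervalIntegral.integral_const_mul,
        intervalIntegral.integral_mul_const, integral_ex, if_neg (by simpa using hk0)]
      have h2 := hk k
      have h3 := hibp k
      have h4 : ((2 * π * k : ℝ) : ℂ) ≠ 0 := by
        have : (k:ℝ) ≠ 0 := by exact_mod_cast hk0
        have h5 : (2 * π * k : ℝ) ≠ 0 := by positivity
        exact_mod_cast h5
      have h5 : ((2 * π * k : ℝ) : ℂ) * ((∫ t in (0:ℝ)..1, ex (-k) t * g t)
        - Complex.I * ∫ t in (0:ℝ)..1, ex (-k) t * F t) = 0 := by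
        linear_combination h2 - h3
      have := (mul_eq_zero.1 h5).resolve_left h4
      rw [this]; simp

lemma tendsto_integral_comp {E F : Type*} [NormedAddCommGroup E] [NormedSpace ℝ E]
    [ProperSpace E] [NormedAddCommGroup F] [NormedSpace ℝ F] (Φ : ℝ × E → F) (hΦ : Continuous Φ)
    (u : ℕ → ℝ → E) (v : ℝ → E) (hu : ∀ j, Continuous (u j)) {R : ℝ}
    (hR : ∀ j, ∀ t ∈ Set.Icc (0:ℝ) 1, ‖u j t‖ ≤ R)
    (hlim : ∀ t ∈ Set.Icc (0:ℝ) 1, Filter.Tendsto (fun j => u j t) Filter.atTop (nhds (v t))) :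
    Filter.Tendsto (fun j => ∫ t in (0:ℝ)..1, Φ (t, u j t)) Filter.atTop
      (nhds (∫ t in (0:ℝ)..1, Φ (t, v t))) := by
  obtain ⟨B, hB⟩ : ∃ B, ∀ q ∈ (Set.Icc (0:ℝ) 1) ×ˢ Metric.closedBall (0:E) R, ‖Φ q‖ ≤ B :=
    (isCompact_Icc.prod (isCompact_closedBall _ _)).exists_bound_of_continuousOn hΦ.continuousOn
  have hsub : ∀ t, t ∈ Set.uIoc (0:ℝ) 1 → t ∈ Set.Icc (0:ℝ) 1 := by
    intro t ht
    rw [Set.uIoc_of_le zero_le_one] at ht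
    exact Set.Ioc_subset_Icc_self ht
  apply intervalIntegral.tendsto_integral_filter_of_dominated_convergence (fun _ => B)
  · refine Filter.Eventually.of_forall fun j => ?_
    exact (hΦ.comp (continuous_id.prodMk (hu j))).aestronglyMeasurable
  · refine Filter.Eventually.of_forall fun j => Filter.Eventually.of_forall fun t ht => ?_
    exact hB _ ⟨hsub t ht, mem_closedBall_zero_iff.2 (hR j t (hsub t ht))⟩
  · simp
  · refine Filter.Eventually.of_forall fun t ht => ?_
    exact (hΦ.tendsto _).comp ((tendsto_const_nhds).prodMk_nhds (hlim t (hsub t ht)))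

end NSq


namespace NSq

variable {n N : ℕ} {i₀ : Fin n} {H : V n → ℝ} {X : V n → V n} {c : Fin n → ℝ}
  {m Lp K ρ : ℝ} {p : V n}

lemma bessel (g : ℝ → V n) (hg : Continuous g) :
    ‖cf N g‖ ^ 2 ≤ ∫ t in (0:ℝ)..1, ‖g t‖ ^ 2 := by
  set v := cf N g with hv
  have h1 : ‖v‖ ^ 2 = ∫ t in (0:ℝ)..1, inner ℝ (g t) (ev v t) := by
    rw [← inner_cf g hg, ← real_inner_self_eq_norm_sq]
  have hcv := continuous_ev v
  have h2 : ∫ t in (0:ℝ)..1, inner ℝ (g t) (ev v t)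
      ≤ ∫ t in (0:ℝ)..1, (‖g t‖ ^ 2 / 2 + ‖ev v t‖ ^ 2 / 2) := by
    apply intervalIntegral.integral_mono_on zero_le_one
    · exact (hg.inner hcv).intervalIntegrable _ _
    · exact Continuous.intervalIntegrable (by fun_prop) _ _
    · intro t _
      have h3 := real_inner_le_norm (g t) (ev v t)
      nlinarith [sq_nonneg (‖g t‖ - ‖ev v t‖)]
  rw [intervalIntegral.integral_add (Continuous.intervalIntegrable (by fun_prop) _ _)
    (Continuous.intervalIntegrable (by fun_prop) _ _),
      intervalIntegral.integral_div, intervalIntegral.integral_div, parseval_norm, ← h1] at h2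
  linarith

lemma hasDerivAt_ev (x : TP n N) (t : ℝ) :
    HasDerivAt (ev x) (Complex.I • ev (Dop x) t) t := by
  unfold ev
  have h1 : ∀ k ∈ (Finset.univ : Finset (Fr N)), HasDerivAt (fun t => ex k t • x k)
      (((2 * π * ((k:ℤ):ℝ) : ℝ) * Complex.I * ex k t) • x k) t := fun k _ =>
    (hasDerivAt_ex k t).smul_const (x k)
  have h2 := HasDerivAt.fun_sum h1
  refine h2.congr_deriv ?_
  rw [Finset.smul_sum]
  refine Finset.sum_congr rfl fun k _ => ?_
  simp only [Dop]
  rw [← Complex.coe_smul, smul_smul, smul_smul]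
  congr 1
  ring

lemma ev_osc (x : TP n N) {C : ℝ} (hC : 0 < C) (hx : ‖Dop x‖ ≤ C) {s t : ℝ} (hs : 0 ≤ s)
    (hst : s ≤ t) (ht : t ≤ 1) : ‖ev x t - ev x s‖ ≤ C * √(t - s) := by
  rcases eq_or_lt_of_le hst with h | hlt
  · subst h; simp
  set τ := √(t - s) with hτ
  have hτ0 : 0 < τ := Real.sqrt_pos.2 (by linarith)
  have hτ2 : τ ^ 2 = t - s := Real.sq_sqrt (by linarith)
  have hcD := continuous_ev (Dop x)
  rw [← intervalIntegral.integral_eq_sub_of_hasDerivAt (fun r _ => hasDerivAt_ev x r)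
    (Continuous.intervalIntegrable (by fun_prop) _ _)]
  have h1 : ‖∫ r in s..t, Complex.I • ev (Dop x) r‖
      ≤ ∫ r in s..t, (C / (2 * τ) + τ / (2 * C) * ‖ev (Dop x) r‖ ^ 2) := by
    refine (intervalIntegral.norm_integral_le_integral_norm hst).trans ?_
    apply intervalIntegral.integral_mono_on hst
    · exact Continuous.intervalIntegrable (by fun_prop) _ _
    · exact Continuous.intervalIntegrable (by fun_prop) _ _
    · intro r _
      rw [norm_smul, Complex.norm_I, one_mul]
      set a := ‖ev (Dop x) r‖
      have h2 : C / (2 * τ) + τ / (2 * C) * a ^ 2 - a = (C - τ * a) ^ 2 / (2 * τ * C) := by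
        field_simp; ring
      have : 0 ≤ (C - τ * a) ^ 2 / (2 * τ * C) := by positivity
      linarith
  refine h1.trans ?_
  rw [intervalIntegral.integral_add (by simp) (Continuous.intervalIntegrable (by fun_prop) _ _),
    intervalIntegral.integral_const, intervalIntegral.integral_const_mul, smul_eq_mul, ← hτ2]
  have h3 : ∫ r in s..t, ‖ev (Dop x) r‖ ^ 2 ≤ ∫ r in (0:ℝ)..1, ‖ev (Dop x) r‖ ^ 2 := by
    apply intervalIntegral.integral_mono_interval hs hst ht
    · exact Filter.Eventually.of_forall fun r => by positivity
    · exact Continuous.intervalIntegrable (by fun_prop) _ _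
  rw [parseval_norm] at h3
  have h4 : ‖Dop x‖ ^ 2 ≤ C ^ 2 := pow_le_pow_left₀ (norm_nonneg _) hx 2
  have h5 : τ / (2 * C) * ∫ r in s..t, ‖ev (Dop x) r‖ ^ 2 ≤ τ / (2 * C) * C ^ 2 :=
    mul_le_mul_of_nonneg_left (h3.trans h4) (by positivity)
  refine (add_le_add_right h5 _).trans (le_of_eq ?_)
  field_simp
  ring

lemma qd_eq (x : TP n N) : qd x = 1 / 2 * inner ℝ (Dop x) x := by
  unfold qd Dop
  rw [PiLp.inner_apply, Finset.mul_sum, Finset.mul_sum]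
  refine Finset.sum_congr rfl fun k _ => ?_
  simp only
  rw [real_inner_smul_left, real_inner_self_eq_norm_sq]
  ring

lemma crit_act (hH : Continuous H) (hX : Continuous X) (x : TP n N) (hx : Gr X x = 0) :
    Act H x = ∫ t in (0:ℝ)..1, (1 / 2 * inner ℝ (X (ev x t)) (ev x t) - H (ev x t)) := by
  have hc := continuous_ev x
  have h1 : Dop x = cf N (fun t => X (ev x t)) := sub_eq_zero.1 hx
  unfold Act
  rw [qd_eq, h1, inner_cf (fun t => X (ev x t)) (hX.comp hc), intervalIntegral.integral_sub,
    intervalIntegral.integral_const_mul]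
  · exact Continuous.intervalIntegrable (by fun_prop) _ _
  · exact Continuous.intervalIntegrable (by fun_prop) _ _

/-- Uniform estimates for the critical points. -/
lemma Ham.estimates (h : Ham n i₀ H X c m Lp K ρ p) :
    ∃ C R : ℝ, 0 < C ∧ ∀ (N : ℕ) (x : TP n N), Gr X x = 0 →
      ‖Dop x‖ ≤ C ∧ ∀ t ∈ Set.Icc (0:ℝ) 1, ‖ev x t‖ ≤ R := by
  obtain ⟨d, hd, hgap⟩ := h.exists_gap
  set C : ℝ := √(2 * ‖X 0‖ ^ 2 + 2 * Lp ^ 2 * (K / d) ^ 2) + 1 with hC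
  have hC0 : 0 < C := by positivity
  refine ⟨C, (1 / 2 + (K / d) ^ 2 / 2) + C, hC0, fun N x hx => ?_⟩
  have hX := h.Xc
  have hc := continuous_ev x
  have hxn : ‖x‖ ≤ K / d := by
    have h1 := h.coercive hd hgap x
    rw [hx, norm_zero] at h1
    rw [le_div_iff₀ hd]; linarith
  have hxn2 : ‖x‖ ^ 2 ≤ (K / d) ^ 2 := pow_le_pow_left₀ (norm_nonneg _) hxn 2
  have hD : ‖Dop x‖ ≤ C := by
    have h1 : Dop x = cf N (fun t => X (ev x t)) := sub_eq_zero.1 hx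
    have h2 := bessel (N := N) (fun t => X (ev x t)) (hX.comp hc)
    rw [← h1] at h2
    have h3 : ∫ t in (0:ℝ)..1, ‖X (ev x t)‖ ^ 2
        ≤ ∫ t in (0:ℝ)..1, (2 * ‖X 0‖ ^ 2 + 2 * Lp ^ 2 * ‖ev x t‖ ^ 2) := by
      apply intervalIntegral.integral_mono_on zero_le_one
      · exact Continuous.intervalIntegrable (by fun_prop) _ _
      · exact Continuous.intervalIntegrable (by fun_prop) _ _
      · intro t _
        have h4 := h.XL (ev x t) 0
        rw [sub_zero] at h4
        have h5 : ‖X (ev x t)‖ ≤ ‖X 0‖ + Lp * ‖ev x t‖ := by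
          have := norm_le_norm_add_norm_sub' (X (ev x t)) (X 0)
          linarith
        have h6 : ‖X (ev x t)‖ ^ 2 ≤ (‖X 0‖ + Lp * ‖ev x t‖) ^ 2 :=
          pow_le_pow_left₀ (norm_nonneg _) h5 2
        nlinarith [sq_nonneg (‖X 0‖ - Lp * ‖ev x t‖)]
    rw [intervalIntegral.integral_add (by simp) (Continuous.intervalIntegrable (by fun_prop) _ _),
      intervalIntegral.integral_const, intervalIntegral.integral_const_mul, parseval_norm] at h3
    have h4 : ‖Dop x‖ ^ 2 ≤ 2 * ‖X 0‖ ^ 2 + 2 * Lp ^ 2 * (K / d) ^ 2 := by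
      have : 2 * Lp ^ 2 * ‖x‖ ^ 2 ≤ 2 * Lp ^ 2 * (K / d) ^ 2 :=
        mul_le_mul_of_nonneg_left hxn2 (by positivity)
      simp only [sub_zero, one_smul] at h3
      linarith
    have := Real.le_sqrt_of_sq_le h4
    linarith
  refine ⟨hD, fun t ht => ?_⟩
  have hosc : ∀ s ∈ Set.Icc (0:ℝ) 1, ‖ev x t‖ ≤ ‖ev x s‖ + C := by
    intro s hs
    have h1 : ‖ev x t - ev x s‖ ≤ C := by
      rcases le_total s t with hst | hst
      · refine (ev_osc x hC0 hD hs.1 hst ht.2).trans ?_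
        have : √(t - s) ≤ 1 := Real.sqrt_le_one.2 (by linarith [hs.1, ht.2])
        nlinarith
      · rw [norm_sub_rev]
        refine (ev_osc x hC0 hD ht.1 hst hs.2).trans ?_
        have : √(s - t) ≤ 1 := Real.sqrt_le_one.2 (by linarith [hs.2, ht.1])
        nlinarith
    have := norm_le_norm_add_norm_sub' (ev x t) (ev x s)
    linarith
  have h2 : ∫ s in (0:ℝ)..1, ‖ev x t‖ ≤ ∫ s in (0:ℝ)..1, ((1 / 2 + C) + 1 / 2 * ‖ev x s‖ ^ 2) := by
    apply intervalIntegral.integral_mono_on zero_le_one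
    · simp
    · exact Continuous.intervalIntegrable (by fun_prop) _ _
    · intro s hs
      have := hosc s hs
      nlinarith [sq_nonneg (‖ev x s‖ - 1)]
  rw [intervalIntegral.integral_add (by simp) (Continuous.intervalIntegrable (by fun_prop) _ _),
      intervalIntegral.integral_const, intervalIntegral.integral_const,
      intervalIntegral.integral_const_mul, parseval_norm] at h2
  simp only [sub_zero, one_smul] at h2
  linarith

lemma ev_periodic (x : TP n N) : ev x 0 = ev x 1 := by
  simp [ev, ex_at_zero, ex_at_one]

/-- Compactness. -/
lemma Ham.subseq (h : Ham n i₀ H X c m Lp K ρ p) (x : ∀ j : ℕ, TP n (j + 1))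
    (hx : ∀ j, Gr X (x j) = 0) : ∃ R : ℝ, ∃ u : ℝ → V n, ∃ φ : ℕ → ℕ, StrictMono φ ∧ Continuous u ∧
      (∀ j, ∀ t ∈ Set.Icc (0:ℝ) 1, ‖ev (x j) t‖ ≤ R) ∧
      ∀ t ∈ Set.Icc (0:ℝ) 1, Filter.Tendsto (fun j => ev (x (φ j)) t) Filter.atTop (nhds (u t)) := by
  obtain ⟨C, R, hC, hest⟩ := h.estimates
  let e : ℕ → BoundedContinuousFunction (Set.Icc (0:ℝ) 1) (V n) := fun j =>
    BoundedContinuousFunction.mkOfCompact ⟨fun t => ev (x j) t,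
      (continuous_ev (x j)).comp continuous_subtype_val⟩
  have he : ∀ j (t : Set.Icc (0:ℝ) 1), e j t = ev (x j) t := fun j t => rfl
  have hcomp : IsCompact (closure (Set.range e)) := by
    apply BoundedContinuousFunction.arzela_ascoli (Metric.closedBall (0 : V n) R)
      (isCompact_closedBall _ _)
    · rintro f t ⟨j, rfl⟩
      rw [mem_closedBall_zero_iff, he]
      exact (hest _ (x j) (hx j)).2 t t.2
    · apply Metric.equicontinuous_of_continuity_modulus (fun s => C * √s)
      · have : Continuous fun s : ℝ => C * √s := by fun_prop
        have h2 := this.tendsto 0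
        simpa using h2
      · rintro s t ⟨_, j, rfl⟩
        change dist (e j s) (e j t) ≤ _
        rw [he, he, dist_eq_norm, Subtype.dist_eq, Real.dist_eq]
        have hD := (hest _ (x j) (hx j)).1
        rcases le_total (s:ℝ) (t:ℝ) with hst | hst
        · rw [norm_sub_rev, abs_sub_comm, abs_of_nonneg (by linarith)]
          exact ev_osc (x j) hC hD s.2.1 hst t.2.2
        · rw [abs_of_nonneg (by linarith)]
          exact ev_osc (x j) hC hD t.2.1 hst s.2.2
  obtain ⟨f, -, φ, hφ, hlim⟩ := hcomp.tendsto_subseq (x := e)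
    (fun j => subset_closure (Set.mem_range_self j))
  refine ⟨R, fun t => f (Set.projIcc 0 1 zero_le_one t), φ, hφ,
    f.continuous.comp continuous_projIcc, fun j => (hest _ (x j) (hx j)).2, fun t ht => ?_⟩
  simp only
  rw [Set.projIcc_of_mem _ ht]
  rw [tendsto_iff_dist_tendsto_zero] at hlim ⊢
  refine squeeze_zero (fun _ => dist_nonneg) (fun j => ?_) hlim
  exact BoundedContinuousFunction.dist_coe_le_dist (f := e (φ j)) (g := f) ⟨t, ht⟩

/-- Existence of a 1-periodic orbit with positive action. -/
lemma Ham.orbit (h : Ham n i₀ H X c m Lp K ρ p) : ∃ u : ℝ → V n, Continuous u ∧ u 0 = u 1 ∧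
    (∀ t ∈ Set.Icc (0:ℝ) 1, u t = u 0 + ∫ s in (0:ℝ)..t, Complex.I • X (u s)) ∧
    0 < ∫ t in (0:ℝ)..1, (1 / 2 * inner ℝ (X (u t)) (u t) - H (u t)) := by
  obtain ⟨β, hβ, hcrit⟩ := h.galerkin
  choose x hx hxA using fun j : ℕ => hcrit (j + 1) (by omega)
  obtain ⟨R, u, φ, hφ, hu, hR, hlim⟩ := h.subseq x hx
  have hX := h.Xc
  have hH := h.Hc
  have hconv := fun {F : Type} [NormedAddCommGroup F] [NormedSpace ℝ F] (Φ : ℝ × V n → F)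
    (hΦ : Continuous Φ) => tendsto_integral_comp Φ hΦ (fun j => ev (x (φ j))) u
      (fun j => continuous_ev _) (fun j => hR _) hlim
  have hper : u 0 = u 1 := by
    have h0 := hlim 0 (by simp)
    have h1 := hlim 1 (by simp)
    simp only [ev_periodic] at h0
    exact tendsto_nhds_unique h0 h1
  refine ⟨u, hu, hper, ?_, ?_⟩
  · have hcoef : ∀ k : ℤ, (2 * π * k : ℝ) • (∫ t in (0:ℝ)..1, ex (-k) t • u t)
        = ∫ t in (0:ℝ)..1, ex (-k) t • X (u t) := by
      intro k
      have h1 := (hconv (fun q => ex (-k) q.1 • q.2)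
        (((continuous_ex _).comp continuous_fst).smul continuous_snd)).const_smul (2 * π * k : ℝ)
      have h2 := hconv (fun q => ex (-k) q.1 • X q.2)
        (((continuous_ex _).comp continuous_fst).smul (hX.comp continuous_snd))
      refine tendsto_nhds_unique (h1.congr' ?_) h2
      filter_upwards [Filter.eventually_ge_atTop k.natAbs] with j hj
      have hj2 := hφ.id_le j
      simp only [id] at hj2
      have hk : k ∈ Finset.Icc (-((φ j + 1 : ℕ):ℤ)) ((φ j + 1 : ℕ):ℤ) := by
        rw [Finset.mem_Icc]; omega
      have h3 := congrArg (fun z : TP n (φ j + 1) => z ⟨k, hk⟩) (cf_ev (x (φ j)))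
      have h4 := congrArg (fun z : TP n (φ j + 1) => z ⟨k, hk⟩) (sub_eq_zero.1 (hx (φ j)))
      simp only [cf, Dop] at h3 h4
      rw [h3, h4]
    intro t ht
    ext i
    have hcomp : ∀ (g : ℝ → V n) (a b : ℝ), Continuous g →
        (∫ t in a..b, g t) i = ∫ t in a..b, g t i := by
      intro g a b hg
      exact ((EuclideanSpace.proj (𝕜 := ℂ) i).intervalIntegral_comp_comm (f := g)
        (hg.intervalIntegrable _ _)).symm
    have hXu : Continuous fun t => X (u t) := hX.comp hu
    rw [PiLp.add_apply, hcomp _ _ _ (by fun_prop)]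
    simp only [PiLp.smul_apply, smul_eq_mul]
    rw [intervalIntegral.integral_const_mul]
    refine fourier_ode (fun t => u t i) (fun t => X (u t) i) (by fun_prop) (by fun_prop)
      (by simp only [hper]) ?_ t ht
    intro k
    have h1 := congrArg (fun v : V n => v i) (hcoef k)
    have hce := continuous_ex (-k)
    simp only [PiLp.smul_apply] at h1
    rw [hcomp _ _ _ (by fun_prop), hcomp _ _ _ (by fun_prop)] at h1
    simpa only [PiLp.smul_apply, smul_eq_mul, Complex.real_smul] using h1
  · have h1 := hconv (fun q => 1 / 2 * inner ℝ (X q.2) q.2 - H q.2) (by fun_prop)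
    refine hβ.trans_le (ge_of_tendsto' h1 fun j => ?_)
    have := hxA (φ j)
    rwa [crit_act hH hX _ (hx _)] at this

end NSq


namespace NSq

variable {n : ℕ}

lemma omega_inner (v w : V n) : omegaStd n v w = inner ℝ (Complex.I • v) w := by
  unfold omegaStd
  rw [PiLp.inner_apply]
  refine Finset.sum_congr rfl fun k _ => ?_
  simp [Complex.inner]
  ring

lemma inner_I_I (v w : V n) : inner ℝ (Complex.I • v) (Complex.I • w) = inner ℝ v w := by
  rw [PiLp.inner_apply, PiLp.inner_apply]
  refine Finset.sum_congr rfl fun k _ => ?_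
  simp [Complex.inner]

lemma inner_I_self (v : V n) : inner ℝ v (Complex.I • v) = 0 := by
  rw [PiLp.inner_apply]
  refine Finset.sum_eq_zero fun k _ => ?_
  simp [Complex.inner]
  ring

lemma omega_I_left (v w : V n) : omegaStd n (Complex.I • v) w = - inner ℝ v w := by
  rw [omega_inner, smul_smul, Complex.I_mul_I, neg_one_smul, inner_neg_left]

lemma omega_nondeg {v : V n} (h : ∀ w, omegaStd n v w = 0) : v = 0 := by
  have h1 := h (Complex.I • v)
  rw [omega_inner, real_inner_self_eq_norm_sq] at h1
  have h2 : ‖Complex.I • v‖ = 0 := by simpa using h1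
  rw [norm_smul, Complex.norm_I, one_mul] at h2
  exact norm_eq_zero.1 h2

/-- The inverse of a symplectic embedding is smooth. -/
lemma inverse_smooth {B : Set (V n)} (hB : IsOpen B) {ψ : V n → V n}
    (hψ : IsSymplecticEmbedding n B Set.univ ψ) :
    ∃ φ : V n → V n, ∀ y ∈ B, φ (ψ y) = y ∧ ContDiffAt ℝ (⊤ : ℕ∞) φ (ψ y) ∧
      ψ '' B ∈ nhds (ψ y) := by
  obtain ⟨hsm, hinj, -, hsymp⟩ := hψ
  refine ⟨Function.invFunOn ψ B, fun y hy => ?_⟩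
  have hleft : ∀ z ∈ B, Function.invFunOn ψ B (ψ z) = z := fun z hz =>
    hinj.leftInvOn_invFunOn hz
  have hCD : ContDiffAt ℝ (⊤ : ℕ∞) ψ y := hsm.contDiffAt (hB.mem_nhds hy)
  have hker : Function.Injective (fderiv ℝ ψ y).toLinearMap := by
    rw [injective_iff_map_eq_zero]
    intro v hv
    apply omega_nondeg
    intro w
    rw [← hsymp y hy v w]
    have : fderiv ℝ ψ y v = 0 := hv
    rw [this]
    simp [omegaStd]
  let A : V n ≃L[ℝ] V n :=
    (LinearEquiv.ofInjectiveEndo (fderiv ℝ ψ y).toLinearMap hker).toContinuousLinearEquiv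
  have hA : (A : V n →L[ℝ] V n) = fderiv ℝ ψ y := by
    ext1 v; rfl
  have hd : HasFDerivAt ψ (A : V n →L[ℝ] V n) y := by
    rw [hA]
    exact (hCD.differentiableAt (by simp)).hasFDerivAt
  have hn : ((⊤ : ℕ∞) : WithTop ℕ∞) ≠ 0 := by simp
  let e := hCD.toOpenPartialHomeomorph ψ hd hn
  have he : (e : V n → V n) = ψ := hCD.toOpenPartialHomeomorph_coe hd hn
  have hye : y ∈ e.source := hCD.mem_toOpenPartialHomeomorph_source hd hn
  have hsymm := hCD.to_localInverse hd hn
  have hlocdef : hCD.localInverse hd hn = e.symm := rfl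
  rw [hlocdef] at hsymm
  have hyt : ψ y ∈ e.target := by rw [← he]; exact e.map_source hye
  have hey : e.symm (ψ y) = y := by rw [← he]; exact e.left_inv hye
  have hev1 : ∀ᶠ z in nhds (ψ y), e.symm z ∈ B := by
    apply hsymm.continuousAt.eventually
    rw [hey]
    exact hB.mem_nhds hy
  have hev2 : ∀ᶠ z in nhds (ψ y), ψ (e.symm z) = z := by
    filter_upwards [e.open_target.mem_nhds hyt] with z hz
    rw [← he]
    exact e.right_inv hz
  refine ⟨hleft y hy, ?_, ?_⟩
  · refine hsymm.congr_of_eventuallyEq ?_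
    filter_upwards [hev1, hev2] with z h1 h2
    rw [← hleft _ h1, h2]
  · filter_upwards [hev1, hev2] with z h1 h2
    exact ⟨_, h1, h2⟩

lemma prim_deriv {b : ℝ → ℝ} (hb : Continuous b) (s : ℝ) :
    HasDerivAt (fun s => ∫ t in (0:ℝ)..s, b t) (b s) s :=
  intervalIntegral.integral_hasDerivAt_right (hb.intervalIntegrable _ _)
      (hb.stronglyMeasurableAtFilter _ _) hb.continuousAt

lemma prim_contDiff {b : ℝ → ℝ} (hb : ContDiff ℝ (⊤ : ℕ∞) b) :
    ContDiff ℝ (⊤ : ℕ∞) (fun s => ∫ t in (0:ℝ)..s, b t) := by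
  rw [contDiff_infty_iff_deriv]
  refine ⟨fun s => (prim_deriv hb.continuous s).differentiableAt, ?_⟩
  have : deriv (fun s => ∫ t in (0:ℝ)..s, b t) = b := funext fun s => (prim_deriv hb.continuous s).deriv
  rwa [this]

/-- The function `f`. -/
lemma exists_f {m a₀ : ℝ} (ha : a₀ < m) (hm : 0 ≤ m) : ∃ f σ : ℝ → ℝ, ∃ κ : ℝ, ContDiff ℝ (⊤ : ℕ∞) f ∧
    (∀ s, HasDerivAt f (σ s) s) ∧ (∀ s, m ≤ s → f s = s + κ) ∧ (∀ s, 0 ≤ s → m ≤ f s) ∧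
    (∀ s, 0 ≤ s → s ≤ a₀ → f s = m ∧ σ s = 0) ∧ (∀ s, 0 ≤ s → s * σ s ≤ f s) := by
  let σ : ℝ → ℝ := fun s => Real.smoothTransition ((s - a₀) / (m - a₀))
  have hma : 0 < m - a₀ := by linarith
  have hσ : ContDiff ℝ (⊤ : ℕ∞) σ := by
    have := Real.smoothTransition.contDiff (n := (⊤ : ℕ∞))
    exact this.comp (by fun_prop)
  have hσc := hσ.continuous
  have h0 : ∀ s, 0 ≤ σ s := fun s => Real.smoothTransition.nonneg _
  have h1 : ∀ s, σ s ≤ 1 := fun s => Real.smoothTransition.le_one _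
  have hlow : ∀ s, s ≤ a₀ → σ s = 0 := fun s hs =>
    Real.smoothTransition.zero_of_nonpos (div_nonpos_of_nonpos_of_nonneg (by linarith) hma.le)
  have hhigh : ∀ s, m ≤ s → σ s = 1 := fun s hs =>
    Real.smoothTransition.one_of_one_le (by rw [le_div_iff₀ hma]; linarith)
  have hintg : ∀ a b, IntervalIntegrable σ volume a b := fun a b => hσc.intervalIntegrable _ _
  have hbig : ∀ s, m ≤ s → ∫ t in (0:ℝ)..s, σ t = s - m + ∫ t in (0:ℝ)..m, σ t := by
    intro s hs
    rw [← intervalIntegral.integral_add_adjacent_intervals (hintg 0 m) (hintg m s), add_comm]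
    congr 1
    rw [intervalIntegral.integral_congr (g := fun _ => (1:ℝ))]
    · simp
    · intro t ht
      rw [Set.uIcc_of_le hs] at ht
      exact hhigh t ht.1
  have hnn : ∀ s, 0 ≤ s → 0 ≤ ∫ t in (0:ℝ)..s, σ t := fun s hs =>
    intervalIntegral.integral_nonneg hs fun t _ => h0 t
  refine ⟨fun s => m + ∫ t in (0:ℝ)..s, σ t, σ, ∫ t in (0:ℝ)..m, σ t,
    contDiff_const.add (prim_contDiff hσ), fun s => (prim_deriv hσc s).const_add m, ?_, ?_, ?_, ?_⟩
  · intro s hs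
    simp only [hbig s hs]; ring
  · intro s hs
    simp only
    linarith [hnn s hs]
  · intro s hs hsa
    refine ⟨?_, hlow s hsa⟩
    simp only
    rw [intervalIntegral.integral_congr (g := fun _ => (0:ℝ))]
    · simp
    · intro t ht
      rw [Set.uIcc_of_le hs] at ht
      exact hlow t (ht.2.trans hsa)
  · intro s hs
    simp only
    rcases le_total s m with h | h
    · have := hnn s hs
      nlinarith [h1 s, h0 s]
    · rw [hbig s h, hhigh s h]
      linarith [hnn m hm]

/-- The function `g`. -/
lemma exists_g {m R : ℝ} (hm : 0 < m) (hR : m < R) : ∃ g b : ℝ → ℝ, ∃ ε : ℝ, 0 < ε ∧ ε < R ∧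
    ContDiff ℝ (⊤ : ℕ∞) g ∧ (∀ s, HasDerivAt g (-b s) s) ∧ (∀ s, 0 ≤ b s ∧ b s < 1) ∧
    (∀ s, s ≤ ε → g s = m ∧ b s = 0) ∧ (∀ s, R - ε ≤ s → g s = 0) ∧ (∀ s, 0 ≤ s → 0 ≤ g s ∧ g s ≤ m) := by
  set ε : ℝ := (R - m) / 8 with hε
  have hε0 : 0 < ε := by rw [hε]; linarith
  let b₀ : ℝ → ℝ := fun s => Real.smoothTransition ((s - ε) / ε) * Real.smoothTransition ((R - ε - s) / ε)
  have hb₀ : ContDiff ℝ (⊤ : ℕ∞) b₀ := by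
    have h := Real.smoothTransition.contDiff (n := (⊤ : ℕ∞))
    exact (h.comp (by fun_prop)).mul (h.comp (by fun_prop))
  have h0 : ∀ s, 0 ≤ b₀ s := fun s =>
    mul_nonneg (Real.smoothTransition.nonneg _) (Real.smoothTransition.nonneg _)
  have h1 : ∀ s, b₀ s ≤ 1 := fun s =>
    mul_le_one₀ (Real.smoothTransition.le_one _) (Real.smoothTransition.nonneg _) (Real.smoothTransition.le_one _)
  have hlow : ∀ s, s ≤ ε → b₀ s = 0 := fun s hs => by
    simp only [b₀]
    rw [Real.smoothTransition.zero_of_nonpos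
      (div_nonpos_of_nonpos_of_nonneg (by linarith) hε0.le), zero_mul]
  have hhigh : ∀ s, R - ε ≤ s → b₀ s = 0 := fun s hs => by
    simp only [b₀]
    rw [Real.smoothTransition.zero_of_nonpos (x := (R - ε - s) / ε)
      (div_nonpos_of_nonpos_of_nonneg (by linarith) hε0.le), mul_zero]
  have hmid : ∀ s, 2 * ε ≤ s → s ≤ R - 2 * ε → b₀ s = 1 := fun s hs hs2 => by
    simp only [b₀]
    rw [Real.smoothTransition.one_of_one_le (by rw [le_div_iff₀ hε0]; linarith),
      Real.smoothTransition.one_of_one_le (by rw [le_div_iff₀ hε0]; linarith), mul_one]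
  have hc := hb₀.continuous
  have hintg : ∀ a b, IntervalIntegrable b₀ volume a b := fun a b => hc.intervalIntegrable _ _
  set I := ∫ t in (0:ℝ)..R, b₀ t with hI
  have hIm : m < I := by
    have h2 : ∫ t in (2 * ε)..(R - 2 * ε), b₀ t = R - 4 * ε := by
      rw [intervalIntegral.integral_congr (g := fun _ => (1:ℝ))]
      · simp; ring
      · intro t ht
        rw [Set.uIcc_of_le (by linarith)] at ht
        exact hmid t ht.1 ht.2
    have h3 : ∫ t in (2 * ε)..(R - 2 * ε), b₀ t ≤ I := by
      apply intervalIntegral.integral_mono_interval (by linarith) (by linarith) (by linarith)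
      · exact Filter.Eventually.of_forall h0
      · exact hintg _ _
    linarith
  have hI0 : 0 < I := hm.trans hIm
  let b : ℝ → ℝ := fun s => m / I * b₀ s
  have hb : ContDiff ℝ (⊤ : ℕ∞) b := contDiff_const.mul hb₀
  have hbnn : ∀ s, 0 ≤ b s := fun s => mul_nonneg (by positivity) (h0 s)
  have hbint : ∀ a c, IntervalIntegrable b volume a c := fun a c => hb.continuous.intervalIntegrable _ _
  have hbI : ∫ t in (0:ℝ)..R, b t = m := by
    simp only [b]
    rw [intervalIntegral.integral_const_mul, ← hI]; field_simp
  have htail : ∀ s, R - ε ≤ s → ∫ t in (0:ℝ)..s, b t = m := by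
    intro s hs
    rw [← hbI, ← intervalIntegral.integral_add_adjacent_intervals (hbint 0 R) (hbint R s)]
    rw [intervalIntegral.integral_congr (a := R) (b := s) (g := fun _ => (0:ℝ))]
    · simp
    · intro t ht
      have : R - ε ≤ t := (le_min (by linarith) hs).trans ht.1
      simp [b, hhigh t this]
  refine ⟨fun s => m - ∫ t in (0:ℝ)..s, b t, b, ε, hε0, by linarith,
    contDiff_const.sub (prim_contDiff hb), fun s => (prim_deriv hb.continuous s).const_sub m,
    fun s => ⟨hbnn s, ?_⟩, ?_, ?_, ?_⟩
  · have : m / I < 1 := by rw [div_lt_one hI0]; exact hIm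
    have h2 : 0 < m / I := by positivity
    calc m / I * b₀ s ≤ m / I * 1 := mul_le_mul_of_nonneg_left (h1 s) h2.le
      _ < 1 := by linarith
  · intro s hs
    refine ⟨?_, by simp [b, hlow s hs]⟩
    simp only
    rw [intervalIntegral.integral_congr (g := fun _ => (0:ℝ))]
    · simp
    · intro t ht
      have : t ≤ ε := ht.2.trans (max_le hε0.le hs)
      simp [b, hlow t this]
  · intro s hs
    simp only [htail s hs, sub_self]
  · intro s hs
    have h2 : 0 ≤ ∫ t in (0:ℝ)..s, b t := intervalIntegral.integral_nonneg hs fun t _ => hbnn t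
    refine ⟨?_, by simp only; linarith⟩
    have h3 : ∫ t in (0:ℝ)..s, b t ≤ ∫ t in (0:ℝ)..(max s R), b t := by
      apply intervalIntegral.integral_mono_interval le_rfl hs (le_max_left _ _)
      · exact Filter.Eventually.of_forall hbnn
      · exact hbint _ _
    rw [htail (max s R) (by have := le_max_right s R; linarith)] at h3
    simp only; linarith

/-- Gradients of compactly supported functions. -/
lemma grad_package {E : V n → ℝ} (hE : ContDiff ℝ (⊤ : ℕ∞) E) (hcs : HasCompactSupport E) :
    ∃ (Y : V n → V n) (L K : ℝ), 0 ≤ L ∧ (∀ z v, fderiv ℝ E z v = inner ℝ (Y z) v) ∧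
      (∀ a b, ‖Y a - Y b‖ ≤ L * ‖a - b‖) ∧
      (∀ a b, |E (a + b) - E a - inner ℝ (Y a) b| ≤ L * ‖b‖ ^ 2) ∧ ∀ z, ‖Y z‖ ≤ K := by
  have hD : ContDiff ℝ 1 (fderiv ℝ E) := hE.fderiv_right (m := 1)
    (WithTop.coe_le_coe.2 (le_top : (1 + 1 : ℕ∞) ≤ ⊤))
  have hDcs : HasCompactSupport (fderiv ℝ E) := hcs.fderiv ℝ
  obtain ⟨L, hL⟩ := hD.lipschitzWith_of_hasCompactSupport hDcs (by simp)
  obtain ⟨K, hK⟩ := hDcs.exists_bound_of_continuous hD.continuous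
  have hL' : ∀ a b, ‖fderiv ℝ E a - fderiv ℝ E b‖ ≤ L * ‖a - b‖ := fun a b => by
    rw [← dist_eq_norm, ← dist_eq_norm]; exact hL.dist_le_mul a b
  refine ⟨fun z => (InnerProductSpace.toDual ℝ (V n)).symm (fderiv ℝ E z), L, K, L.2, ?_, ?_, ?_, ?_⟩
  · intro z v
    rw [InnerProductSpace.toDual_symm_apply]
  · intro a b
    rw [← map_sub, LinearIsometryEquiv.norm_map]
    exact hL' a b
  · intro a b
    rw [InnerProductSpace.toDual_symm_apply]
    have := (convex_closedBall a ‖b‖).norm_image_sub_le_of_norm_hasFDerivWithin_le'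
      (f := E) (f' := fun x => fderiv ℝ E x) (φ := fderiv ℝ E a) (C := L * ‖b‖) (x := a) (y := a + b)
      (fun x _ => ((hE.differentiable (by simp)) x).hasFDerivAt.hasFDerivWithinAt)
      (fun x hx => by
        refine (hL' x a).trans ?_
        apply mul_le_mul_of_nonneg_left _ L.2
        rwa [mem_closedBall_iff_norm] at hx)
      (by simp) (by simp)
    rw [add_sub_cancel_left, Real.norm_eq_abs] at this
    rw [pow_two, ← mul_assoc]
    exact this
  · intro z
    rw [LinearIsometryEquiv.norm_map]
    exact hK z

end NSq


namespace NSq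

variable {n : ℕ}

lemma const_of_deriv_zero {E : Type*} [NormedAddCommGroup E] [NormedSpace ℝ E] {f : ℝ → E}
    (h : ∀ t ∈ Set.Icc (0:ℝ) 1, HasDerivAt f 0 t) : ∀ t ∈ Set.Icc (0:ℝ) 1, f t = f 0 :=
  constant_of_has_deriv_right_zero (fun t ht => (h t ht).continuousAt.continuousWithinAt)
    (fun t ht => (h t (Set.Ico_subset_Icc_self ht)).hasDerivWithinAt)

/-- Open ball of capacity `R`. -/
def Bl (n : ℕ) (R : ℝ) : Set (V n) := {z | π * ‖z‖ ^ 2 < R}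

lemma isOpen_Bl (R : ℝ) : IsOpen (Bl n R) := isOpen_lt (by fun_prop) continuous_const

lemma smooth_G {R ε : ℝ} {g : ℝ → ℝ} {ψ φ : V n → V n}
    (hψ : IsSymplecticEmbedding n (Bl n R) Set.univ ψ)
    (hφ : ∀ y ∈ Bl n R, φ (ψ y) = y ∧ ContDiffAt ℝ (⊤ : ℕ∞) φ (ψ y) ∧ ψ '' Bl n R ∈ nhds (ψ y))
    (hg : ContDiff ℝ (⊤ : ℕ∞) g) (hε : 0 < ε) (hgR : ∀ s, R - ε ≤ s → g s = 0) :
    ∃ G : V n → ℝ, ContDiff ℝ (⊤ : ℕ∞) G ∧ (∀ y ∈ Bl n R, G (ψ y) = g (π * ‖y‖ ^ 2)) ∧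
      ∀ z, z ∉ ψ '' Bl n R → G z = 0 := by
  classical
  let G : V n → ℝ := fun z => if z ∈ ψ '' Bl n R then g (π * ‖φ z‖ ^ 2) else 0
  have hGψ : ∀ y ∈ Bl n R, G (ψ y) = g (π * ‖y‖ ^ 2) := by
    intro y hy
    simp only [G]
    rw [if_pos ⟨y, hy, rfl⟩, (hφ y hy).1]
  refine ⟨G, ?_, hGψ, fun z hz => if_neg hz⟩
  let C : Set (V n) := {z | π * ‖z‖ ^ 2 ≤ R - ε}
  have hCB : C ⊆ Bl n R := fun z hz => by
    have : π * ‖z‖ ^ 2 ≤ R - ε := hz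
    change π * ‖z‖ ^ 2 < R
    linarith
  have hCc : IsCompact C := by
    apply Metric.isCompact_of_isClosed_isBounded
    · exact isClosed_le (by fun_prop) continuous_const
    · rw [isBounded_iff_forall_norm_le]
      refine ⟨√((R - ε) / π), fun z hz => Real.le_sqrt_of_sq_le ?_⟩
      rw [le_div_iff₀ pi_pos, mul_comm]
      exact hz
  have hKc : IsCompact (ψ '' C) := hCc.image_of_continuousOn (hψ.1.continuousOn.mono hCB)
  rw [contDiff_iff_contDiffAt]
  intro z
  by_cases hz : z ∈ ψ '' C
  · obtain ⟨y, hy, rfl⟩ := hz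
    obtain ⟨-, h2, h3⟩ := hφ y (hCB hy)
    have h4 : ContDiffAt ℝ (⊤ : ℕ∞) (fun z => g (π * ‖φ z‖ ^ 2)) (ψ y) := by
      apply hg.contDiffAt.comp
      exact contDiffAt_const.mul (h2.norm_sq ℝ)
    refine h4.congr_of_eventuallyEq ?_
    filter_upwards [h3] with z hz
    exact if_pos hz
  · have h4 : ContDiffAt ℝ (⊤ : ℕ∞) (fun _ : V n => (0:ℝ)) z := contDiffAt_const
    refine h4.congr_of_eventuallyEq ?_
    filter_upwards [hKc.isClosed.isOpen_compl.mem_nhds hz] with z' hz'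
    by_cases h5 : z' ∈ ψ '' Bl n R
    · obtain ⟨y, hy, rfl⟩ := h5
      rw [hGψ y hy]
      apply hgR
      by_contra hlt
      exact hz' ⟨y, (not_le.1 hlt).le, rfl⟩
    · exact if_neg h5

/-- The quadratic form at infinity. -/
noncomputable def Qf (c : Fin n → ℝ) (z : V n) : ℝ := π * ∑ j, c j * ‖z j‖ ^ 2

lemma Qf_contDiff (c : Fin n → ℝ) : ContDiff ℝ (⊤ : ℕ∞) (Qf c) := by
  unfold Qf
  refine contDiff_const.mul (ContDiff.sum fun j _ => contDiff_const.mul ?_)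
  apply ContDiff.norm_sq ℝ
  have : ContDiff ℝ (⊤ : ℕ∞) fun z : V n => (EuclideanSpace.proj (𝕜 := ℂ) j).restrictScalars ℝ z :=
    ContinuousLinearMap.contDiff _
  exact this

lemma Qf_add (c : Fin n → ℝ) (a b : V n) :
    Qf c (a + b) = Qf c a + inner ℝ (dg (fun j => 2 * π * c j) a) b + Qf c b := by
  unfold Qf
  rw [PiLp.inner_apply, Finset.mul_sum, Finset.mul_sum, Finset.mul_sum, ← Finset.sum_add_distrib,
    ← Finset.sum_add_distrib]
  refine Finset.sum_congr rfl fun j _ => ?_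
  rw [PiLp.add_apply, norm_add_sq_real, dg_apply, ← Complex.real_smul, real_inner_smul_left]
  ring

lemma Qf_bounds {c : Fin n → ℝ} {l h : ℝ} (hl : ∀ j, l ≤ c j) (hh : ∀ j, c j ≤ h) (z : V n) :
    π * l * ‖z‖ ^ 2 ≤ Qf c z ∧ Qf c z ≤ π * h * ‖z‖ ^ 2 := by
  unfold Qf
  rw [EuclideanSpace.norm_sq_eq, mul_assoc, mul_assoc]
  constructor
  · apply mul_le_mul_of_nonneg_left _ pi_pos.le
    rw [Finset.mul_sum]
    exact Finset.sum_le_sum fun j _ => mul_le_mul_of_nonneg_right (hl j) (by positivity)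
  · apply mul_le_mul_of_nonneg_left _ pi_pos.le
    rw [Finset.mul_sum]
    exact Finset.sum_le_sum fun j _ => mul_le_mul_of_nonneg_right (hh j) (by positivity)

lemma Qf_hasFDerivAt (c : Fin n → ℝ) (z : V n) :
    HasFDerivAt (Qf c) (innerSL ℝ (dg (fun j => 2 * π * c j) z)) z := by
  rw [hasFDerivAt_iff_isLittleO_nhds_zero]
  have h1 : ∀ b : V n, Qf c (z + b) - Qf c z - innerSL ℝ (dg (fun j => 2 * π * c j) z) b
      = Qf c b := by
    intro b
    rw [Qf_add, innerSL_apply_apply]; ring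
  simp only [h1]
  obtain ⟨h, hh⟩ : ∃ h, ∀ j, |c j| ≤ h := by
    refine ⟨∑ j, |c j|, fun j => Finset.single_le_sum (f := fun j => |c j|)
      (fun _ _ => abs_nonneg _) (Finset.mem_univ j)⟩
  have h2 : (fun b : V n => Qf c b) =O[nhds 0] fun b : V n => ‖b‖ ^ 2 := by
    refine Asymptotics.IsBigO.of_bound (π * h) (Filter.Eventually.of_forall fun b => ?_)
    have h3 := Qf_bounds (c := c) (l := -h) (h := h) (fun j => (abs_le.1 (hh j)).1)
      (fun j => (abs_le.1 (hh j)).2) b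
    rw [Real.norm_eq_abs, Real.norm_eq_abs, abs_of_nonneg (by positivity : 0 ≤ ‖b‖ ^ 2), abs_le]
    constructor <;> linarith [h3.1, h3.2]
  refine h2.trans_isLittleO ?_
  have h4 : (fun b : V n => ‖b‖ ^ 2) =o[nhds 0] fun b : V n => ‖b‖ :=
    ((Asymptotics.isLittleO_pow_id (𝕜 := ℝ) (n := 2) (by norm_num)).comp_tendsto
      (tendsto_norm_zero))
  exact h4.norm_right.of_norm_right.trans_isBigO
    (Asymptotics.isBigO_norm_left.2 (Asymptotics.isBigO_refl _ _))

end NSq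


namespace NSq

variable {n : ℕ}

lemma orbit_ode {H : V n → ℝ} {X : V n → V n} (hX : Continuous X) {u : ℝ → V n}
    (hu : Continuous u) (h01 : u 0 = u 1)
    (hode : ∀ t ∈ Set.Icc (0:ℝ) 1, u t = u 0 + ∫ s in (0:ℝ)..t, Complex.I • X (u s))
    (hact : 0 < ∫ t in (0:ℝ)..1, (1/2 * inner ℝ (X (u t)) (u t) - H (u t))) :
    ∃ w : ℝ → V n, w 0 = w 1 ∧ (∀ t ∈ Set.Icc (0:ℝ) 1, HasDerivAt w (Complex.I • X (w t)) t) ∧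
      0 < ∫ t in (0:ℝ)..1, (1/2 * inner ℝ (X (w t)) (w t) - H (w t)) := by
  let w : ℝ → V n := fun t => u 0 + ∫ s in (0:ℝ)..t, Complex.I • X (u s)
  have hwu : ∀ t ∈ Set.Icc (0:ℝ) 1, u t = w t := hode
  have hc : Continuous fun s => Complex.I • X (u s) := by fun_prop
  refine ⟨w, ?_, ?_, ?_⟩
  · rw [← hwu 0 (by simp), ← hwu 1 (by simp), h01]
  · intro t ht
    rw [← hwu t ht]
    refine HasDerivAt.const_add (u 0) ?_
    exact intervalIntegral.integral_hasDerivAt_right (hc.intervalIntegrable _ _)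
      (hc.stronglyMeasurableAtFilter _ _) hc.continuousAt
  · refine lt_of_lt_of_eq hact (intervalIntegral.integral_congr fun t ht => ?_)
    rw [Set.uIcc_of_le zero_le_one] at ht
    simp only [hwu t ht]

lemma ball_orbit {b : ℝ → ℝ} (hb : ∀ s, 0 ≤ b s ∧ b s < 1) {y : ℝ → V n} (h01 : y 0 = y 1)
    (hy : ∀ t ∈ Set.Icc (0:ℝ) 1,
      HasDerivAt y ((2 * π * b (π * ‖y t‖ ^ 2)) • Complex.I • y t) t) :
    ∀ t ∈ Set.Icc (0:ℝ) 1, (2 * π * b (π * ‖y t‖ ^ 2)) • Complex.I • y t = 0 := by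
  have h1 : ∀ t ∈ Set.Icc (0:ℝ) 1, ‖y t‖ ^ 2 = ‖y 0‖ ^ 2 := by
    apply const_of_deriv_zero (f := fun t => ‖y t‖ ^ 2)
    intro t ht
    refine ((hy t ht).norm_sq).congr_deriv ?_
    rw [real_inner_smul_right, inner_I_self]; ring
  set l : ℝ := b (π * ‖y 0‖ ^ 2) with hl
  have hy' : ∀ t ∈ Set.Icc (0:ℝ) 1, HasDerivAt y ((2 * π * l) • Complex.I • y t) t := by
    intro t ht
    have := hy t ht
    rwa [h1 t ht] at this
  have h2 : ∀ t ∈ Set.Icc (0:ℝ) 1,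
      Complex.exp (-(2 * π * l * t * Complex.I)) • y t = y 0 := by
    intro t ht
    have h3 := const_of_deriv_zero (f := fun t : ℝ => Complex.exp (-(2 * π * l * t * Complex.I)) • y t)
      ?_ t ht
    · simpa using h3
    intro s hs
    have he : HasDerivAt (fun t : ℝ => Complex.exp (-(2 * π * l * t * Complex.I)))
        (Complex.exp (-(2 * π * l * s * Complex.I)) * (-(2 * π * l * Complex.I))) s := by
      apply HasDerivAt.cexp
      have h5 : HasDerivAt (fun t : ℝ => (t : ℂ)) 1 s := Complex.ofRealCLM.hasDerivAt
      refine (((h5.const_mul (2 * π * l : ℂ)).mul_const Complex.I).neg).congr_deriv ?_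
      ring
    refine (he.smul (hy' s hs)).congr_deriv ?_
    have h6 : ((2 * π * l : ℝ)) • Complex.I • y s = ((2 * π * l * Complex.I : ℂ)) • y s := by
      rw [← Complex.coe_smul, smul_smul]; push_cast; rfl
    rw [h6, smul_smul, ← add_smul]
    ring_nf
    exact zero_smul _ _
  intro t ht
  rw [h1 t ht, ← hl]
  by_cases hy0 : y t = 0
  · rw [hy0]; simp
  suffices l = 0 by rw [this]; simp
  have h0 : y 0 ≠ 0 := by
    intro h
    have := h1 t ht
    rw [h] at this
    simp at this
    exact hy0 this
  have h3 := h2 1 (by simp)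
  rw [← h01] at h3
  have h4 : Complex.exp (-(2 * π * l * (1:ℝ) * Complex.I)) = 1 := by
    have : (Complex.exp (-(2 * π * l * (1:ℝ) * Complex.I)) - 1) • y 0 = 0 := by
      rw [sub_smul, h3, one_smul, sub_self]
    rcases smul_eq_zero.1 this with h | h
    · exact sub_eq_zero.1 h
    · exact absurd h h0
  rw [Complex.exp_eq_one_iff] at h4
  obtain ⟨k, hk⟩ := h4
  have h5 : (l : ℂ) = ((-k : ℤ) : ℂ) := by
    have hne : (2 * π * Complex.I : ℂ) ≠ 0 := Complex.two_pi_I_ne_zero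
    apply mul_right_cancel₀ hne
    push_cast at hk ⊢
    linear_combination -hk
  have h6 : l = ((-k : ℤ) : ℝ) := by exact_mod_cast h5
  have h7 := hb (π * ‖y 0‖ ^ 2)
  rw [← hl, h6] at h7
  have h8 : 0 ≤ -k := by exact_mod_cast h7.1
  have h9 : -k < 1 := by exact_mod_cast h7.2
  rw [h6, show -k = 0 by omega]; simp

lemma pull_back {R : ℝ} {ψ φ : V n → V n}
    (hψ : IsSymplecticEmbedding n (Bl n R) Set.univ ψ)
    (hφ : ∀ y ∈ Bl n R, φ (ψ y) = y ∧ ContDiffAt ℝ (⊤ : ℕ∞) φ (ψ y) ∧ ψ '' Bl n R ∈ nhds (ψ y))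
    {H : V n → ℝ} {X : V n → V n} (hX : ∀ z, HasFDerivAt H (innerSL ℝ (X z)) z)
    {h b : ℝ → ℝ} (hh : ∀ s, HasDerivAt h (b s) s)
    (hH : ∀ y ∈ Bl n R, H (ψ y) = h (π * ‖y‖ ^ 2))
    {w : ℝ → V n} {t : ℝ} (hw : HasDerivAt w (Complex.I • X (w t)) t) (hwt : w t ∈ ψ '' Bl n R) :
    HasDerivAt (fun t => φ (w t)) ((2 * π * b (π * ‖φ (w t)‖ ^ 2)) • Complex.I • φ (w t)) t ∧
      ((2 * π * b (π * ‖φ (w t)‖ ^ 2)) • Complex.I • φ (w t) = 0 → X (w t) = 0) := by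
  obtain ⟨y, hy, hyw⟩ := hwt
  obtain ⟨h1, h2, h3⟩ := hφ y hy
  have hφw : φ (w t) = y := by rw [← hyw, h1]
  have hDφ : HasFDerivAt φ (fderiv ℝ φ (ψ y)) (ψ y) :=
    (h2.differentiableAt (by simp)).hasFDerivAt
  have hDψ : HasFDerivAt ψ (fderiv ℝ ψ y) y :=
    ((hψ.1.contDiffAt ((isOpen_Bl R).mem_nhds hy)).differentiableAt (by simp)).hasFDerivAt
  have hid : ∀ v, fderiv ℝ ψ y (fderiv ℝ φ (ψ y) v) = v := by
    have ha : HasFDerivAt (ψ ∘ φ) ((fderiv ℝ ψ y).comp (fderiv ℝ φ (ψ y))) (ψ y) :=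
      HasFDerivAt.comp (ψ y) (by rwa [h1]) hDφ
    have hb : HasFDerivAt (ψ ∘ φ) (ContinuousLinearMap.id ℝ (V n)) (ψ y) := by
      refine (hasFDerivAt_id (ψ y)).congr_of_eventuallyEq ?_
      filter_upwards [h3] with z hz
      obtain ⟨x, hx, rfl⟩ := hz
      simp [(hφ x hx).1]
    intro v
    have := ha.unique hb
    exact DFunLike.congr_fun this v
  rw [← hyw] at hw ⊢
  rw [h1]
  set Z : V n := X (ψ y) with hZ
  set d : V n := fderiv ℝ φ (ψ y) (Complex.I • Z) with hd
  have hder : HasDerivAt (fun t => φ (w t)) d t := by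
    have : HasFDerivAt φ (fderiv ℝ φ (ψ y)) (w t) := by rwa [← hyw]
    exact this.comp_hasDerivAt t hw
  have hgrad : ∀ v, inner ℝ Z (fderiv ℝ ψ y v) = 2 * π * b (π * ‖y‖ ^ 2) * inner ℝ y v := by
    intro v
    have ha : HasFDerivAt (fun x => H (ψ x)) ((innerSL ℝ Z).comp (fderiv ℝ ψ y)) y :=
      (hX (ψ y)).comp y hDψ
    have hb : HasFDerivAt (fun x => H (ψ x))
        ((b (π * ‖y‖ ^ 2)) • (π • (2 • (innerSL ℝ y : V n →L[ℝ] ℝ)))) y := by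
      have hn : HasFDerivAt (fun x : V n => ‖x‖ ^ 2) (2 • (innerSL ℝ y : V n →L[ℝ] ℝ)) y :=
        (hasStrictFDerivAt_norm_sq y).hasFDerivAt
      have := (hh (π * ‖y‖ ^ 2)).comp_hasFDerivAt y (hn.const_mul π)
      refine this.congr_of_eventuallyEq ?_
      filter_upwards [(isOpen_Bl R).mem_nhds hy] with x hx
      exact hH x hx
    have hu := DFunLike.congr_fun (ha.unique hb) v
    simp [innerSL_apply_apply] at hu
    rw [hu]; ring
  have heq : d = (2 * π * b (π * ‖y‖ ^ 2)) • Complex.I • y := by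
    rw [← sub_eq_zero]
    apply omega_nondeg
    intro v
    have h4 : omegaStd n d v = - inner ℝ Z (fderiv ℝ ψ y v) := by
      rw [← hψ.2.2.2 y hy d v, hd, hid, omega_I_left]
    have h5 : omegaStd n (d - (2 * π * b (π * ‖y‖ ^ 2)) • Complex.I • y) v
        = omegaStd n d v - (2 * π * b (π * ‖y‖ ^ 2)) * omegaStd n (Complex.I • y) v := by
      simp only [omega_inner, smul_sub, inner_sub_left]
      rw [smul_comm, real_inner_smul_left]
    rw [h5, h4, hgrad, omega_I_left]; ring
  refine ⟨heq ▸ hder, fun h0 => ?_⟩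
  rw [← heq] at h0
  have h6 := hid (Complex.I • Z)
  rw [← hd, h0, map_zero] at h6
  rcases smul_eq_zero.1 h6.symm with h | h
  · exact absurd h Complex.I_ne_zero
  · exact h

end NSq


namespace NSq

variable {n : ℕ}

/-- Gradient at a minimum vanishes. -/
lemma grad_min {H : V n → ℝ} {z Z : V n} (h : HasFDerivAt H (innerSL ℝ Z) z)
    (hm : ∀ x, H z ≤ H x) : Z = 0 := by
  have h1 : IsLocalMin H z := Filter.Eventually.of_forall hm
  have h2 := h1.hasFDerivAt_eq_zero h
  have h3 := DFunLike.congr_fun h2 Z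
  rw [innerSL_apply_apply] at h3
  exact inner_self_eq_zero.1 h3

lemma inner_dg (c : Fin n → ℝ) (z : V n) : inner ℝ (dg (fun j => 2 * π * c j) z) z = 2 * Qf c z := by
  unfold Qf
  rw [PiLp.inner_apply, Finset.mul_sum, Finset.mul_sum]
  refine Finset.sum_congr rfl fun j _ => ?_
  rw [dg_apply, ← Complex.real_smul, real_inner_smul_left, real_inner_self_eq_norm_sq]
  ring

lemma dg_lip {c : Fin n → ℝ} (hc0 : ∀ j, 0 < c j) (hc : ∀ j, c j < 2) (a b : V n) :
    ‖dg (fun j => 2 * π * c j) a - dg (fun j => 2 * π * c j) b‖ ≤ 4 * π * ‖a - b‖ := by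
  have h1 : dg (fun j => 2 * π * c j) a - dg (fun j => 2 * π * c j) b
      = dg (fun j => 2 * π * c j) (a - b) := by
    ext j
    rw [PiLp.sub_apply, dg_apply, dg_apply, dg_apply, PiLp.sub_apply]; ring
  rw [h1]
  have hp := pi_pos
  refine (abs_le_of_sq_le_sq' (b := 4 * π * ‖a - b‖) ?_ (by positivity)).2
  rw [norm_dg_sq, mul_pow, EuclideanSpace.norm_sq_eq (a - b), Finset.mul_sum]
  refine Finset.sum_le_sum fun j _ => mul_le_mul_of_nonneg_right ?_ (by positivity)
  have := hc0 j
  have := hc j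
  apply pow_le_pow_left₀ (by positivity)
  nlinarith

theorem nonsqueezing {i₀ : Fin n} {R M Rb : ℝ} {ψ : V n → V n} (hR : 0 < R) (hM0 : 0 ≤ M) (hM : M < R)
    (hψ : IsSymplecticEmbedding n (Bl n R) Set.univ ψ)
    (hcyl : ∀ z ∈ Bl n R, π * ‖ψ z i₀‖ ^ 2 ≤ M) (hbd : ∀ z ∈ Bl n R, ‖ψ z‖ ≤ Rb) : False := by
  have hp := pi_pos
  obtain ⟨φ, hφ⟩ := inverse_smooth (isOpen_Bl R) hψ
  set δ : ℝ := min (1/2) ((R - M) / (4 * (π * Rb ^ 2 + 1))) with hδ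
  have hδ0 : 0 < δ := lt_min (by norm_num) (by have : 0 < R - M := by linarith
                                               positivity)
  have hδ1 : δ ≤ 1/2 := min_le_left _ _
  have hδ2 : δ * (π * Rb ^ 2) ≤ (R - M) / 4 := by
    have h1 : δ ≤ (R - M) / (4 * (π * Rb ^ 2 + 1)) := min_le_right _ _
    rw [le_div_iff₀ (by positivity)] at h1
    nlinarith
  let c : Fin n → ℝ := fun j => δ + if j = i₀ then 1 else 0
  have hci : c i₀ = δ + 1 := by simp [c]
  have hcj : ∀ j, j ≠ i₀ → c j = δ := fun j hj => by simp [c, hj]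
  have hcl : ∀ j, δ ≤ c j := fun j => by
    by_cases h : j = i₀
    · rw [h, hci]; linarith
    · rw [hcj j h]
  have hcu : ∀ j, c j < 2 := fun j => by
    by_cases h : j = i₀
    · rw [h, hci]; linarith
    · rw [hcj j h]; linarith
  have hcpos : ∀ j, 0 < c j := fun j => hδ0.trans_le (hcl j)
  have hQeq : ∀ z : V n, Qf c z = δ * (π * ‖z‖ ^ 2) + π * ‖z i₀‖ ^ 2 := by
    intro z
    unfold Qf
    rw [EuclideanSpace.norm_sq_eq]
    simp only [c, add_mul, Finset.sum_add_distrib, ite_mul, one_mul, zero_mul, Finset.sum_ite_eq',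
      Finset.mem_univ, if_true]
    rw [← Finset.mul_sum]; ring
  have hQ0 : ∀ z, 0 ≤ Qf c z := fun z => by rw [hQeq]; positivity
  set a₀ : ℝ := M + (R - M) / 4 with ha₀
  set m : ℝ := (M + R) / 2 with hm
  have ham : a₀ < m := by rw [ha₀, hm]; linarith
  have hm0 : 0 < m := by rw [hm]; linarith
  have hmR : m < R := by rw [hm]; linarith
  have hQimg : ∀ y ∈ Bl n R, Qf c (ψ y) ≤ a₀ := by
    intro y hy
    rw [hQeq, ha₀]
    have h1 := hcyl y hy
    have h2 : δ * (π * ‖ψ y‖ ^ 2) ≤ δ * (π * Rb ^ 2) := by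
      have := hbd y hy
      gcongr
    linarith
  obtain ⟨f, σ, κ, hfs, hfd, hfinf, hfm, hflow, hfσ⟩ := exists_f ham hm0.le
  obtain ⟨g, b, ε, hε0, hεR, hgs, hgd, hgb, hgl, hgR, hg0⟩ := exists_g hm0 hmR
  obtain ⟨G, hGs, hGψ, hGo⟩ := smooth_G hψ hφ hgs hε0 hgR
  have hG0 : ∀ z, 0 ≤ G z ∧ G z ≤ m := by
    intro z
    by_cases hz : z ∈ ψ '' Bl n R
    · obtain ⟨y, hy, rfl⟩ := hz
      rw [hGψ y hy]
      exact hg0 _ (by positivity)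
    · rw [hGo z hz]; exact ⟨le_rfl, hm0.le⟩
  let H : V n → ℝ := fun z => f (Qf c z) - G z
  have hHdef : ∀ z, H z = f (Qf c z) - G z := fun z => rfl
  let E : V n → ℝ := fun z => f (Qf c z) - Qf c z - κ - G z
  have hEs : ContDiff ℝ (⊤ : ℕ∞) E :=
    (((hfs.comp (Qf_contDiff c)).sub (Qf_contDiff c)).sub contDiff_const).sub hGs
  have hEcs : HasCompactSupport E := by
    refine HasCompactSupport.intro (isCompact_closedBall (0 : V n) (max Rb √(m / (π * δ)))) ?_
    intro z hz
    rw [mem_closedBall_zero_iff, not_le, max_lt_iff] at hz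
    have h1 : z ∉ ψ '' Bl n R := by
      rintro ⟨y, hy, rfl⟩
      exact absurd (hbd y hy) (not_le.2 hz.1)
    have h2 : m ≤ Qf c z := by
      have h3 := (Real.sqrt_lt' (lt_of_le_of_lt (Real.sqrt_nonneg _) hz.2)).1 hz.2
      rw [div_lt_iff₀ (by positivity)] at h3
      have h4 := (Qf_bounds (c := c) (l := δ) (h := 2) hcl (fun j => (hcu j).le) z).1
      linarith
    simp only [E]
    rw [hfinf _ h2, hGo z h1]; ring
  obtain ⟨Y, L, K, hL0, hYd, hYL, hYT, hYK⟩ := grad_package hEs hEcs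
  let X : V n → V n := fun z => dg (fun j => 2 * π * c j) z + Y z
  have hHE : ∀ z, H z = Qf c z + κ + E z := fun z => by simp only [H, E]; ring
  have hXgrad : ∀ z, HasFDerivAt H (innerSL ℝ (X z)) z := by
    intro z
    have hE' : HasFDerivAt E (innerSL ℝ (Y z)) z := by
      have h1 := (hEs.differentiable (by simp) z).hasFDerivAt
      have h2 : fderiv ℝ E z = innerSL ℝ (Y z) := by
        ext v; rw [hYd, innerSL_apply_apply]
      rwa [h2] at h1
    have h3 := ((Qf_hasFDerivAt c z).add_const κ).add hE'
    have h5 : innerSL ℝ (X z) = innerSL ℝ (dg (fun j => 2 * π * c j) z) + innerSL ℝ (Y z) := by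
      simp only [X, map_add]
    rw [h5]
    exact h3.congr_of_eventuallyEq (Filter.Eventually.of_forall hHE)
  have hH0 : ∀ z, 0 ≤ H z := fun z => by
    have := hfm _ (hQ0 z)
    have := (hG0 z).2
    rw [hHdef]; linarith
  have hHimg : ∀ y ∈ Bl n R, H (ψ y) = m - g (π * ‖y‖ ^ 2) := by
    intro y hy
    rw [hHdef, hGψ y hy, (hflow _ (hQ0 _) (hQimg y hy)).1]
  have h0B : (0 : V n) ∈ Bl n R := by
    change π * ‖(0 : V n)‖ ^ 2 < R
    simpa using hR
  obtain ⟨hφ0, hφzs, hφzn⟩ := hφ 0 h0B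
  have hflat : ∃ ρ > 0, ∀ a, ‖a‖ ≤ ρ → H (ψ 0 + a) = 0 := by
    have h1 : {z | π * ‖φ z‖ ^ 2 < ε} ∈ nhds (ψ 0) := by
      have h2 : ContinuousAt (fun z => π * ‖φ z‖ ^ 2) (ψ 0) :=
        continuousAt_const.mul (hφzs.continuousAt.norm.pow 2)
      apply h2.eventually_lt continuousAt_const
      rw [hφ0]; simpa using hε0
    obtain ⟨ρ, hρ, hsub⟩ := Metric.nhds_basis_closedBall.mem_iff.1 (Filter.inter_mem h1 hφzn)
    refine ⟨ρ, hρ, fun a ha => ?_⟩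
    obtain ⟨h3, y, hy, hyz⟩ := hsub (show ψ 0 + a ∈ Metric.closedBall (ψ 0) ρ by simpa using ha)
    rw [← hyz] at h3 ⊢
    have h4 : π * ‖φ (ψ y)‖ ^ 2 < ε := h3
    rw [(hφ y hy).1] at h4
    rw [hHimg y hy, (hgl _ h4.le).1, sub_self]
  obtain ⟨ρ, hρ0, hρ⟩ := hflat
  have ham : Ham n i₀ H X c (m + |κ|) (L + 4 * π) K ρ (ψ 0) := by
    refine ⟨?_, by positivity, ?_, ?_, hH0, ?_, ?_, ?_, hcu i₀, hcpos, ?_, hρ0, ?_⟩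
    · exact continuous_iff_continuousAt.2 fun z => (hXgrad z).continuousAt
    · intro a b
      have h1 : X a - X b = (dg (fun j => 2 * π * c j) a - dg (fun j => 2 * π * c j) b) + (Y a - Y b) := by
        simp only [X]; abel
      rw [h1]
      refine (norm_add_le _ _).trans ?_
      linarith [dg_lip hcpos hcu a b, hYL a b]
    · intro a b
      have h1 : H (a + b) - H a - inner ℝ (X a) b
          = Qf c b + (E (a + b) - E a - inner ℝ (Y a) b) := by
        rw [hHE, hHE, Qf_add]; simp only [X, inner_add_left]; ring
      rw [h1]
      refine (abs_add_le _ _).trans ?_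
      have h2 := (Qf_bounds (c := c) (l := δ) (h := 2) hcl (fun j => (hcu j).le) b).2
      rw [abs_of_nonneg (hQ0 b)]
      have h3 := hYT a b
      nlinarith [sq_nonneg ‖b‖]
    · intro z
      have h1 : Qf c z - (m + |κ|) ≤ H z := by
        by_cases hq : m ≤ Qf c z
        · rw [hHdef, hfinf _ hq]
          linarith [(hG0 z).2, neg_abs_le κ]
        · linarith [hH0 z, abs_nonneg κ, not_le.1 hq]
      exact h1
    · intro z
      have h1 : X z - dg (fun j => 2 * π * c j) z = Y z := by simp only [X]; abel
      rw [h1]; exact hYK z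
    · rw [hci]; linarith
    · intro j hj
      rw [hcj j hj]; linarith
    · intro a ha
      refine ⟨hρ a ha, grad_min (hXgrad _) fun x => ?_⟩
      rw [hρ a ha]; exact hH0 x
  obtain ⟨u, hu, hu01, hode, hact⟩ := ham.orbit
  obtain ⟨w, hw01, hwd, hpos⟩ := orbit_ode ham.Xc hu hu01 hode hact
  refine absurd hpos (not_lt.2 ?_)
  have hcons : ∀ t ∈ Set.Icc (0:ℝ) 1, H (w t) = H (w 0) := by
    apply const_of_deriv_zero (f := fun t => H (w t))
    intro t ht
    refine ((hXgrad (w t)).comp_hasDerivAt t (hwd t ht)).congr_deriv ?_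
    rw [innerSL_apply_apply, inner_I_self]
  have hle : ∀ t ∈ Set.Icc (0:ℝ) 1, 1/2 * inner ℝ (X (w t)) (w t) - H (w t) ≤ 0 := by
    by_cases hcase : m ≤ H (w 0)
    · intro t ht
      have h1 : m ≤ H (w t) := by rw [hcons t ht]; exact hcase
      have hGz : G (w t) = 0 := by
        by_cases hz : w t ∈ ψ '' Bl n R
        · obtain ⟨y, hy, hyw⟩ := hz
          rw [← hyw] at h1 ⊢
          rw [hHimg y hy] at h1
          rw [hGψ y hy]
          linarith [(hg0 (π * ‖y‖ ^ 2) (by positivity)).1]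
        · exact hGo _ hz
      have hGd : HasFDerivAt G (0 : V n →L[ℝ] ℝ) (w t) := by
        have h2 := (hGs.differentiable (by simp) (w t)).hasFDerivAt
        have h3 : IsLocalMin G (w t) := Filter.Eventually.of_forall fun x => by
          rw [hGz]; exact (hG0 x).1
        rwa [h3.hasFDerivAt_eq_zero h2] at h2
      have hHd : HasFDerivAt H (σ (Qf c (w t)) • innerSL ℝ (dg (fun j => 2 * π * c j) (w t)) - 0) (w t) :=
        ((hfd _).comp_hasFDerivAt (w t) (Qf_hasFDerivAt c (w t))).sub hGd
      have h4 := DFunLike.congr_fun ((hXgrad (w t)).unique hHd) (w t)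
      simp only [innerSL_apply_apply, sub_zero, smul_apply, inner_dg, smul_eq_mul] at h4
      rw [h4, hHdef, hGz]
      have := hfσ _ (hQ0 (w t))
      linarith
    · have hin : ∀ t ∈ Set.Icc (0:ℝ) 1, w t ∈ ψ '' Bl n R := by
        intro t ht
        by_contra hz
        have h1 := hcons t ht
        rw [hHdef, hGo _ hz] at h1
        linarith [hfm _ (hQ0 (w t)), not_le.1 hcase]
      have hh : ∀ s, HasDerivAt (fun s => m - g s) (b s) s := fun s =>
        ((hgd s).const_sub m).congr_deriv (by ring)
      have hpb := fun t ht => pull_back hψ hφ hXgrad hh hHimg (hwd t ht) (hin t ht)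
      have hz := ball_orbit (b := b) hgb (y := fun t => φ (w t)) (by simp only [hw01])
        (fun t ht => (hpb t ht).1)
      intro t ht
      rw [(hpb t ht).2 (hz t ht), inner_zero_left]
      linarith [hH0 (w t)]
  rw [← neg_nonneg, ← intervalIntegral.integral_neg]
  apply intervalIntegral.integral_nonneg zero_le_one
  intro t ht
  linarith [hle t ht]

end NSq


namespace NSq

lemma exists_chi {K : Set (ℝ × ℝ)} (hK : IsCompact K) {A : ℝ} (hA : volume K < ENNReal.ofReal A) :
    ∃ (χ : ℝ × ℝ → ℝ) (L : ℝ), 0 < L ∧ ContDiff ℝ (⊤ : ℕ∞) χ ∧ (∀ p, 0 ≤ χ p) ∧ (∀ p ∈ K, χ p = 1) ∧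
      (∀ p ∈ K, p.1 ∈ Set.Ioo (-L) L ∧ p.2 ∈ Set.Ioo (-L) L) ∧
      (∀ x y, y ∉ Set.Ioo (-L) L → χ (x, y) = 0) ∧
      ∫ x in (-L)..L, ∫ y in (-L)..L, χ (x, y) < A := by
  obtain ⟨O, hKO, hO, hOA⟩ := K.exists_isOpen_lt_of_lt _ hA
  obtain ⟨L, hL⟩ : ∃ L, ∀ p ∈ K, ‖p‖ ≤ L := hK.isBounded.exists_norm_le
  set L' : ℝ := |L| + 1 with hL'
  have hL0 : 0 < L' := by positivity
  have hbox : ∀ p ∈ K, p.1 ∈ Set.Ioo (-L') L' ∧ p.2 ∈ Set.Ioo (-L') L' := by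
    intro p hp
    have h1 := hL p hp
    have h2 : ‖p.1‖ ≤ ‖p‖ := norm_fst_le p
    have h3 : ‖p.2‖ ≤ ‖p‖ := norm_snd_le p
    rw [Real.norm_eq_abs] at h2 h3
    have h4 := le_abs_self L
    exact ⟨abs_lt.1 (by linarith), abs_lt.1 (by linarith)⟩
  let U : Set (ℝ × ℝ) := O ∩ (Set.univ ×ˢ Set.Ioo (-L') L')
  have hU : IsOpen U := hO.inter (isOpen_univ.prod isOpen_Ioo)
  have hKU : K ⊆ U := fun p hp => ⟨hKO hp, trivial, (hbox p hp).2⟩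
  obtain ⟨f, hf0, hf1, hf⟩ := exists_contMDiffMap_zero_one_of_isClosed (n := (⊤ : ℕ∞))
    (modelWithCornersSelf ℝ (ℝ × ℝ)) hU.isClosed_compl hK.isClosed
    (Set.disjoint_compl_left_iff_subset.2 hKU)
  have hfc : ContDiff ℝ (⊤ : ℕ∞) f := f.contMDiff.contDiff
  refine ⟨f, L', hL0, hfc, fun p => (hf p).1, fun p hp => hf1 hp, hbox, ?_, ?_⟩
  · intro x y hy
    exact hf0 (show (x, y) ∈ Uᶜ from fun h => hy h.2.2)
  · have hle : -L' ≤ L' := by linarith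
    rw [intervalIntegral.integral_of_le hle]
    simp only [intervalIntegral.integral_of_le hle]
    have hOfin : volume O ≠ ⊤ := (hOA.trans ENNReal.ofReal_lt_top).ne
    have hintg : IntegrableOn (fun p => f p) (Set.Ioc (-L') L' ×ˢ Set.Ioc (-L') L')
        ((volume : Measure ℝ).prod volume) := by
      refine IntegrableOn.mono_set ?_ (Set.prod_mono Set.Ioc_subset_Icc_self Set.Ioc_subset_Icc_self)
      exact hfc.continuous.continuousOn.integrableOn_compact (isCompact_Icc.prod isCompact_Icc)
    rw [← setIntegral_prod _ hintg, ← Measure.volume_eq_prod]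
    have hind : Integrable (O.indicator fun _ => (1:ℝ)) volume :=
      (integrable_indicator_iff hO.measurableSet).2 (integrableOn_const hOfin)
    calc ∫ p in Set.Ioc (-L') L' ×ˢ Set.Ioc (-L') L', f p
        ≤ ∫ p in Set.Ioc (-L') L' ×ˢ Set.Ioc (-L') L', O.indicator (fun _ => (1:ℝ)) p := by
          refine setIntegral_mono hintg hind.integrableOn fun p => ?_
          by_cases hp : p ∈ O
          · rw [Set.indicator_of_mem hp]; exact (hf p).2
          · rw [Set.indicator_of_notMem hp]
            exact (hf0 (show p ∈ Uᶜ from fun h => hp h.1)).le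
      _ ≤ ∫ p, O.indicator (fun _ => (1:ℝ)) p := by
          refine setIntegral_le_integral hind (Filter.Eventually.of_forall fun p => ?_)
          exact Set.indicator_nonneg (fun _ _ => zero_le_one) p
      _ = (volume O).toReal := by
          rw [integral_indicator hO.measurableSet]; simp [Measure.real]
      _ < A := by
          exact ENNReal.toReal_lt_of_lt_ofReal hOA

lemma vint_contDiff {χ : ℝ × ℝ → ℝ} {L : ℝ} (hχ : ContDiff ℝ (⊤ : ℕ∞) χ)
    (h0 : ∀ x y, y ∉ Set.Ioo (-L) L → χ (x, y) = 0) :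
    ContDiff ℝ (⊤ : ℕ∞) (fun p : ℝ × ℝ => ∫ s in (-L)..p.2, χ (p.1, s)) := by
  let f : ℝ → ℝ := (Set.Ici (0:ℝ)).indicator fun _ => 1
  have hf : LocallyIntegrable f volume :=
    (locallyIntegrable_const (1:ℝ)).indicator measurableSet_Ici
  have h1 := contDiffOn_convolution_right_with_param (μ := (volume : Measure ℝ)) (𝕜 := ℝ) (n := ⊤)
    (ContinuousLinearMap.mul ℝ ℝ)
    (f := f) (g := fun x y : ℝ => χ (x, y)) (s := Set.univ) (k := Set.Icc (-L) L) isOpen_univ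
    isCompact_Icc (fun p x _ hx => h0 p x fun h => hx (Set.Ioo_subset_Icc_self h)) hf
    (by exact hχ.contDiffOn)
  rw [Set.univ_prod_univ, contDiffOn_univ] at h1
  have h2 : (fun p : ℝ × ℝ => ∫ s in (-L)..p.2, χ (p.1, s)) = fun q : ℝ × ℝ =>
      (MeasureTheory.convolution f (fun y => χ (q.1, y)) (ContinuousLinearMap.mul ℝ ℝ) volume) q.2 := by
    ext ⟨x, y⟩
    simp only
    have hcs : Integrable (fun s => χ (x, s)) volume := by
      apply Continuous.integrable_of_hasCompactSupport
      · exact hχ.continuous.comp (by fun_prop)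
      · exact HasCompactSupport.intro (isCompact_Icc (a := -L) (b := L))
          fun s hs => h0 x s fun h => hs (Set.Ioo_subset_Icc_self h)
    rw [convolution_eq_swap, ← intervalIntegral.integral_Iic_sub_Iic hcs.integrableOn hcs.integrableOn,
      ← integral_indicator measurableSet_Iic]
    have hz : ∫ s in Set.Iic (-L), χ (x, s) = 0 := by
      refine setIntegral_eq_zero_of_forall_eq_zero fun s hs => h0 x s fun h => ?_
      exact absurd h.1 (not_lt.2 hs)
    rw [hz, sub_zero]
    congr 1
    ext s
    simp only [f, ContinuousLinearMap.mul_apply', Set.indicator_apply, Set.mem_Iic, Set.mem_Ici, sub_nonneg]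
    split_ifs <;> simp
  rw [h2]
  exact h1

end NSq


namespace NSq

/-- Polar coordinates: the algebra of the Jacobian. -/
lemma polar_jac {ρ : ℝ → ℝ} {θ : ℝ × ℝ → ℝ} {p : ℝ × ℝ} {ρ' J : ℝ} (hρ : HasDerivAt ρ ρ' p.1)
    (hθ : DifferentiableAt ℝ θ p) (hθy : HasDerivAt (fun s => θ (p.1, s)) J p.2)
    (v w : ℝ × ℝ) {τ : ℝ × ℝ → ℂ}
    (hτ : τ = fun p => (ρ p.1 : ℂ) * Complex.exp ((θ p : ℂ) * Complex.I))
    (hd : DifferentiableAt ℝ τ p) :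
    (fderiv ℝ τ p v).re * (fderiv ℝ τ p w).im - (fderiv ℝ τ p v).im * (fderiv ℝ τ p w).re
      = ρ p.1 * ρ' * J * (v.1 * w.2 - v.2 * w.1) := by
  set T := fderiv ℝ θ p with hT
  have hTy : T (0, 1) = J := by
    have h1 : HasDerivAt (fun s : ℝ => (p.1, s)) ((0:ℝ), (1:ℝ)) p.2 :=
      (hasDerivAt_const _ _).prodMk (hasDerivAt_id _)
    have h2 : HasFDerivAt θ T (p.1, p.2) := hθ.hasFDerivAt
    exact (h2.comp_hasDerivAt p.2 h1).unique hθy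
  have hTv : ∀ v : ℝ × ℝ, T v = v.1 * T (1, 0) + v.2 * J := by
    intro v
    have h1 : v = v.1 • ((1:ℝ), (0:ℝ)) + v.2 • ((0:ℝ), (1:ℝ)) := by ext <;> simp
    conv_lhs => rw [h1]
    rw [map_add, map_smul, map_smul, hTy, smul_eq_mul, smul_eq_mul]
  have key : ∀ v : ℝ × ℝ, fderiv ℝ τ p v = Complex.exp ((θ p : ℂ) * Complex.I) *
      ((ρ' * v.1 : ℝ) + (ρ p.1 * T v : ℝ) * Complex.I) := by
    intro v
    have hl : HasDerivAt (fun s : ℝ => p + s • v) v 0 := by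
      have := ((hasDerivAt_id (0:ℝ)).smul_const v).const_add p
      simpa using this
    have h1 : HasDerivAt (fun s : ℝ => τ (p + s • v)) (fderiv ℝ τ p v) 0 := by
      have : HasFDerivAt τ (fderiv ℝ τ p) (p + (0:ℝ) • v) := by
        rw [zero_smul, add_zero]; exact hd.hasFDerivAt
      exact this.comp_hasDerivAt 0 hl
    have h2 : HasDerivAt (fun s : ℝ => θ (p + s • v)) (T v) 0 := by
      have : HasFDerivAt θ T (p + (0:ℝ) • v) := by
        rw [zero_smul, add_zero]; exact hθ.hasFDerivAt
      exact this.comp_hasDerivAt 0 hl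
    have h3 : HasDerivAt (fun s : ℝ => ρ (p.1 + s * v.1)) (ρ' * v.1) 0 := by
      have hl1 : HasDerivAt (fun s : ℝ => p.1 + s * v.1) v.1 0 := by
        have := ((hasDerivAt_id (0:ℝ)).mul_const v.1).const_add p.1
        simpa using this
      have : HasDerivAt ρ ρ' (p.1 + 0 * v.1) := by simpa using hρ
      exact this.comp 0 hl1
    have h4 := h3.ofReal_comp.mul ((h2.ofReal_comp.mul_const Complex.I).cexp)
    have h5 := h1.unique (by rw [hτ]; exact h4)
    rw [h5]
    simp
    ring
  have hc := Real.cos_sq_add_sin_sq (θ p)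
  have hcos : (Complex.exp ((θ p : ℂ) * Complex.I)).re = Real.cos (θ p) := Complex.exp_ofReal_mul_I_re _
  have hsin : (Complex.exp ((θ p : ℂ) * Complex.I)).im = Real.sin (θ p) := Complex.exp_ofReal_mul_I_im _
  rw [key, key, hTv v, hTv w]
  simp only [Complex.mul_re, Complex.mul_im, Complex.add_re, Complex.add_im, hcos, hsin,
    Complex.ofReal_re, Complex.ofReal_im, Complex.I_re, Complex.I_im]
  linear_combination (ρ p.1 * ρ' * J * (v.1 * w.2 - v.2 * w.1)) * hc

lemma planar {K : Set (ℝ × ℝ)} (hK : IsCompact K) {A : ℝ} (hA : volume K < ENNReal.ofReal A) :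
    ∃ (τ : ℝ × ℝ → ℂ) (M : ℝ), 0 ≤ M ∧ M < A ∧ Set.InjOn τ K ∧ (∀ p ∈ K, π * ‖τ p‖ ^ 2 ≤ M) ∧
      (∀ p ∈ K, ContDiffAt ℝ (⊤ : ℕ∞) τ p) ∧ ∀ p ∈ K, ∀ v w,
      (fderiv ℝ τ p v).re * (fderiv ℝ τ p w).im - (fderiv ℝ τ p v).im * (fderiv ℝ τ p w).re
        = v.1 * w.2 - v.2 * w.1 := by
  have hp := pi_pos
  obtain ⟨χ, L, hL, hχs, hχ0, hχ1, hbox, hχz, hI⟩ := exists_chi hK hA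
  set I₀ : ℝ := ∫ x in (-L)..L, ∫ y in (-L)..L, χ (x, y) with hI₀
  have hI₀0 : 0 ≤ I₀ := intervalIntegral.integral_nonneg (by linarith) fun x _ =>
    intervalIntegral.integral_nonneg (by linarith) fun y _ => hχ0 _
  set ε : ℝ := min (1/2) ((A - I₀) / (8 * L ^ 2)) with hε
  have hε0 : 0 < ε := lt_min (by norm_num) (by have : 0 < A - I₀ := by linarith
                                               positivity)
  have hε1 : ε ≤ 1/2 := min_le_left _ _
  have hε2 : ε * (8 * L ^ 2) ≤ A - I₀ := by
    have h1 : ε ≤ (A - I₀) / (8 * L ^ 2) := min_le_right _ _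
    rwa [le_div_iff₀ (by positivity)] at h1
  let q : ℝ × ℝ → ℝ := fun p => ∫ s in (-L)..p.2, χ (p.1, s)
  have hqs : ContDiff ℝ (⊤ : ℕ∞) q := vint_contDiff hχs hχz
  let Q : ℝ × ℝ → ℝ := fun p => (1 - ε) * q p + ε * (p.2 + L)
  have hQs : ContDiff ℝ (⊤ : ℕ∞) Q :=
    (contDiff_const.mul hqs).add (contDiff_const.mul (contDiff_snd.add contDiff_const))
  have hQy : ∀ x y, HasDerivAt (fun s => Q (x, s)) ((1 - ε) * χ (x, y) + ε) y := by
    intro x y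
    have hc : Continuous fun s => χ (x, s) := hχs.continuous.comp (by fun_prop)
    have h1 : HasDerivAt (fun s => q (x, s)) (χ (x, y)) y :=
      intervalIntegral.integral_hasDerivAt_right (hc.intervalIntegrable _ _)
        (hc.stronglyMeasurableAtFilter _ _) hc.continuousAt
    have h2 := (h1.const_mul (1 - ε)).add (((hasDerivAt_id y).add_const L).const_mul ε)
    exact h2.congr_deriv (by ring)
  have hQmono : ∀ x, StrictMono fun s => Q (x, s) := by
    intro x
    apply strictMono_of_deriv_pos
    intro y
    rw [(hQy x y).deriv]
    have := hχ0 (x, y)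
    nlinarith
  have hQlow : ∀ x, Q (x, -L) = 0 := fun x => by simp [Q, q]
  let F : ℝ → ℝ := fun x => Q (x, L)
  have hFs : ContDiff ℝ (⊤ : ℕ∞) F := hQs.comp (contDiff_id.prodMk contDiff_const)
  have hF0 : ∀ x, 0 < F x := fun x => by
    rw [← hQlow x]; exact hQmono x (by linarith)
  let P : ℝ → ℝ := fun x => (∫ t in (0:ℝ)..x, F t) - ∫ t in (0:ℝ)..(-L), F t
  have hPs : ContDiff ℝ (⊤ : ℕ∞) P := (prim_contDiff hFs).sub contDiff_const
  have hPd : ∀ x, HasDerivAt P (F x) x := fun x => (prim_deriv hFs.continuous x).sub_const _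
  have hPmono : StrictMono P := strictMono_of_deriv_pos fun x => by
    rw [(hPd x).deriv]; exact hF0 x
  have hPlow : P (-L) = 0 := sub_self _
  have hPtop : P L < A := by
    have h1 : P L = ∫ t in (-L)..L, F t :=
      intervalIntegral.integral_interval_sub_left (hFs.continuous.intervalIntegrable _ _)
        (hFs.continuous.intervalIntegrable _ _)
    have hqc : Continuous fun x => q (x, L) := hqs.continuous.comp (by fun_prop)
    have h2 : ∫ t in (-L)..L, F t = (1 - ε) * I₀ + ε * (2 * L) * (2 * L) := by
      have : (fun t => F t) = fun t => (1 - ε) * q (t, L) + ε * (2 * L) := by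
        ext t; simp only [F, Q]; ring
      rw [this, intervalIntegral.integral_add ((hqc.const_mul _).intervalIntegrable _ _)
        (intervalIntegrable_const), intervalIntegral.integral_const_mul,
        intervalIntegral.integral_const]
      simp only [q, smul_eq_mul, hI₀]; ring
    rw [h1, h2]
    nlinarith [mul_pos hL hL]
  let ρ : ℝ → ℝ := fun x => √(P x / π)
  let θ : ℝ × ℝ → ℝ := fun p => 2 * π * (Q p / F p.1)
  have hPpos : ∀ p ∈ K, 0 < P p.1 := fun p hp' => by
    rw [← hPlow]; exact hPmono (hbox p hp').1.1
  have hθs : ContDiff ℝ (⊤ : ℕ∞) θ :=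
    contDiff_const.mul (hQs.div (hFs.comp contDiff_fst) fun p => (hF0 p.1).ne')
  have hρs : ∀ p ∈ K, ContDiffAt ℝ (⊤ : ℕ∞) ρ p.1 := fun p hp' => by
    have := hPpos p hp'
    exact (hPs.contDiffAt.div_const π).sqrt (by positivity)
  let τ : ℝ × ℝ → ℂ := fun p => (ρ p.1 : ℂ) * Complex.exp ((θ p : ℂ) * Complex.I)
  have hτs : ∀ p ∈ K, ContDiffAt ℝ (⊤ : ℕ∞) τ p := by
    intro p hp'
    have h1 : ContDiffAt ℝ (⊤ : ℕ∞) (fun p : ℝ × ℝ => (ρ p.1 : ℂ)) p :=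
      Complex.ofRealCLM.contDiff.contDiffAt.comp p ((hρs p hp').comp p contDiffAt_fst)
    have h2 : ContDiffAt ℝ (⊤ : ℕ∞) (fun p : ℝ × ℝ => Complex.exp ((θ p : ℂ) * Complex.I)) p := by
      have h3 : ContDiffAt ℝ (⊤ : ℕ∞) (fun p : ℝ × ℝ => (θ p : ℂ)) p :=
        Complex.ofRealCLM.contDiff.contDiffAt.comp p hθs.contDiffAt
      exact (h3.mul contDiffAt_const).cexp
    exact h1.mul h2
  have hnorm : ∀ p ∈ K, π * ‖τ p‖ ^ 2 = P p.1 := by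
    intro p hp'
    have := hPpos p hp'
    simp only [τ]
    rw [norm_mul, Complex.norm_exp_ofReal_mul_I, mul_one, Complex.norm_real, Real.norm_eq_abs, sq_abs,
      Real.sq_sqrt (by positivity)]
    field_simp
  refine ⟨τ, P L, ?_, hPtop, ?_, ?_, hτs, ?_⟩
  · rw [← hPlow]; exact (hPmono (by linarith)).le
  · intro a ha b hb hab
    have h1 : a.1 = b.1 := by
      apply hPmono.injective
      rw [← hnorm a ha, ← hnorm b hb, hab]
    have hρ0 : (ρ b.1 : ℂ) ≠ 0 := by
      have := hPpos b hb
      have : 0 < ρ b.1 := Real.sqrt_pos.2 (by positivity)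
      exact_mod_cast this.ne'
    have h2 : Complex.exp ((θ a : ℂ) * Complex.I) = Complex.exp ((θ b : ℂ) * Complex.I) := by
      have h3 : (ρ a.1 : ℂ) * Complex.exp ((θ a : ℂ) * Complex.I)
        = (ρ b.1 : ℂ) * Complex.exp ((θ b : ℂ) * Complex.I) := hab
      rw [h1] at h3
      exact mul_left_cancel₀ hρ0 h3
    have hrange : ∀ p ∈ K, 0 < Q p / F p.1 ∧ Q p / F p.1 < 1 := by
      intro p hp'
      have h4 : 0 < Q p := by
        have := hQmono p.1 (hbox p hp').2.1
        simp only [hQlow] at this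
        exact this
      have h5 : Q p < F p.1 := hQmono p.1 (hbox p hp').2.2
      exact ⟨div_pos h4 (hF0 _), (div_lt_one (hF0 _)).2 h5⟩
    rw [Complex.exp_eq_exp_iff_exists_int] at h2
    obtain ⟨k, hk⟩ := h2
    have h6 : Q a / F a.1 = Q b / F b.1 + k := by
      have hne : (2 * π * Complex.I : ℂ) ≠ 0 := Complex.two_pi_I_ne_zero
      have h7 : ((Q a / F a.1 : ℝ) : ℂ) = ((Q b / F b.1 + k : ℝ) : ℂ) := by
        apply mul_right_cancel₀ hne
        simp only [θ] at hk
        push_cast at hk ⊢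
        linear_combination hk
      exact_mod_cast h7
    have ha' := hrange a ha
    have hb' := hrange b hb
    have hk1 : ((-1 : ℤ) : ℝ) < k := by push_cast; linarith
    have hk2 : (k : ℝ) < ((1 : ℤ) : ℝ) := by push_cast; linarith
    have hk3 : -1 < k := by exact_mod_cast hk1
    have hk4 : k < 1 := by exact_mod_cast hk2
    have hk0 : k = 0 := by omega
    rw [hk0, h1] at h6
    have h8 : Q a = Q b := by
      have := (hF0 b.1).ne'
      field_simp at h6
      simpa using h6
    have h9 : Q (b.1, a.2) = Q (b.1, b.2) := 
      calc Q (b.1, a.2) = Q (a.1, a.2) := by rw [h1]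
        _ = Q (b.1, b.2) := h8
    exact Prod.ext h1 ((hQmono b.1).injective h9)
  · intro p hp'
    rw [hnorm p hp']
    exact (hPmono (hbox p hp').1.2).le
  · intro p hp' v w
    have hP := hPpos p hp'
    have hρd : HasDerivAt ρ (F p.1 / π / (2 * √(P p.1 / π))) p.1 :=
      ((hPd p.1).div_const π).sqrt (by positivity)
    have hθy : HasDerivAt (fun s => θ (p.1, s)) (2 * π * (((1 - ε) * χ (p.1, p.2) + ε) / F p.1)) p.2 :=
      ((hQy p.1 p.2).div_const (F p.1)).const_mul (2 * π)
    rw [polar_jac hρd (hθs.differentiable (by simp) p) hθy v w rfl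
      ((hτs p hp').differentiableAt (by simp))]
    have h1 : χ (p.1, p.2) = 1 := hχ1 p hp'
    have h2 : 0 < √(P p.1 / π) := Real.sqrt_pos.2 (by positivity)
    have h3 := (hF0 p.1).ne'
    have h4 : ρ p.1 * (F p.1 / π / (2 * √(P p.1 / π))) * (2 * π * (((1 - ε) * χ (p.1, p.2) + ε) / F p.1)) = 1 := by
      change √(P p.1 / π) * _ * _ = 1
      rw [h1]
      field_simp
      ring
    rw [h4, one_mul]

end NSq


namespace NSq

variable {n : ℕ}

lemma om_add_l (a b c : V n) : omegaStd n (a + b) c = omegaStd n a c + omegaStd n b c := by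
  simp only [omega_inner, smul_add, inner_add_left]

lemma om_add_r (a b c : V n) : omegaStd n a (b + c) = omegaStd n a b + omegaStd n a c := by
  simp only [omega_inner, inner_add_right]

lemma om_smul_l (s : ℝ) (a c : V n) : omegaStd n (s • a) c = s * omegaStd n a c := by
  simp only [omega_inner]
  rw [smul_comm, real_inner_smul_left]

lemma om_smul_r (s : ℝ) (a c : V n) : omegaStd n a (s • c) = s * omegaStd n a c := by
  simp only [omega_inner, real_inner_smul_right]

lemma om_self (a : V n) : omegaStd n a a = 0 := by
  unfold omegaStd
  exact Finset.sum_eq_zero fun k _ => by ring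

lemma om_anti (a b : V n) : omegaStd n a b = - omegaStd n b a := by
  unfold omegaStd
  rw [← Finset.sum_neg_distrib]
  exact Finset.sum_congr rfl fun k _ => by ring

/-- Linear symplectic maps. -/
def LSymp (A : V n →ₗ[ℝ] V n) : Prop := ∀ v w, omegaStd n (A v) (A w) = omegaStd n v w

lemma LSymp.comp {A B : V n →ₗ[ℝ] V n} (hA : LSymp A) (hB : LSymp B) : LSymp (A.comp B) :=
  fun v w => by rw [LinearMap.comp_apply, LinearMap.comp_apply, hA, hB]

lemma transvection {u v : V n} (h : omegaStd n u v ≠ 0) :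
    ∃ A : V n →ₗ[ℝ] V n, LSymp A ∧ A u = v ∧ ∀ x, omegaStd n x u = omegaStd n x v → A x = x := by
  set a : V n := v + (-1 : ℝ) • u with ha
  set c : ℝ := (omegaStd n u v)⁻¹ with hc
  let A : V n →ₗ[ℝ] V n :=
    { toFun := fun x => x + (c * omegaStd n x a) • a
      map_add' := fun x y => by rw [om_add_l, mul_add, add_smul]; abel
      map_smul' := fun s x => by
        have h1 : c * (s * omegaStd n x a) = s * (c * omegaStd n x a) := by ring
        rw [om_smul_l, RingHom.id_apply, smul_add s x, smul_smul s, h1] }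
  have hA : ∀ x, A x = x + (c * omegaStd n x a) • a := fun x => rfl
  refine ⟨A, ?_, ?_, ?_⟩
  · intro x y
    rw [hA, hA]
    simp only [om_add_l, om_add_r, om_smul_l, om_smul_r, om_self]
    rw [om_anti a y]
    ring
  · have h1 : c * omegaStd n u a = 1 := by
      rw [ha, om_add_r, om_smul_r, om_self, mul_zero, add_zero, hc, inv_mul_cancel₀ h]
    rw [hA, h1, one_smul, ha, neg_one_smul]; abel
  · intro x hx
    have h1 : omegaStd n x a = 0 := by
      rw [ha, om_add_r, om_smul_r, hx]; ring
    rw [hA, h1, mul_zero, zero_smul, add_zero]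

lemma om_I_right (u v : V n) : omegaStd n u (Complex.I • v) = inner ℝ u v := by
  rw [omega_inner, inner_I_I]

lemma lsymp_one {u v : V n} (hu : u ≠ 0) (hv : v ≠ 0) : ∃ A : V n →ₗ[ℝ] V n, LSymp A ∧ A u = v := by
  have hu' : 0 < ‖u‖ ^ 2 := by have := norm_pos_iff.2 hu; positivity
  have hv' : 0 < ‖v‖ ^ 2 := by have := norm_pos_iff.2 hv; positivity
  by_cases h : omegaStd n u v = 0
  · obtain ⟨z, h1, h2⟩ : ∃ z, omegaStd n u z ≠ 0 ∧ omegaStd n z v ≠ 0 := by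
      by_cases h3 : inner ℝ u v = 0
      · refine ⟨Complex.I • u + Complex.I • v, ?_, ?_⟩
        · rw [om_add_r, om_I_right, om_I_right, h3, real_inner_self_eq_norm_sq]
          simpa using hu
        · rw [om_add_l, omega_I_left, omega_I_left, h3, real_inner_self_eq_norm_sq]
          simpa using hv
      · refine ⟨Complex.I • u, ?_, ?_⟩
        · rw [om_I_right, real_inner_self_eq_norm_sq]
          simpa using hu
        · rw [omega_I_left]; simpa using h3
    obtain ⟨A, hA, hAu, -⟩ := transvection h1
    obtain ⟨B, hB, hBu, -⟩ := transvection h2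
    exact ⟨B.comp A, hB.comp hA, by rw [LinearMap.comp_apply, hAu, hBu]⟩
  · obtain ⟨A, hA, hAu, -⟩ := transvection h
    exact ⟨A, hA, hAu⟩

lemma lsymp_two {e f f' : V n} (h1 : omegaStd n e f = 1) (h2 : omegaStd n e f' = 1) :
    ∃ A : V n →ₗ[ℝ] V n, LSymp A ∧ A e = e ∧ A f = f' := by
  by_cases h : omegaStd n f f' = 0
  · obtain ⟨A, hA, hAu, hAf⟩ := transvection (u := f) (v := f + e) (by
      rw [om_add_r, om_self, om_anti, h1]; norm_num)
    obtain ⟨B, hB, hBu, hBf⟩ := transvection (u := f + e) (v := f') (by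
      rw [om_add_l, h, h2]; norm_num)
    refine ⟨B.comp A, hB.comp hA, ?_, ?_⟩
    · rw [LinearMap.comp_apply, hAf, hBf]
      · rw [om_add_r, om_self, h1, h2, add_zero]
      · rw [om_add_r, om_self, add_zero]
    · rw [LinearMap.comp_apply, hAu, hBu]
  · obtain ⟨A, hA, hAu, hAf⟩ := transvection h
    exact ⟨A, hA, hAf e (by rw [h1, h2]), hAu⟩

/-- Symplectic coordinates adapted to a symplectic pair. -/
lemma lsymp_coord (i₀ : Fin n) {u v : V n} (h : omegaStd n u v = 1) :
    ∃ A : V n →ₗ[ℝ] V n, LSymp A ∧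
      ∀ x, (A x i₀).re = omegaStd n x v ∧ (A x i₀).im = omegaStd n u x := by
  set e : V n := EuclideanSpace.single i₀ (1:ℂ) with he
  set f : V n := EuclideanSpace.single i₀ Complex.I with hf
  have hre : ∀ x : V n, omegaStd n x f = (x i₀).re := by
    intro x
    unfold omegaStd
    rw [Finset.sum_eq_single i₀]
    · simp [hf]
    · intro j _ hj; simp [hf, hj]
    · simp
  have him : ∀ x : V n, omegaStd n e x = (x i₀).im := by
    intro x
    unfold omegaStd
    rw [Finset.sum_eq_single i₀]
    · simp [he]
    · intro j _ hj; simp [he, hj]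
    · simp
  have hef : omegaStd n e f = 1 := by rw [hre, he]; simp
  have hu : u ≠ 0 := by
    rintro rfl
    simp [omega_inner] at h
  have hee : e ≠ 0 := by
    intro h0
    rw [h0] at hef
    simp [omega_inner] at hef
  obtain ⟨A, hA, hAu⟩ := lsymp_one hu hee
  have h1 : omegaStd n e (A v) = 1 := by rw [← hAu, hA, h]
  obtain ⟨B, hB, hBe, hBf⟩ := lsymp_two h1 hef
  refine ⟨B.comp A, hB.comp hA, fun x => ⟨?_, ?_⟩⟩
  · have : f = (B.comp A) v := by rw [LinearMap.comp_apply, hBf]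
    rw [← hre]
    conv_lhs => rw [this]
    exact hB.comp hA x v
  · have : e = (B.comp A) u := by rw [LinearMap.comp_apply, hAu, hBe]
    rw [← him]
    conv_lhs => rw [this]
    exact hB.comp hA u x

open scoped Pointwise in
lemma vol_scale (c : ℝ) (D : Set (ℝ × ℝ)) :
    volume ((fun p : ℝ × ℝ => c • p) '' D) = ENNReal.ofReal |c ^ 2| * volume D := by
  have h := Measure.addHaar_smul (volume : Measure (ℝ × ℝ)) c D
  rw [Module.finrank_prod, Module.finrank_self] at h
  exact h

/-- The `i₀`-th coordinate as a point of the real plane. -/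
noncomputable def ci (i₀ : Fin n) : V n →L[ℝ] ℝ × ℝ :=
  (Complex.equivRealProdCLM : ℂ →L[ℝ] ℝ × ℝ).comp
    ((EuclideanSpace.proj (𝕜 := ℂ) i₀).restrictScalars ℝ)

lemma ci_apply (i₀ : Fin n) (z : V n) : ci i₀ z = ((z i₀).re, (z i₀).im) := rfl

/-- Nonsqueezing for shadows in a coordinate plane. -/
theorem shadow_coord {i₀ : Fin n} {R : ℝ} {η : V n → V n} (hR : 0 < R)
    (hηs : ∀ z, π * ‖z‖ ^ 2 ≤ R → ContDiffAt ℝ (⊤ : ℕ∞) η z)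
    (hηi : Set.InjOn η {z | π * ‖z‖ ^ 2 ≤ R})
    (hηw : ∀ z, π * ‖z‖ ^ 2 ≤ R → ∀ v w,
      omegaStd n (fderiv ℝ η z v) (fderiv ℝ η z w) = omegaStd n v w)
    (hvol : volume ((fun z => ci i₀ (η z)) '' {z | π * ‖z‖ ^ 2 ≤ R}) < ENNReal.ofReal R) : False := by
  set C : Set (V n) := {z | π * ‖z‖ ^ 2 ≤ R} with hC
  have hCc : IsCompact C := by
    apply Metric.isCompact_of_isClosed_isBounded
    · exact isClosed_le (by fun_prop) continuous_const
    · rw [isBounded_iff_forall_norm_le]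
      refine ⟨√(R / π), fun z hz => Real.le_sqrt_of_sq_le ?_⟩
      rw [le_div_iff₀ pi_pos, mul_comm]
      exact hz
  have hcont : ContinuousOn (fun z => ci i₀ (η z)) C := fun z hz =>
    ((ci i₀).continuous.continuousAt.comp (hηs z hz).continuousAt).continuousWithinAt
  have hK := hCc.image_of_continuousOn hcont
  obtain ⟨τ, M, hM0, hMR, hinj, hbd, hsm, hjac⟩ := planar hK hvol
  let e : V n := EuclideanSpace.single i₀ (1:ℂ)
  let pr : V n →L[ℝ] ℂ := (EuclideanSpace.proj (𝕜 := ℂ) i₀).restrictScalars ℝ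
  have hpr : ∀ x, pr x = x i₀ := fun x => rfl
  let Θ : V n → V n := fun x => x + (τ (ci i₀ x) - pr x) • e
  have hΘi : ∀ x, Θ x i₀ = τ (ci i₀ x) := fun x => by simp [Θ, e, hpr]
  have hΘj : ∀ x j, j ≠ i₀ → Θ x j = x j := fun x j hj => by simp [Θ, e, hj]
  have hmem : ∀ z ∈ C, ci i₀ (η z) ∈ (fun z => ci i₀ (η z)) '' C := fun z hz => ⟨z, hz, rfl⟩
  have hΘs : ∀ z ∈ C, ContDiffAt ℝ (⊤ : ℕ∞) Θ (η z) := by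
    intro z hz
    have h1 : ContDiffAt ℝ (⊤ : ℕ∞) (fun x => τ (ci i₀ x)) (η z) :=
      (hsm _ (hmem z hz)).comp (η z) (ci i₀).contDiff.contDiffAt
    exact contDiffAt_id.add ((h1.sub pr.contDiff.contDiffAt).smul contDiffAt_const)
  have hΘd : ∀ z ∈ C, ∀ v, fderiv ℝ Θ (η z) v =
      v + (fderiv ℝ τ (ci i₀ (η z)) (ci i₀ v) - pr v) • e := by
    intro z hz v
    have h1 : HasFDerivAt τ (fderiv ℝ τ (ci i₀ (η z))) (ci i₀ (η z)) :=
      ((hsm _ (hmem z hz)).differentiableAt (by simp)).hasFDerivAt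
    have h2 : HasFDerivAt (fun x => τ (ci i₀ x)) _ (η z) := h1.comp (η z) (ci i₀).hasFDerivAt
    have h3 := (hasFDerivAt_id (𝕜 := ℝ) (η z)).add ((h2.sub pr.hasFDerivAt).smul_const e)
    have h4 : fderiv ℝ Θ (η z) = _ := h3.fderiv
    rw [h4]
    simp
  have hΨs : ∀ z ∈ C, ContDiffAt ℝ (⊤ : ℕ∞) (Θ ∘ η) z := fun z hz =>
    (hΘs z hz).comp z (hηs z hz)
  have hBC : Bl n R ⊆ C := fun z hz => le_of_lt (show π * ‖z‖ ^ 2 < R from hz)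
  obtain ⟨Rb, hRb⟩ : ∃ Rb, ∀ z ∈ C, ‖(Θ ∘ η) z‖ ≤ Rb :=
    hCc.exists_bound_of_continuousOn fun z hz => (hΨs z hz).continuousAt.continuousWithinAt
  refine nonsqueezing (i₀ := i₀) (ψ := Θ ∘ η) hR hM0 hMR ⟨?_, ?_, ?_, ?_⟩ ?_ (fun z hz => hRb z (hBC hz))
  · exact fun z hz => (hΨs z (hBC hz)).contDiffWithinAt
  · intro a ha b hb hab
    have hab' : Θ (η a) = Θ (η b) := hab
    apply hηi (hBC ha) (hBC hb)
    have h1 : ci i₀ (η a) = ci i₀ (η b) := by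
      apply hinj (hmem a (hBC ha)) (hmem b (hBC hb))
      rw [← hΘi, ← hΘi, hab']
    ext j
    by_cases hj : j = i₀
    · rw [hj]
      rw [ci_apply, ci_apply, Prod.mk.injEq] at h1
      exact Complex.ext h1.1 h1.2
    · rw [← hΘj (η a) j hj, ← hΘj (η b) j hj, hab']
  · exact fun _ _ => trivial
  · intro z hz v w
    have hz := hBC hz
    have hcomp : ∀ v, fderiv ℝ (Θ ∘ η) z v = fderiv ℝ Θ (η z) (fderiv ℝ η z v) := by
      intro v
      rw [fderiv_comp z ((hΘs z hz).differentiableAt (by simp)) ((hηs z hz).differentiableAt (by simp))]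
      rfl
    rw [hcomp, hcomp, ← hηw z hz v w]
    set a := fderiv ℝ η z v
    set b := fderiv ℝ η z w
    rw [hΘd z hz, hΘd z hz]
    unfold omegaStd
    refine Finset.sum_congr rfl fun k _ => ?_
    by_cases hk : k = i₀
    · have := hjac _ (hmem z hz) (ci i₀ a) (ci i₀ b)
      rw [hk]
      simp only [ci_apply] at this
      simpa [e, hpr, ci_apply] using this
    · simp [e, hk]
  · intro z hz
    change π * ‖Θ (η z) i₀‖ ^ 2 ≤ M
    rw [hΘi]
    exact hbd _ (hmem z (hBC hz))

end NSq

theorem shadow_of_ball (n : ℕ) (r : ℝ) (hr : 0 < r)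
    (S : Submodule ℝ (EuclideanSpace ℂ (Fin n)))
    (hdim : Module.finrank ℝ S = 2)
    (b₁ b₂ : EuclideanSpace ℂ (Fin n)) (hb₁ : b₁ ∈ S) (hb₂ : b₂ ∈ S)
    (hspan : Submodule.span ℝ {b₁, b₂} = S)
    (hpos : 0 < omegaStd n b₁ b₂)
    (πS : EuclideanSpace ℂ (Fin n) →ₗ[ℝ] EuclideanSpace ℂ (Fin n))
    (hπrange : ∀ v, πS v ∈ S)
    (hπker : ∀ v, ∀ s ∈ S, omegaStd n (v - πS v) s = 0)
    (ψ : EuclideanSpace ℂ (Fin n) → EuclideanSpace ℂ (Fin n))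
    (hψ : IsSymplecticEmbedding n
      {z : EuclideanSpace ℂ (Fin n) | π * ∑ k, ‖z k‖ ^ 2 < r} Set.univ ψ) :
    ENNReal.ofReal r ≤ ENNReal.ofReal (omegaStd n b₁ b₂) *
      volume {p : ℝ × ℝ | p.1 • b₁ + p.2 • b₂ ∈
        πS '' (ψ '' {z : EuclideanSpace ℂ (Fin n) | π * ∑ k, ‖z k‖ ^ 2 < r})} := by
  classical
  by_contra hcon
  rw [not_le] at hcon
  set w : ℝ := omegaStd n b₁ b₂ with hw
  simp only [← EuclideanSpace.norm_sq_eq] at hcon hψ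
  set D : Set (ℝ × ℝ) := {p : ℝ × ℝ | p.1 • b₁ + p.2 • b₂ ∈
        πS '' (ψ '' {z : EuclideanSpace ℂ (Fin n) | π * ‖z‖ ^ 2 < r})} with hD
  obtain ⟨r', hr'0, hr'1, hr'2⟩ : ∃ r' : ℝ, 0 < r' ∧ ENNReal.ofReal w * volume D < ENNReal.ofReal r' ∧
      r' < r := by
    obtain ⟨q, hq1, hq2⟩ := ENNReal.lt_iff_exists_nnreal_btwn.1 hcon
    refine ⟨q, ?_, ?_, ?_⟩
    · have h0 := lt_of_le_of_lt (zero_le) hq1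
      exact_mod_cast h0
    · rwa [ENNReal.ofReal_coe_nnreal]
    · rw [ENNReal.lt_ofReal_iff_toReal_lt ENNReal.coe_ne_top] at hq2
      simpa using hq2
  -- the coordinates of the projection
  have hproj : ∀ v, πS v = (omegaStd n v b₂ / w) • b₁ + (omegaStd n b₁ v / w) • b₂ := by
    intro v
    have h1 := hπrange v
    rw [← hspan, Submodule.mem_span_pair] at h1
    obtain ⟨s, t, hst⟩ := h1
    have h2 : ∀ x ∈ S, omegaStd n v x = omegaStd n (πS v) x := by
      intro x hx
      have h3 := hπker v x hx
      have h4 : v = (v - πS v) + πS v := by abel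
      conv_lhs => rw [h4]
      rw [NSq.om_add_l, h3, zero_add]
    have h5 := h2 b₂ hb₂
    have h6 := h2 b₁ hb₁
    rw [← hst, NSq.om_add_l, NSq.om_smul_l, NSq.om_smul_l, NSq.om_self] at h5 h6
    rw [NSq.om_anti v b₁, NSq.om_anti b₂ b₁, ← hw] at h6
    rw [← hw] at h5
    have hw0 : w ≠ 0 := hpos.ne'
    have h7 : omegaStd n v b₂ / w = s := by rw [h5]; field_simp; ring
    have h8 : omegaStd n b₁ v / w = t := by
      rw [show omegaStd n b₁ v = t * w by linarith]; field_simp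
    rw [h7, h8, hst]
  have hn : Nonempty (Fin n) := by
    by_contra hne
    rw [not_nonempty_iff] at hne
    have : w = 0 := by rw [hw]; unfold omegaStd; exact Finset.sum_of_isEmpty _
    exact hpos.ne' this
  obtain ⟨i₀⟩ := hn
  set c : ℝ := √w with hc
  have hc0 : 0 < c := Real.sqrt_pos.2 hpos
  have hcc : c * c = w := Real.mul_self_sqrt hpos.le
  obtain ⟨A, hA, hAc⟩ := NSq.lsymp_coord i₀ (u := c⁻¹ • b₁) (v := c⁻¹ • b₂) (by
    rw [NSq.om_smul_l, NSq.om_smul_r, ← hw, ← hcc]; field_simp)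
  let A' : NSq.V n →L[ℝ] NSq.V n := LinearMap.toContinuousLinearMap A
  have hA' : ∀ x, A' x = A x := fun x => rfl
  have hop : IsOpen {z : NSq.V n | π * ‖z‖ ^ 2 < r} := NSq.isOpen_Bl r
  have hsub : ∀ z : NSq.V n, π * ‖z‖ ^ 2 ≤ r' → z ∈ {z : NSq.V n | π * ‖z‖ ^ 2 < r} :=
    fun z hz => lt_of_le_of_lt hz hr'2
  have hψs : ∀ z : NSq.V n, π * ‖z‖ ^ 2 ≤ r' → ContDiffAt ℝ (⊤ : ℕ∞) ψ z := fun z hz =>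
    hψ.1.contDiffAt (hop.mem_nhds (hsub z hz))
  refine NSq.shadow_coord (i₀ := i₀) (R := r') (η := fun z => A' (ψ z)) hr'0 ?_ ?_ ?_ ?_
  · intro z hz
    exact A'.contDiff.contDiffAt.comp z (hψs z hz)
  · intro a ha b hb hab
    apply hψ.2.1 (hsub a ha) (hsub b hb)
    rw [← sub_eq_zero]
    apply NSq.omega_nondeg
    intro x
    have h1 : A (ψ a - ψ b) = 0 := by
      rw [map_sub, sub_eq_zero]; exact hab
    rw [← hA, h1]
    simp [NSq.omega_inner]
  · intro z hz v x
    have h1 : ∀ v, fderiv ℝ (fun z => A' (ψ z)) z v = A (fderiv ℝ ψ z v) := by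
      intro v
      have h2 : HasFDerivAt (fun z => A' (ψ z)) (A'.comp (fderiv ℝ ψ z)) z :=
        A'.hasFDerivAt.comp z ((hψs z hz).differentiableAt (by simp)).hasFDerivAt
      rw [h2.fderiv]
      rfl
    rw [h1, h1, hA, hψ.2.2.2 z (hsub z hz)]
  · refine lt_of_le_of_lt (measure_mono (t := (fun p : ℝ × ℝ => c • p) '' D) ?_) ?_
    · rintro _ ⟨z, hz, rfl⟩
      refine ⟨(omegaStd n (ψ z) b₂ / w, omegaStd n b₁ (ψ z) / w), ?_, ?_⟩
      · change (omegaStd n (ψ z) b₂ / w) • b₁ + (omegaStd n b₁ (ψ z) / w) • b₂ ∈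
          πS '' (ψ '' {z : EuclideanSpace ℂ (Fin n) | π * ‖z‖ ^ 2 < r})
        rw [← hproj]
        exact ⟨ψ z, ⟨z, hsub z hz, rfl⟩, rfl⟩
      · have h1 := hAc (ψ z)
        simp only [NSq.ci_apply, hA']
        rw [h1.1, h1.2, NSq.om_smul_l, NSq.om_smul_r, ← hcc]
        ext
        · simp; field_simp
        · simp; field_simp
    · rw [NSq.vol_scale]
      have : |c ^ 2| = w := by
        rw [← hcc, abs_of_pos (by positivity)]
        ring
      rwa [this]
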